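/- arXiv:1703.09587 — 4 statements merged into one kernel-verified Lean document; each statement's English description precedes it below -/
import Mathlib

section
/- Fix a positive integer k. As N → ∞, the ensemble average of the trace of the (2k)-th power of a UME matrix satisfies ⟨Tr(M^{2k})⟩ = C_k N^{k+1} + O(N^k), where C_k = (2k)!/(k!(k+1)!) is the k-th Catalan number; i.e. there exist constants c and N₀ (depending on k) such that |⟨Tr(M^{2k})⟩ − C_k N^{k+1}| ≤ c N^k for all N ≥ N₀. -/
open MeasureTheory Matrix

noncomputable section

/-- The uniform probability measure on `[0, 2π)`. -/
def uniformPhase : Measure ℝ :=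
  (ENNReal.ofReal (2 * Real.pi))⁻¹ • volume.restrict (Set.Ico 0 (2 * Real.pi))

/-- Product measure: the phases `ω μ ν` (used for `μ < ν`) are i.i.d. uniform on `[0, 2π)`. -/
def phaseMeasure (N : ℕ) : Measure (Fin N → Fin N → ℝ) :=
  Measure.pi fun _ => Measure.pi fun _ => uniformPhase

/-- Antisymmetrized phases built from a raw sample: `φ ν μ = - φ μ ν`, `φ μ μ = 0`. -/
def phases (N : ℕ) (ω : Fin N → Fin N → ℝ) : Fin N → Fin N → ℝ :=
  fun μ ν => if μ < ν then ω μ ν else if ν < μ then - (ω ν μ) else 0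

/-- The uni-modular matrix with phases `φ`: zero diagonal, `M μ ν = exp(i φ μ ν)` off diagonal. -/
def umeMatrix (N : ℕ) (φ : Fin N → Fin N → ℝ) : Matrix (Fin N) (Fin N) ℂ :=
  fun μ ν => if μ = ν then 0 else Complex.exp (Complex.I * (φ μ ν : ℂ))


namespace UMEProof

variable {α : Type*}

/-- Consecutive pairs of a list. -/
def steps : List α → List (α × α)
  | a :: b :: l => (a, b) :: steps (b :: l)
  | _ => []

theorem steps_append (P Q : List α) (x : α) :
    steps (P ++ x :: Q) = steps (P ++ [x]) ++ steps (x :: Q) := by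
  induction P with
  | nil => simp [steps]
  | cons a P ih =>
    cases P with
    | nil => simp [steps]
    | cons b P => simpa [steps] using ih

theorem mem_of_steps {l : List α} {a b : α} (h : (a, b) ∈ steps l) : a ∈ l ∧ b ∈ l := by
  induction l with
  | nil => simp [steps] at h
  | cons c l ih =>
    cases l with
    | nil => simp [steps] at h
    | cons d l =>
      simp only [steps, List.mem_cons, Prod.mk.injEq] at h
      rcases h with ⟨rfl, rfl⟩ | h
      · simp
      · have := ih h
        simp only [List.mem_cons] at this ⊢
        tauto

/-- Each step is used equally often in both directions. -/
def Balanced [DecidableEq α] (w : List α) : Prop :=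
  ∀ a b, (steps w).count (a, b) = (steps w).count (b, a)

/-- The depth-first contour walk of a labelled tree. -/
def walk (v : α) : BinaryTree α → List α
  | .nil => [v]
  | .node u l r => v :: (walk u l ++ walk v r)

/-- Labels in depth-first order. -/
def labels : BinaryTree α → List α
  | .nil => []
  | .node u l r => u :: (labels l ++ labels r)

theorem labels_length (t : BinaryTree α) : (labels t).length = t.numNodes := by
  induction t with
  | nil => simp [labels]
  | node u l r hl hr => simp [labels, hl, hr]

theorem walk_length (t : BinaryTree α) (v : α) : (walk v t).length = 2 * t.numNodes + 1 := by
  induction t generalizing v with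
  | nil => simp [walk]
  | node u l r hl hr => simp [walk, hl, hr]; ring

theorem walk_head (t : BinaryTree α) (v : α) : ∃ L, walk v t = v :: L := by
  cases t <;> exact ⟨_, rfl⟩

theorem walk_last (t : BinaryTree α) (v : α) : ∃ L, walk v t = L ++ [v] := by
  induction t generalizing v with
  | nil => exact ⟨[], rfl⟩
  | node u l r hl hr =>
    obtain ⟨L, hL⟩ := hr v
    exact ⟨v :: (walk u l ++ L), by simp [walk, hL]⟩

theorem mem_walk (t : BinaryTree α) (v x : α) : x ∈ walk v t ↔ x ∈ v :: labels t := by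
  induction t generalizing v with
  | nil => simp [walk, labels]
  | node u l r hl hr => simp [walk, labels, hl, hr]; tauto

theorem steps_walk_node (u v : α) (l r : BinaryTree α) :
    steps (walk v (.node u l r)) = (v, u) :: steps (walk u l) ++ (u, v) :: steps (walk v r) := by
  obtain ⟨A, hA⟩ := walk_last l u
  obtain ⟨A', hA'⟩ := walk_head l u
  obtain ⟨B, hB⟩ := walk_head r v
  have h1 : steps (walk u l ++ walk v r) = steps (walk u l) ++ (u, v) :: steps (walk v r) := by
    rw [hA, hB, List.append_assoc, List.singleton_append, steps_append]
    simp [steps]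
  rw [walk, List.cons_append, ← h1, hA']
  simp [steps]

theorem walk_balanced [DecidableEq α] (t : BinaryTree α) (v : α) : Balanced (walk v t) := by
  induction t generalizing v with
  | nil => intro a b; simp [walk, steps]
  | node u l r hl hr =>
    intro a b
    have h1 := hl u a b
    have h2 := hr v a b
    rw [steps_walk_node]
    simp only [List.count_append, List.count_cons, h1, h2, beq_iff_eq, Prod.mk.injEq,
      and_comm (a := u = _)]
    omega

theorem walk_noloop (t : BinaryTree α) (v : α) (h : (v :: labels t).Nodup) :
    ∀ a b, (a, b) ∈ steps (walk v t) → a ≠ b := by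
  induction t generalizing v with
  | nil => simp [walk, steps]
  | node u l r hl hr =>
    intro a b hab
    simp only [labels, List.nodup_cons, List.mem_cons, List.mem_append, not_or,
      List.nodup_append] at h
    rw [steps_walk_node] at hab
    simp only [List.cons_append, List.mem_cons, List.mem_append, Prod.mk.injEq] at hab
    rcases hab with ⟨rfl, rfl⟩ | hab | ⟨rfl, rfl⟩ | hab
    · exact h.1.1
    · exact hl u (by simp only [List.nodup_cons]; tauto) a b hab
    · exact fun e => h.1.1 e.symm
    · exact hr v (by simp only [List.nodup_cons]; tauto) a b hab

theorem append_inj_of_notMem {A A' B B' : List α} {v : α} (hA : v ∉ A) (hA' : v ∉ A')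
    (h : A ++ v :: B = A' ++ v :: B') : A = A' ∧ B = B' := by
  induction A generalizing A' with
  | nil =>
    cases A' with
    | nil => simpa using h
    | cons a A' => simp at h hA'; exact absurd h.1 hA'.1
  | cons a A ih =>
    cases A' with
    | nil => simp at h hA; exact absurd h.1.symm hA.1
    | cons b A' =>
      simp only [List.cons_append, List.cons.injEq, List.mem_cons, not_or] at h hA hA'
      obtain ⟨h1, h2⟩ := ih hA.2 hA'.2 h.2
      exact ⟨by rw [h.1, h1], h2⟩

theorem walk_inj (t t' : BinaryTree α) (v : α) (h : (v :: labels t).Nodup)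
    (h' : (v :: labels t').Nodup) (hw : walk v t = walk v t') : t = t' := by
  induction t generalizing v t' with
  | nil =>
    cases t' with
    | nil => rfl
    | node u l r =>
      have := congrArg List.length hw
      rw [walk_length, walk_length] at this
      simp at this
  | node u l r hl hr =>
    cases t' with
    | nil =>
      have := congrArg List.length hw
      rw [walk_length, walk_length] at this
      simp at this
    | node u' l' r' =>
      simp only [labels, List.nodup_cons, List.mem_cons, List.mem_append, not_or,
        List.nodup_append] at h h'
      obtain ⟨B, hB⟩ := walk_head r v
      obtain ⟨B', hB'⟩ := walk_head r' v
      simp only [walk, List.cons.injEq, true_and] at hw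
      have hw2 := hw
      rw [hB, hB'] at hw2
      obtain ⟨e1, e2⟩ := append_inj_of_notMem
        (by rw [mem_walk]; simp only [List.mem_cons]; tauto)
        (by rw [mem_walk]; simp only [List.mem_cons]; tauto) hw2
      have e3 : u = u' := by
        obtain ⟨A, hA⟩ := walk_head l u
        obtain ⟨A', hA'⟩ := walk_head l' u'
        rw [hA, hA'] at e1
        exact (List.cons.inj e1).1
      subst e3
      rw [hl l' u (by simp only [List.nodup_cons]; tauto) (by simp only [List.nodup_cons]; tauto) e1]
      rw [hr r' v (by simp only [List.nodup_cons]; tauto) (by simp only [List.nodup_cons]; tauto)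
        (by rw [hB, hB', e2])]

theorem insert_leaf (t : BinaryTree α) (v x y : α) (P Q : List α)
    (h : walk v t = P ++ x :: Q) :
    ∃ t', walk v t' = P ++ x :: y :: x :: Q ∧ t'.numNodes = t.numNodes + 1 := by
  induction t generalizing v P Q with
  | nil =>
    cases P with
    | nil =>
      simp only [walk, List.nil_append, List.cons.injEq] at h
      obtain ⟨rfl, rfl⟩ := h
      exact ⟨.node y .nil .nil, by simp [walk], by simp⟩
    | cons a P => simp [walk] at h
  | node u l r hl hr =>
    cases P with
    | nil =>
      have h0 := h
      simp only [walk, List.nil_append, List.cons.injEq] at h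
      obtain ⟨rfl, h2⟩ := h
      refine ⟨.node y .nil (.node u l r), ?_, by simp⟩
      rw [walk, h0]; simp [walk]
    | cons a P =>
      simp only [walk, List.cons_append, List.cons.injEq] at h
      obtain ⟨rfl, h⟩ := h
      rcases List.append_eq_append_iff.1 h with ⟨C, h1, h2⟩ | ⟨C, h1, h2⟩
      · obtain ⟨t', e, en⟩ := hr v C Q h2
        exact ⟨.node u l t', by simp [walk, e, h1], by simp [en]; ring⟩
      · cases C with
        | nil =>
          simp only [List.nil_append, List.append_nil] at h1 h2
          obtain ⟨t', e, en⟩ := hr v [] Q h2.symm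
          exact ⟨.node u l t', by simp [walk, e, h1], by simp [en]; ring⟩
        | cons c C =>
          simp only [List.cons_append, List.cons.injEq] at h2
          obtain ⟨rfl, h2⟩ := h2
          obtain ⟨t', e, en⟩ := hl u P C h1
          exact ⟨.node u t' r, by simp [walk, e, h2], by simp [en]; ring⟩

theorem exists_count_one [DecidableEq α] (w : List α) (h : w.length < 2 * w.toFinset.card) :
    ∃ y ∈ w, w.count y = 1 := by
  by_contra! hc
  have h1 : ∑ x ∈ w.toFinset, w.count x = w.length := by
    simp
  have h2 : ∑ x ∈ w.toFinset, 2 ≤ ∑ x ∈ w.toFinset, w.count x := by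
    refine Finset.sum_le_sum fun x hx => ?_
    have hx' := List.mem_toFinset.1 hx
    have := hc x hx'
    have := List.count_pos_iff.2 hx'
    omega
  simp at h2
  omega

theorem walk_surj [DecidableEq α] (k : ℕ) (w : List α) (v : α) (hl : w.length = 2 * k + 1)
    (h1 : w.head? = some v) (h2 : w.getLast? = some v) (hb : Balanced w)
    (hc : k + 1 ≤ w.toFinset.card) : ∃ t, walk v t = w ∧ t.numNodes = k := by
  induction k generalizing w with
  | zero =>
    obtain ⟨a, rfl⟩ := List.length_eq_one_iff.1 (by simpa using hl)
    simp at h1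
    exact ⟨.nil, by simp [walk, h1], rfl⟩
  | succ k ih =>
    obtain ⟨y, hy, hy1⟩ := exists_count_one w (by omega)
    obtain ⟨P', Q', hw⟩ := List.append_of_mem hy
    subst hw
    have hy1' : y ∉ P' ∧ y ∉ Q' := by
      simp only [List.count_append, List.count_cons_self] at hy1
      constructor <;> intro hm <;> have := List.count_pos_iff.2 hm <;> omega
    rcases List.eq_nil_or_concat P' with rfl | ⟨P, x, rfl⟩
    · rcases List.eq_nil_or_concat Q' with rfl | ⟨Q, z, rfl⟩
      · simp at hl
      · simp at h1
        have : z = y := by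
          rw [List.nil_append, List.concat_eq_append, ← List.cons_append, List.getLast?_concat] at h2
          simp at h2; rw [h2, h1]
        simp [this] at hy1'
    · cases Q' with
      | nil =>
        simp at h2
        subst h2
        cases P with
        | nil => simp at h1; simp [h1] at hy1'
        | cons a P => simp at h1; simp [h1] at hy1'
      | cons z Q =>
        simp only [List.append_assoc, List.singleton_append, List.cons_append,
          List.concat_eq_append, List.nil_append] at *
        have hs : steps (P ++ x :: y :: z :: Q) =
            steps (P ++ [x]) ++ (x, y) :: (y, z) :: steps (z :: Q) := by
          rw [steps_append]; simp [steps]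
        have hxz : x = z := by
          have h3 := hb x y
          have h4 : 0 < (steps (P ++ x :: y :: z :: Q)).count (y, x) := by
            rw [← h3, List.count_pos_iff, hs]; simp
          rw [List.count_pos_iff, hs] at h4
          simp only [List.mem_append, List.mem_cons, Prod.mk.injEq] at h4
          rcases h4 with h4 | h4 | h4 | h4
          · exact absurd (mem_of_steps h4).1 (by simpa using hy1'.1)
          · exact absurd h4.2 (by rintro rfl; simp at hy1')
          · exact h4.2
          · exact absurd (mem_of_steps h4).1 (by simpa using hy1'.2)
        subst hxz
        obtain ⟨t, ht, hn⟩ := ih (P ++ x :: Q) (by simp at hl ⊢; omega)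
          (by cases P <;> simpa using h1)
          (by
            rw [show P ++ x :: y :: x :: Q = (P ++ [x, y]) ++ (x :: Q) by simp] at h2
            rw [List.getLast?_append] at h2 ⊢
            cases h : (x :: Q).getLast? with
            | none => simp at h
            | some a => rw [h] at h2; simpa using h2)
          (by
            intro a b
            have h3 := hb a b
            rw [hs] at h3
            rw [steps_append]
            simp only [List.count_append, List.count_cons, beq_iff_eq, Prod.mk.injEq] at h3 ⊢
            have e1 : (x = a ∧ y = b) ↔ (y = b ∧ x = a) := and_comm
            have e2 : (y = a ∧ x = b) ↔ (x = b ∧ y = a) := and_comm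
            simp only [e1, e2] at h3
            omega)
          (by
            have : (P ++ x :: y :: x :: Q).toFinset = insert y (P ++ x :: Q).toFinset := by
              ext a; simp only [List.mem_toFinset, List.mem_append, List.mem_cons, Finset.mem_insert]; tauto
            rw [this] at hc
            have := Finset.card_insert_le y (P ++ x :: Q).toFinset
            omega)
        obtain ⟨t', e, en⟩ := insert_leaf t v x y P Q ht
        exact ⟨t', e, by omega⟩

/-- Fill a tree shape with labels. -/
def fill : BinaryTree Unit → List α → BinaryTree α
  | .nil, _ => .nil
  | .node _ _ _, [] => .nil
  | .node _ l r, u :: L => .node u (fill l (L.take l.numNodes)) (fill r (L.drop l.numNodes))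

theorem shape_fill (s : BinaryTree Unit) (L : List α) (h : L.length = s.numNodes) :
    (fill s L).map (fun _ => ()) = s := by
  induction s generalizing L with
  | nil => simp [fill, BinaryTree.map]
  | node u l r hl hr =>
    cases L with
    | nil => simp at h
    | cons a L =>
      simp at h
      simp only [fill, BinaryTree.map]
      rw [hl _ (by simp; omega), hr _ (by simp; omega)]

theorem labels_fill (s : BinaryTree Unit) (L : List α) (h : L.length = s.numNodes) :
    labels (fill s L) = L := by
  induction s generalizing L with
  | nil => simp at h; simp [fill, labels, h]
  | node u l r hl hr =>
    cases L with
    | nil => simp at h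
    | cons a L =>
      simp at h
      simp only [fill, labels]
      rw [hl _ (by simp; omega), hr _ (by simp; omega)]
      simp

theorem numNodes_map (t : BinaryTree α) : (t.map (fun _ => ())).numNodes = t.numNodes := by
  induction t with
  | nil => simp [BinaryTree.map]
  | node u l r hl hr => simp [BinaryTree.map, hl, hr]

theorem fill_labels (t : BinaryTree α) : fill (t.map (fun _ => ())) (labels t) = t := by
  induction t with
  | nil => simp [fill, BinaryTree.map]
  | node u l r hl hr =>
    have h1 : List.take l.numNodes (labels l ++ labels r) = labels l := by
      rw [← labels_length]; simp
    have h2 : List.drop l.numNodes (labels l ++ labels r) = labels r := by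
      rw [← labels_length]; simp
    simp only [fill, BinaryTree.map, labels, numNodes_map, h1, h2, hl, hr]

/-- All lists of length `n`. -/
def lists (α : Type*) [Fintype α] [DecidableEq α] : ℕ → Finset (List α)
  | 0 => {[]}
  | n + 1 => (Finset.univ ×ˢ lists α n).image (fun p : α × List α => p.1 :: p.2)

section
variable [Fintype α] [DecidableEq α]

theorem sum_lists_succ {β : Type*} [AddCommMonoid β] (n : ℕ) (f : List α → β) :
    ∑ w ∈ lists α (n + 1), f w = ∑ a, ∑ w ∈ lists α n, f (a :: w) := by
  rw [lists, Finset.sum_image, Finset.sum_product]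
  rintro ⟨a, l⟩ _ ⟨b, m⟩ _ h
  simpa using h

theorem mem_lists (n : ℕ) (w : List α) : w ∈ lists α n ↔ w.length = n := by
  induction n generalizing w with
  | zero => simp [lists]
  | succ n ih => cases w <;> simp [lists, ih]

theorem card_lists (n : ℕ) : (lists α n).card = Fintype.card α ^ n := by
  induction n with
  | zero => simp [lists]
  | succ n ih =>
    rw [Finset.card_eq_sum_ones, sum_lists_succ]
    simp [ih]; ring

theorem card_small (n k : ℕ) (hn : 1 ≤ n) :
    ((lists α n).filter (fun w => w.toFinset.card ≤ k)).card ≤ k ^ n * Fintype.card α ^ k := by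
  have hsub : (lists α n).filter (fun w => w.toFinset.card ≤ k) ⊆
      ((lists (Fin k) n) ×ˢ (Finset.univ : Finset (Fin k → α))).image
        (fun p => p.1.map p.2) := by
    intro w hw
    simp only [Finset.mem_filter, mem_lists] at hw
    obtain ⟨hwl, hwc⟩ := hw
    simp only [Finset.mem_image, Finset.mem_product, mem_lists, Finset.mem_univ, and_true,
      Prod.exists]
    rcases w.eq_nil_or_concat with rfl | ⟨w', a, hwa⟩
    · simp at hwl; omega
    · obtain ⟨e⟩ : Nonempty (w.toFinset ↪ Fin k) :=
        Function.Embedding.nonempty_of_card_le (by rw [Fintype.card_coe, Fintype.card_fin]; exact hwc)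
      have : Nonempty w.toFinset := ⟨⟨a, by simp [hwa]⟩⟩
      refine ⟨w.attach.map (fun x => e ⟨x.1, List.mem_toFinset.2 x.2⟩),
        fun i => (Function.invFun e i).1, by simp [hwl], ?_⟩
      rw [List.map_map]
      have : (fun i => (Function.invFun e i).1) ∘ (fun x : {x // x ∈ w} => e ⟨x.1, List.mem_toFinset.2 x.2⟩)
          = fun x => x.1 := by
        funext x
        simp [Function.leftInverse_invFun e.injective _]
      rw [this]
      simp
  refine (Finset.card_le_card hsub).trans (Finset.card_image_le.trans ?_)
  simp [card_lists]

/-- The walks contributing to the averaged trace. -/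
def Good (w : List α) : Prop :=
  w.head? = w.getLast? ∧ (∀ a b, (a, b) ∈ steps w → a ≠ b) ∧ Balanced w

open Classical in
theorem card_big (k : ℕ) :
    (((lists α (2 * k + 1)).filter Good).filter (fun w => ¬ w.toFinset.card ≤ k)).card
      = catalan k * ((lists α (k + 1)).filter List.Nodup).card := by
  rw [← BinaryTree.treesOfNumNodesEq_card_eq_catalan, ← Finset.card_product]
  symm
  refine Finset.card_bij (fun p _ => match p.2 with
    | [] => []
    | v :: L => walk v (fill p.1 L)) ?_ ?_ ?_
  · rintro ⟨s, L⟩ h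
    simp only [Finset.mem_product, BinaryTree.mem_treesOfNumNodesEq, Finset.mem_filter,
      mem_lists] at h
    obtain ⟨hs, hl, hn⟩ := h
    cases L with
    | nil => simp at hl
    | cons v L =>
      simp at hl
      have e1 := shape_fill s L (by omega)
      have e2 := labels_fill s L (by omega)
      have e3 : (fill s L).numNodes = k := by rw [← numNodes_map, e1, hs]
      simp only [Finset.mem_filter, mem_lists, not_le]
      refine ⟨⟨by rw [walk_length, e3], ?_, walk_noloop _ _ (by rwa [e2]), walk_balanced _ _⟩, ?_⟩
      · obtain ⟨A, hA⟩ := walk_head (fill s L) v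
        obtain ⟨B, hB⟩ := walk_last (fill s L) v
        rw [hB, List.getLast?_concat, ← hB, hA]; rfl
      · have : (walk v (fill s L)).toFinset = (v :: L).toFinset := by
          ext x; rw [List.mem_toFinset, mem_walk, e2, List.mem_toFinset]
        rw [this, List.toFinset_card_of_nodup hn]
        simp [hl]
  · rintro ⟨s, L⟩ h ⟨s', L'⟩ h' he
    simp only [Finset.mem_product, BinaryTree.mem_treesOfNumNodesEq, Finset.mem_filter,
      mem_lists] at h h'
    obtain ⟨hs, hl, hn⟩ := h
    obtain ⟨hs', hl', hn'⟩ := h'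
    cases L with
    | nil => simp at hl
    | cons v L =>
      cases L' with
      | nil => simp at hl'
      | cons v' L' =>
        simp at hl hl'
        simp only at he
        have e1 := shape_fill s L (by omega)
        have e2 := labels_fill s L (by omega)
        have e1' := shape_fill s' L' (by omega)
        have e2' := labels_fill s' L' (by omega)
        have hv : v = v' := by
          obtain ⟨A, hA⟩ := walk_head (fill s L) v
          obtain ⟨A', hA'⟩ := walk_head (fill s' L') v'
          rw [hA, hA'] at he
          exact (List.cons.inj he).1
        subst hv
        have := walk_inj _ _ v (by rwa [e2]) (by rwa [e2']) he
        have f1 : s = s' := by rw [← e1, ← e1', this]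
        have f2 : L = L' := by rw [← e2, ← e2', this]
        rw [f1, f2]
  · intro w hw
    simp only [Finset.mem_filter, mem_lists, not_le] at hw
    obtain ⟨⟨hl, hh, _, hb⟩, hc⟩ := hw
    obtain ⟨v, hv⟩ : ∃ v, w.head? = some v := by
      cases w with
      | nil => simp at hl
      | cons a w => exact ⟨a, rfl⟩
    obtain ⟨t, ht, hn⟩ := walk_surj k w v hl hv (by rw [← hh, hv]) hb hc
    refine ⟨(t.map (fun _ => ()), v :: labels t), ?_, ?_⟩
    · simp only [Finset.mem_product, BinaryTree.mem_treesOfNumNodesEq, Finset.mem_filter,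
        mem_lists, numNodes_map, List.length_cons, labels_length, hn, true_and]
      have hw : w.toFinset = (v :: labels t).toFinset := by
        ext x; rw [← ht, List.mem_toFinset, mem_walk, List.mem_toFinset]
      rw [hw] at hc
      rw [← Multiset.coe_nodup, ← Multiset.toFinset_card_eq_card_iff_nodup]
      have h1 := List.toFinset_card_le (v :: labels t)
      have h2 : (v :: labels t).length = k + 1 := by simp [labels_length, hn]
      change (v :: labels t).toFinset.card = (v :: labels t).length
      omega
    · simp only [fill_labels, ht]

open Classical in
theorem card_good_bounds (k : ℕ) :
    ((lists α (2 * k + 1)).filter Good).card ≤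
      catalan k * Fintype.card α ^ (k + 1) + k ^ (2 * k + 1) * Fintype.card α ^ k ∧
    catalan k * Fintype.card α ^ (k + 1) ≤ ((lists α (2 * k + 1)).filter Good).card +
      catalan k * k ^ (k + 1) * Fintype.card α ^ k := by
  have h1 := Finset.card_filter_add_card_filter_not
    (s := (lists α (2 * k + 1)).filter Good) (fun w => w.toFinset.card ≤ k)
  have h2 : (((lists α (2 * k + 1)).filter Good).filter (fun w => w.toFinset.card ≤ k)).card
      ≤ k ^ (2 * k + 1) * Fintype.card α ^ k :=
    (Finset.card_le_card (Finset.filter_subset_filter _ (Finset.filter_subset _ _))).trans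
      (card_small (α := α) (2 * k + 1) k (by omega))
  have h3 := card_big (α := α) k
  have h4 := Finset.card_filter_add_card_filter_not
    (s := lists α (k + 1)) (fun w => w.Nodup)
  have h5 : ((lists α (k + 1)).filter (fun w => ¬ w.Nodup)).card
      ≤ k ^ (k + 1) * Fintype.card α ^ k := by
    refine (Finset.card_le_card ?_).trans (card_small (α := α) (k + 1) k (by omega))
    intro w hw
    simp only [Finset.mem_filter, mem_lists] at hw ⊢
    refine ⟨hw.1, ?_⟩
    by_contra hc
    apply hw.2
    rw [← Multiset.coe_nodup, ← Multiset.toFinset_card_eq_card_iff_nodup]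
    have h1 := List.toFinset_card_le w
    change w.toFinset.card = w.length
    omega
  rw [card_lists] at h4
  have h6 : catalan k * Fintype.card α ^ (k + 1) =
      catalan k * ((lists α (k + 1)).filter List.Nodup).card +
      catalan k * ((lists α (k + 1)).filter (fun w => ¬ w.Nodup)).card := by
    rw [← mul_add, h4]
  have h7 := Nat.mul_le_mul_left (catalan k) h5
  rw [← mul_assoc] at h7
  constructor
  · omega
  · omega

end

end UMEProof

namespace UMEProof

/-- Product of matrix entries along a list of steps. -/
def wt {N : ℕ} (M : Matrix (Fin N) (Fin N) ℂ) (S : List (Fin N × Fin N)) : ℂ :=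
  (S.map (fun p => M p.1 p.2)).prod

theorem pow_apply_walks {N : ℕ} (M : Matrix (Fin N) (Fin N) ℂ) (n : ℕ) (i j : Fin N) :
    (M ^ n) i j = ∑ L ∈ lists (Fin N) n,
      if (i :: L).getLast? = some j then wt M (steps (i :: L)) else 0 := by
  induction n generalizing i with
  | zero => simp [lists, steps, wt, Matrix.one_apply]
  | succ n ih =>
    rw [pow_succ', Matrix.mul_apply, sum_lists_succ]
    refine Finset.sum_congr rfl fun b _ => ?_
    rw [ih, Finset.mul_sum]
    refine Finset.sum_congr rfl fun L _ => ?_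
    rw [List.getLast?_cons_cons, mul_ite, mul_zero]
    simp [steps, wt]

theorem trace_pow_walks {N : ℕ} (M : Matrix (Fin N) (Fin N) ℂ) (n : ℕ) :
    (M ^ n).trace = ∑ w ∈ lists (Fin N) (n + 1),
      if w.head? = w.getLast? then wt M (steps w) else 0 := by
  rw [sum_lists_succ, Matrix.trace]
  refine Finset.sum_congr rfl fun i _ => ?_
  rw [Matrix.diag_apply, pow_apply_walks]
  refine Finset.sum_congr rfl fun L _ => ?_
  simp [eq_comm]

/-- Net multiplicity of the phase `ω a b` in a product along steps. -/
def mult {N : ℕ} (S : List (Fin N × Fin N)) (a b : Fin N) : ℤ :=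
  if a < b then (S.count (a, b) : ℤ) - S.count (b, a) else 0

theorem entry_eq {N : ℕ} (ω : Fin N → Fin N → ℝ) (a b : Fin N) (h : a ≠ b) :
    umeMatrix N (phases N ω) a b =
      ∏ c, ∏ d, Complex.exp (Complex.I * (mult [(a, b)] c d : ℂ) * (ω c d : ℂ)) := by
  rcases lt_or_gt_of_ne h with h' | h'
  · rw [Finset.prod_eq_single a, Finset.prod_eq_single b]
    · have : (b, a) ≠ (a, b) := by simp [h]
      simp [umeMatrix, phases, mult, h, h', List.count_cons, h.symm]
    · intro d _ hd
      have : mult [(a, b)] a d = 0 := by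
        simp only [mult, List.count_cons, List.count_nil, beq_iff_eq, Prod.mk.injEq]
        grind
      simp [this]
    · simp
    · intro c _ hc
      refine Finset.prod_eq_one fun d _ => ?_
      have : mult [(a, b)] c d = 0 := by
        simp only [mult, List.count_cons, List.count_nil, beq_iff_eq, Prod.mk.injEq]
        grind
      simp [this]
    · simp
  · rw [Finset.prod_eq_single b, Finset.prod_eq_single a]
    · simp [umeMatrix, phases, mult, h, h', List.count_cons, h.symm, not_lt.2 h'.le]
    · intro d _ hd
      have : mult [(a, b)] b d = 0 := by
        simp only [mult, List.count_cons, List.count_nil, beq_iff_eq, Prod.mk.injEq]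
        grind
      simp [this]
    · simp
    · intro c _ hc
      refine Finset.prod_eq_one fun d _ => ?_
      have : mult [(a, b)] c d = 0 := by
        simp only [mult, List.count_cons, List.count_nil, beq_iff_eq, Prod.mk.injEq]
        grind
      simp [this]
    · simp

theorem wt_eq {N : ℕ} (ω : Fin N → Fin N → ℝ) (S : List (Fin N × Fin N))
    (h : ∀ a b, (a, b) ∈ S → a ≠ b) :
    wt (umeMatrix N (phases N ω)) S =
      ∏ c, ∏ d, Complex.exp (Complex.I * (mult S c d : ℂ) * (ω c d : ℂ)) := by
  induction S with
  | nil => simp [wt, mult]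
  | cons p S ih =>
    obtain ⟨a, b⟩ := p
    have h1 : wt (umeMatrix N (phases N ω)) ((a, b) :: S) =
      umeMatrix N (phases N ω) a b * wt (umeMatrix N (phases N ω)) S := by simp [wt]
    rw [h1, ih (fun c d hcd => h c d (List.mem_cons_of_mem _ hcd)),
      entry_eq ω a b (h a b (by simp)), ← Finset.prod_mul_distrib]
    refine Finset.prod_congr rfl fun c _ => ?_
    rw [← Finset.prod_mul_distrib]
    refine Finset.prod_congr rfl fun d _ => ?_
    rw [← Complex.exp_add]
    have : mult ((a, b) :: S) c d = mult [(a, b)] c d + mult S c d := by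
      simp only [mult, List.count_cons, List.count_nil]
      split_ifs <;> push_cast <;> ring
    rw [this]
    push_cast
    congr 1
    ring

theorem wt_loop {N : ℕ} (ω : Fin N → Fin N → ℝ) (S : List (Fin N × Fin N))
    (h : ¬ ∀ a b, (a, b) ∈ S → a ≠ b) : wt (umeMatrix N (phases N ω)) S = 0 := by
  push Not at h
  obtain ⟨a, b, hab, rfl⟩ := h
  refine List.prod_eq_zero ?_
  rw [List.mem_map]
  exact ⟨(a, a), hab, by simp [umeMatrix]⟩

instance uniformPhase_prob : IsProbabilityMeasure uniformPhase := by
  constructor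
  have : (0 : ℝ) < 2 * Real.pi := by positivity
  simp only [uniformPhase, Measure.smul_apply, Measure.restrict_apply MeasurableSet.univ,
    Set.univ_inter, Real.volume_Ico, sub_zero, smul_eq_mul]
  exact ENNReal.inv_mul_cancel (by simpa using Real.pi_pos) ENNReal.ofReal_ne_top

instance phaseMeasure_prob (N : ℕ) : IsProbabilityMeasure (phaseMeasure N) := by
  unfold phaseMeasure; infer_instance

theorem integral_phase (m : ℤ) :
    ∫ x, Complex.exp (Complex.I * (m : ℂ) * (x : ℂ)) ∂uniformPhase = if m = 0 then 1 else 0 := by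
  split_ifs with h
  · simp [h]
  · have hc : Complex.I * (m : ℂ) ≠ 0 := by simp [h]
    rw [uniformPhase, integral_smul_measure, integral_Ico_eq_integral_Ioc,
      ← intervalIntegral.integral_of_le (by positivity), integral_exp_mul_complex hc]
    have : Complex.exp (Complex.I * (m : ℂ) * ((2 * Real.pi : ℝ) : ℂ)) = 1 := by
      rw [Complex.exp_eq_one_iff]
      exact ⟨m, by push_cast; ring⟩
    rw [this]
    simp

open Classical in
theorem integral_wt {N : ℕ} (w : List (Fin N)) :
    ∫ ω, wt (umeMatrix N (phases N ω)) (steps w) ∂(phaseMeasure N) =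
      if (∀ a b, (a, b) ∈ steps w → a ≠ b) ∧ Balanced w then 1 else 0 := by
  by_cases h : ∀ a b, (a, b) ∈ steps w → a ≠ b
  · simp_rw [fun ω => wt_eq ω _ h]
    rw [phaseMeasure, integral_fintype_prod_eq_prod (𝕜 := ℂ)
      (fun c (x : Fin N → ℝ) => ∏ d, Complex.exp (Complex.I * (mult (steps w) c d : ℂ) * (x d : ℂ)))]
    simp_rw [fun c => integral_fintype_prod_eq_prod (𝕜 := ℂ) (μ := fun _ : Fin N => uniformPhase)
      (fun d (x : ℝ) => Complex.exp (Complex.I * (mult (steps w) c d : ℂ) * (x : ℂ))),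
      integral_phase]
    by_cases hb : Balanced w
    · rw [if_pos ⟨h, hb⟩]
      refine Finset.prod_eq_one fun c _ => Finset.prod_eq_one fun d _ => ?_
      simp [mult, hb c d]
    · rw [if_neg (fun h => hb h.2)]
      have : ∃ c d, mult (steps w) c d ≠ 0 := by
        by_contra! hm
        apply hb
        intro a b
        have h1 := hm a b
        have h2 := hm b a
        simp only [mult] at h1 h2
        rcases lt_trichotomy a b with hab | rfl | hab
        · rw [if_pos hab] at h1; omega
        · rfl
        · rw [if_pos hab] at h2; omega
      obtain ⟨c, d, hcd⟩ := this
      exact Finset.prod_eq_zero (Finset.mem_univ c)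
        (Finset.prod_eq_zero (Finset.mem_univ d) (if_neg hcd))
  · simp_rw [fun ω => wt_loop ω _ h]
    simp [h]

theorem integrable_wt {N : ℕ} (w : List (Fin N)) :
    Integrable (fun ω => wt (umeMatrix N (phases N ω)) (steps w)) (phaseMeasure N) := by
  by_cases h : ∀ a b, (a, b) ∈ steps w → a ≠ b
  · simp_rw [fun ω => wt_eq ω _ h]
    refine Integrable.of_bound (C := 1) ?_ ?_
    · apply Measurable.aestronglyMeasurable
      fun_prop
    · refine Filter.Eventually.of_forall fun ω => ?_
      rw [norm_prod]
      refine (Finset.prod_eq_one fun c _ => ?_).le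
      rw [norm_prod]
      refine Finset.prod_eq_one fun d _ => ?_
      rw [Complex.norm_exp]
      simp
  · simp_rw [fun ω => wt_loop ω _ h]
    simp

open Classical in
theorem integral_trace (N n : ℕ) :
    ∫ ω, Matrix.trace ((umeMatrix N (phases N ω)) ^ n) ∂(phaseMeasure N) =
      (((lists (Fin N) (n + 1)).filter Good).card : ℂ) := by
  simp_rw [trace_pow_walks]
  rw [integral_finsetSum]
  · rw [Finset.card_filter]
    push_cast
    refine Finset.sum_congr rfl fun w _ => ?_
    by_cases h : w.head? = w.getLast?
    · simp only [h, if_true, integral_wt, Good, true_and]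
    · simp [h, Good]
  · intro w _
    split_ifs
    · exact integrable_wt w
    · simp

end UMEProof

/-- For fixed `k ≥ 1`, `⟨Tr(M^{2k})⟩ = C_k N^{k+1} + O(N^k)` as `N → ∞`,
where `C_k` is the `k`-th Catalan number. -/
theorem ume_even_trace_asymptotics (k : ℕ) (hk : 1 ≤ k) :
    ∃ (c : ℝ) (N₀ : ℕ), ∀ N ≥ N₀,
      ‖(∫ ω, Matrix.trace ((umeMatrix N (phases N ω)) ^ (2 * k)) ∂(phaseMeasure N))
          - (catalan k : ℂ) * (N : ℂ) ^ (k + 1)‖ ≤ c * (N : ℝ) ^ k := by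
  classical
  refine ⟨(k : ℝ) ^ (2 * k + 1) + (catalan k : ℝ) * (k : ℝ) ^ (k + 1), 0, fun N _ => ?_⟩
  rw [UMEProof.integral_trace]
  obtain ⟨h1, h2⟩ := UMEProof.card_good_bounds (α := Fin N) k
  rw [Fintype.card_fin] at h1 h2
  set A := ((UMEProof.lists (Fin N) (2 * k + 1)).filter UMEProof.Good).card
  have e : ((A : ℂ) - (catalan k : ℂ) * (N : ℂ) ^ (k + 1)) =
      (((A : ℝ) - (catalan k : ℝ) * (N : ℝ) ^ (k + 1) : ℝ) : ℂ) := by push_cast; rfl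
  rw [e, Complex.norm_real, Real.norm_eq_abs, abs_le]
  have h1' : (A : ℝ) ≤ catalan k * (N : ℝ) ^ (k + 1) + (k : ℝ) ^ (2 * k + 1) * (N : ℝ) ^ k := by
    exact_mod_cast h1
  have h2' : (catalan k : ℝ) * (N : ℝ) ^ (k + 1) ≤
      A + catalan k * (k : ℝ) ^ (k + 1) * (N : ℝ) ^ k := by
    exact_mod_cast h2
  have p1 : 0 ≤ (k : ℝ) ^ (2 * k + 1) * (N : ℝ) ^ k := by positivity
  have p2 : 0 ≤ (catalan k : ℝ) * (k : ℝ) ^ (k + 1) * (N : ℝ) ^ k := by positivity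
  constructor <;> nlinarith
end
end

section
/- Fix a positive integer k and positive integers n₁, …, n_k with n₁ + ⋯ + n_k even, and set s = k + (n₁ + ⋯ + n_k)/2. As N → ∞, the averages of products of traces over the UME and over the GUE agree to leading order in N: ⟨Tr(M^{n₁}) ⋯ Tr(M^{n_k})⟩_UME − ⟨Tr(H^{n₁}) ⋯ Tr(H^{n_k})⟩_GUE = O(N^{s−1}). -/
open MeasureTheory Matrix

noncomputable section

/-- The GUE matrix built from a sample of i.i.d. standard real Gaussians: real standard
Gaussian diagonal, off-diagonal real and imaginary parts of variance `1/2`. -/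
def gueMatrix (N : ℕ) (ω : Fin N → Fin N → ℝ) : Matrix (Fin N) (Fin N) ℂ :=
  fun μ ν =>
    if μ = ν then (ω μ μ : ℂ)
    else if μ < ν then ((ω μ ν : ℂ) + Complex.I * (ω ν μ : ℂ)) / (Real.sqrt 2 : ℂ)
    else ((ω ν μ : ℂ) - Complex.I * (ω μ ν : ℂ)) / (Real.sqrt 2 : ℂ)

/-- Product measure of i.i.d. standard real Gaussians, the sample space for the GUE. -/
def gueMeasure (N : ℕ) : Measure (Fin N → Fin N → ℝ) :=
  Measure.pi fun _ => Measure.pi fun _ => ProbabilityTheory.gaussianReal 0 1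

/-- i.i.d. product measure. -/
def PM (ν : Measure ℝ) (N : ℕ) : Measure (Fin N → Fin N → ℝ) :=
  Measure.pi fun _ => Measure.pi fun _ => ν

instance PM_prob (ν : Measure ℝ) [IsProbabilityMeasure ν] (N : ℕ) :
    IsProbabilityMeasure (PM ν N) := by unfold PM; infer_instance

lemma PM_eval (ν : Measure ℝ) [IsProbabilityMeasure ν] (N : ℕ) (u v : Fin N) :
    MeasurePreserving (fun ω : Fin N → Fin N → ℝ => ω u v) (PM ν N) ν :=
  (measurePreserving_eval (fun _ : Fin N => ν) v).comp
    (measurePreserving_eval (fun _ : Fin N => Measure.pi fun _ : Fin N => ν) u)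

lemma PM_indep (ν : Measure ℝ) [IsProbabilityMeasure ν] (N : ℕ) :
    ProbabilityTheory.iIndepFun (fun (q : Fin N × Fin N) (ω : Fin N → Fin N → ℝ) => ω q.1 q.2)
      (PM ν N) := by
  refine ProbabilityTheory.iIndepFun_uncurry' (X := fun i j (ω : Fin N → Fin N → ℝ) => ω i j)
    (fun i j => by fun_prop) ?_ ?_
  · exact ProbabilityTheory.iIndepFun_pi (μ := fun _ : Fin N => Measure.pi fun _ : Fin N => ν)
      (X := fun i (y : Fin N → ℝ) => y) (fun i => by fun_prop)
  · intro i
    have hm := measurePreserving_eval (fun _ : Fin N => Measure.pi fun _ : Fin N => ν) i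
    rw [ProbabilityTheory.iIndepFun_iff_map_fun_eq_pi_map
      (fun j => (PM_eval ν N i j).measurable.aemeasurable)]
    refine hm.map_eq.trans ?_
    congr 1
    funext j
    exact (PM_eval ν N i j).map_eq.symm

lemma PM_fac2 (ν : Measure ℝ) [IsProbabilityMeasure ν] (N : ℕ)
    (f g : (Fin N → Fin N → ℝ) → ℂ) (hf : Measurable f) (hg : Measurable g)
    (S T : Finset (Fin N × Fin N)) (hST : Disjoint S T)
    (hfS : ∀ ω ω', (∀ q ∈ S, ω q.1 q.2 = ω' q.1 q.2) → f ω = f ω')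
    (hgT : ∀ ω ω', (∀ q ∈ T, ω q.1 q.2 = ω' q.1 q.2) → g ω = g ω') :
    ∫ ω, f ω * g ω ∂(PM ν N) = (∫ ω, f ω ∂(PM ν N)) * ∫ ω, g ω ∂(PM ν N) := by
  classical
  have h := (PM_indep ν N).indepFun_finset S T hST (fun q => by fun_prop)
  let ext : (S : Finset (Fin N × Fin N)) → (S → ℝ) → (Fin N → Fin N → ℝ) :=
    fun S y u v => if hq : (u, v) ∈ S then y ⟨(u, v), hq⟩ else 0
  have hext : ∀ S, Measurable (ext S) := by
    intro S
    refine measurable_pi_lambda _ fun u => measurable_pi_lambda _ fun v => ?_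
    by_cases hq : (u, v) ∈ S
    · simp only [ext, hq, dite_true]; fun_prop
    · simp only [ext, hq, dite_false]; fun_prop
  have h2 := h.comp (hf.comp (hext S)) (hg.comp (hext T))
  have e1 : (f ∘ ext S) ∘ (fun ω (i : S) => ω i.1.1 i.1.2) = f := by
    funext ω
    refine hfS _ _ fun q hq => ?_
    simp [ext, hq]
  have e2 : (g ∘ ext T) ∘ (fun ω (i : T) => ω i.1.1 i.1.2) = g := by
    funext ω
    refine hgT _ _ fun q hq => ?_
    simp [ext, hq]
  rw [e1, e2] at h2
  exact h2.integral_fun_mul_eq_mul_integral hf.aestronglyMeasurable hg.aestronglyMeasurable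

lemma PM_fac (ν : Measure ℝ) [IsProbabilityMeasure ν] (N : ℕ)
    (g : Sym2 (Fin N) → (Fin N → Fin N → ℝ) → ℂ) (hg : ∀ p, Measurable (g p))
    (hd : ∀ p ω ω', (∀ q : Fin N × Fin N, s(q.1, q.2) = p → ω q.1 q.2 = ω' q.1 q.2) →
      g p ω = g p ω') (T : Finset (Sym2 (Fin N))) :
    ∫ ω, ∏ p ∈ T, g p ω ∂(PM ν N) = ∏ p ∈ T, ∫ ω, g p ω ∂(PM ν N) := by
  classical
  induction T using Finset.induction_on with
  | empty => simp
  | insert p T hp ih =>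
    simp_rw [Finset.prod_insert hp]
    rw [← ih]
    refine PM_fac2 ν N _ _ (hg p) (by fun_prop) (Finset.univ.filter fun q => s(q.1, q.2) = p)
      (Finset.univ.filter fun q => s(q.1, q.2) ∈ T) ?_ ?_ ?_
    · rw [Finset.disjoint_left]
      intro q h1 h2
      simp only [Finset.mem_filter, Finset.mem_univ, true_and] at h1 h2
      exact hp (h1 ▸ h2)
    · intro ω ω' h
      exact hd p ω ω' fun q hq => h q (by simpa using hq)
    · intro ω ω' h
      refine Finset.prod_congr rfl fun p' hp' => hd p' ω ω' fun q hq => h q ?_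
      simp only [Finset.mem_filter, Finset.mem_univ, true_and]
      exact hq ▸ hp'

structure Good (ν : Measure ℝ)
    (X : ∀ N, (Fin N → Fin N → ℝ) → Matrix (Fin N) (Fin N) ℂ) : Prop where
  meas : ∀ N u v, Measurable (fun ω => X N ω u v)
  dep : ∀ N u v ω ω', ω u v = ω' u v → ω v u = ω' v u → X N ω u v = X N ω' u v
  int : ∀ N m u v, Integrable (fun ω => ‖X N ω u v‖ ^ m) (PM ν N)
  bnd : ∀ m : ℕ, ∃ C : ℝ, ∀ N u v, ∫ ω, ‖X N ω u v‖ ^ m ∂(PM ν N) ≤ C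
  mean : ∀ N u v, ∫ ω, X N ω u v ∂(PM ν N) = 0
  sq : ∀ N u v, u ≠ v → ∫ ω, X N ω u v * X N ω u v ∂(PM ν N) = 0
  abs : ∀ N u v, u ≠ v → ∫ ω, X N ω u v * X N ω v u ∂(PM ν N) = 1

lemma Good.fac {ν : Measure ℝ} [IsProbabilityMeasure ν]
    {X : ∀ N, (Fin N → Fin N → ℝ) → Matrix (Fin N) (Fin N) ℂ} (h : Good ν X)
    {ι : Type*} [Fintype ι] {N : ℕ} (a b : ι → Fin N) :
    ∫ ω, ∏ e, X N ω (a e) (b e) ∂(PM ν N) =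
      ∏ p : Sym2 (Fin N), ∫ ω, ∏ e with s(a e, b e) = p, X N ω (a e) (b e) ∂(PM ν N) := by
  classical
  rw [← PM_fac]
  · congr 1
    funext ω
    rw [Finset.prod_fiberwise]
  · intro p
    have := h.meas
    exact Finset.measurable_prod _ fun e _ => this _ _ _
  · intro p ω ω' hp
    refine Finset.prod_congr rfl fun e he => ?_
    simp only [Finset.mem_filter, Finset.mem_univ, true_and] at he
    exact h.dep _ _ _ _ _ (hp (a e, b e) he) (hp (b e, a e) (by rw [Sym2.eq_swap]; exact he))

lemma Good.zero {ν : Measure ℝ} [IsProbabilityMeasure ν]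
    {X : ∀ N, (Fin N → Fin N → ℝ) → Matrix (Fin N) (Fin N) ℂ} (h : Good ν X)
    {ι : Type*} [Fintype ι] {N : ℕ} (a b : ι → Fin N) (p : Sym2 (Fin N))
    (hp : (Finset.univ.filter fun e => s(a e, b e) = p).card = 1) :
    ∫ ω, ∏ e, X N ω (a e) (b e) ∂(PM ν N) = 0 := by
  classical
  rw [h.fac, Finset.prod_eq_zero (Finset.mem_univ p)]
  obtain ⟨e, he⟩ := Finset.card_eq_one.1 hp
  rw [he]
  simpa using h.mean N (a e) (b e)

lemma Good.eq {ν ν' : Measure ℝ} [IsProbabilityMeasure ν] [IsProbabilityMeasure ν']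
    {X X' : ∀ N, (Fin N → Fin N → ℝ) → Matrix (Fin N) (Fin N) ℂ} (h : Good ν X) (h' : Good ν' X')
    {ι : Type*} [Fintype ι] {N : ℕ} (a b : ι → Fin N)
    (hp : (∃ p, (Finset.univ.filter fun e => s(a e, b e) = p).card = 1) ∨
      ∀ p, (Finset.univ.filter fun e => s(a e, b e) = p).card = 0 ∨
        ((Finset.univ.filter fun e => s(a e, b e) = p).card = 2 ∧ ¬ p.IsDiag)) :
    ∫ ω, ∏ e, X N ω (a e) (b e) ∂(PM ν N) = ∫ ω, ∏ e, X' N ω (a e) (b e) ∂(PM ν' N) := by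
  classical
  rcases hp with ⟨p, hp⟩ | hp
  · rw [h.zero a b p hp, h'.zero a b p hp]
  rw [h.fac, h'.fac]
  refine Finset.prod_congr rfl fun p _ => ?_
  rcases hp p with hp | ⟨hp, hd⟩
  · rw [Finset.card_eq_zero] at hp
    rw [hp]; simp
  · obtain ⟨e, e', hne, he⟩ := Finset.card_eq_two.1 hp
    have m1 : s(a e, b e) = p := by
      have : e ∈ Finset.univ.filter fun e => s(a e, b e) = p := by rw [he]; simp
      simpa using this
    have m2 : s(a e', b e') = p := by
      have : e' ∈ Finset.univ.filter fun e => s(a e, b e) = p := by rw [he]; simp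
      simpa using this
    rw [he]
    simp_rw [Finset.prod_pair hne]
    have hab : a e ≠ b e := by
      rw [← m1] at hd
      simpa using hd
    rw [← m1, Sym2.eq_iff] at m2
    rcases m2 with ⟨h1, h2⟩ | ⟨h1, h2⟩
    · rw [h1, h2, h.sq _ _ _ hab, h'.sq _ _ _ hab]
    · rw [h1, h2, h.abs _ _ _ hab, h'.abs _ _ _ hab]

lemma prod_norm_le {ι : Type*} [Fintype ι] [Nonempty ι] (f : ι → ℂ) :
    ‖∏ e, f e‖ ≤ ∑ e, ‖f e‖ ^ Fintype.card ι := by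
  obtain ⟨e₀, -, he⟩ := Finset.exists_max_image Finset.univ (fun e => ‖f e‖) Finset.univ_nonempty
  rw [norm_prod]
  calc ∏ e, ‖f e‖ ≤ ∏ _e : ι, ‖f e₀‖ :=
        Finset.prod_le_prod (fun _ _ => norm_nonneg _) fun e _ => he e (Finset.mem_univ e)
    _ = ‖f e₀‖ ^ Fintype.card ι := by simp
    _ ≤ _ := Finset.single_le_sum (f := fun e => ‖f e‖ ^ Fintype.card ι)
        (fun _ _ => by positivity) (Finset.mem_univ e₀)

lemma Good.integrable {ν : Measure ℝ} [IsProbabilityMeasure ν]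
    {X : ∀ N, (Fin N → Fin N → ℝ) → Matrix (Fin N) (Fin N) ℂ} (h : Good ν X)
    {ι : Type*} [Fintype ι] [Nonempty ι] {N : ℕ} (a b : ι → Fin N) :
    Integrable (fun ω => ∏ e, X N ω (a e) (b e)) (PM ν N) := by
  refine Integrable.mono' (g := fun ω => ∑ e, ‖X N ω (a e) (b e)‖ ^ Fintype.card ι) ?_ ?_ ?_
  · exact integrable_finsetSum _ fun e _ => h.int _ _ _ _
  · exact (Finset.measurable_prod _ fun e _ => h.meas _ _ _).aestronglyMeasurable
  · exact Filter.Eventually.of_forall fun ω => prod_norm_le _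

lemma Good.bound {ν : Measure ℝ} [IsProbabilityMeasure ν]
    {X : ∀ N, (Fin N → Fin N → ℝ) → Matrix (Fin N) (Fin N) ℂ} (h : Good ν X)
    (ι : Type*) [Fintype ι] [Nonempty ι] : ∃ C : ℝ, ∀ (N : ℕ) (a b : ι → Fin N),
    ‖∫ ω, ∏ e, X N ω (a e) (b e) ∂(PM ν N)‖ ≤ C := by
  obtain ⟨C, hC⟩ := h.bnd (Fintype.card ι)
  refine ⟨∑ _e : ι, C, fun N a b => ?_⟩
  refine (norm_integral_le_integral_norm _).trans ?_
  calc ∫ ω, ‖∏ e, X N ω (a e) (b e)‖ ∂(PM ν N)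
      ≤ ∫ ω, ∑ e, ‖X N ω (a e) (b e)‖ ^ Fintype.card ι ∂(PM ν N) := by
        refine integral_mono (h.integrable a b).norm
          (integrable_finsetSum _ fun e _ => h.int _ _ _ _) fun ω => prod_norm_le _
    _ = ∑ e, ∫ ω, ‖X N ω (a e) (b e)‖ ^ Fintype.card ι ∂(PM ν N) :=
        integral_finsetSum _ fun e _ => h.int _ _ _ _
    _ ≤ _ := Finset.sum_le_sum fun e _ => hC _ _ _

lemma pow_expand {N : ℕ} (A : Matrix (Fin N) (Fin N) ℂ) (m : ℕ) (u v : Fin N) :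
    (A ^ m) u v = ∑ x : Fin (m + 1) → Fin N,
      (if x 0 = u ∧ x (Fin.last m) = v then ∏ j : Fin m, A (x j.castSucc) (x j.succ) else 0) := by
  induction m generalizing u with
  | zero =>
    rw [← (Equiv.funUnique (Fin 1) (Fin N)).symm.sum_comp]
    simp [Matrix.one_apply, Finset.filter_and, Finset.filter_eq']
    split_ifs <;> simp_all
  | succ m ih =>
    rw [pow_succ', Matrix.mul_apply, ← (Fin.consEquiv (fun _ => Fin N)).sum_comp,
      Fintype.sum_prod_type]
    simp only [ih, Fin.consEquiv_apply, Fin.cons_zero, ← Fin.succ_last, Fin.cons_succ,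
      Fin.prod_univ_succ, Fin.castSucc_zero, Fin.castSucc_succ]
    conv_rhs => rw [Finset.sum_eq_single u (fun b _ hb => by simp [hb]) (by simp)]
    simp only [Finset.mul_sum]
    rw [Finset.sum_comm]
    refine Finset.sum_congr rfl fun x _ => ?_
    rw [Finset.sum_eq_single (x 0) (fun b _ hb => by simp [hb.symm]) (by simp)]
    simp

lemma trace_expand {N : ℕ} (A : Matrix (Fin N) (Fin N) ℂ) (m : ℕ) :
    Matrix.trace (A ^ m) = ∑ x : Fin (m + 1) → Fin N,
      (if x 0 = x (Fin.last m) then 1 else 0) * ∏ j : Fin m, A (x j.castSucc) (x j.succ) := by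
  simp only [Matrix.trace, Matrix.diag, pow_expand]
  rw [Finset.sum_comm]
  refine Finset.sum_congr rfl fun x _ => ?_
  rw [Finset.sum_eq_single (x 0) (fun b _ hb => by simp [hb.symm]) (by simp)]
  simp [eq_comm]

lemma prod_trace_expand {N k : ℕ} (n : Fin k → ℕ) (A : Matrix (Fin N) (Fin N) ℂ) :
    ∏ i, Matrix.trace (A ^ n i) = ∑ x : (Σ i, Fin (n i + 1)) → Fin N,
      (∏ i, (if x ⟨i, 0⟩ = x ⟨i, Fin.last _⟩ then (1 : ℂ) else 0)) *
        ∏ e : (Σ i, Fin (n i)), A (x ⟨e.1, e.2.castSucc⟩) (x ⟨e.1, e.2.succ⟩) := by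
  simp only [trace_expand]
  rw [Finset.prod_univ_sum, Fintype.piFinset_univ,
    ← (Equiv.piCurry (fun (i : Fin k) (_ : Fin (n i + 1)) => Fin N)).sum_comp]
  refine Finset.sum_congr rfl fun x _ => ?_
  rw [Finset.prod_mul_distrib, Fintype.prod_sigma]
  rfl

lemma vertex_count {N k : ℕ} (n : Fin k → ℕ) (x : (Σ i, Fin (n i + 1)) → Fin N) :
    (Finset.univ.image x).card ≤ k + ((Finset.univ.image fun e : (Σ i, Fin (n i)) =>
      s(x ⟨e.1, e.2.castSucc⟩, x ⟨e.1, e.2.succ⟩)).filter fun p => ¬ p.IsDiag).card := by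
  classical
  set F := ((Finset.univ.image fun e : (Σ i, Fin (n i)) =>
      s(x ⟨e.1, e.2.castSucc⟩, x ⟨e.1, e.2.succ⟩)).filter fun p => ¬ p.IsDiag) with hF
  -- first occurrence
  have hfirst : ∀ v : Fin N, v ∈ Finset.univ.image x → ∃ p, x p = v ∧ ∀ q, x q = v →
      (p.2 : ℕ) ≤ q.2 := by
    intro v hv
    obtain ⟨p₀, -, hp₀⟩ := Finset.mem_image.1 hv
    obtain ⟨p, hp, hm⟩ := Finset.exists_min_image (Finset.univ.filter fun p => x p = v)
      (fun p => (p.2 : ℕ)) ⟨p₀, by simpa using hp₀⟩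
    exact ⟨p, by simpa using hp, fun q hq => hm q (by simpa using hq)⟩
  set S := Finset.univ.image fun i : Fin k => x ⟨i, 0⟩ with hS
  have hS' : S.card ≤ k := by
    simpa using (Finset.card_image_le (s := (Finset.univ : Finset (Fin k)))
      (f := fun i : Fin k => x ⟨i, 0⟩))
  have key : ∀ v ∈ Finset.univ.image x \ S, ∃ e : (Σ i, Fin (n i)),
      x ⟨e.1, e.2.succ⟩ = v ∧ ∀ q, x q = v → (e.2 : ℕ) + 1 ≤ q.2 := by
    intro v hv
    rw [Finset.mem_sdiff] at hv
    obtain ⟨⟨i, j⟩, hp, hm⟩ := hfirst v hv.1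
    rcases Fin.eq_zero_or_eq_succ j with rfl | ⟨j', rfl⟩
    · exact absurd (Finset.mem_image.2 ⟨i, Finset.mem_univ _, hp⟩) hv.2
    · exact ⟨⟨i, j'⟩, hp, fun q hq => by simpa using hm q hq⟩
  have : (Finset.univ.image x \ S).card ≤ F.card := by
    rcases isEmpty_or_nonempty (Σ i, Fin (n i)) with hE | hE
    · have : Finset.univ.image x \ S = ∅ := by
        rw [Finset.eq_empty_iff_forall_notMem]
        intro v hv
        obtain ⟨e, -⟩ := key v hv
        exact hE.elim e
      simp [this]
    choose! E hE1 hE2 using key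
    refine Finset.card_le_card_of_injOn
      (fun v => s(x ⟨(E v).1, (E v).2.castSucc⟩, x ⟨(E v).1, (E v).2.succ⟩)) ?_ ?_
    · intro v hv
      simp only [hF, Finset.coe_filter, Set.mem_ofPred_eq, Sym2.mk_isDiag_iff]
      refine ⟨Finset.mem_image.2 ⟨E v, Finset.mem_univ _, rfl⟩, fun h => ?_⟩
      rw [hE1 v hv] at h
      have := hE2 v hv _ h
      simp at this
    · intro v hv w hw h
      simp only [hE1 v hv, hE1 w hw, Sym2.eq_iff] at h
      rcases h with ⟨-, h⟩ | ⟨h1, h2⟩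
      · exact h
      · have a1 := hE2 w hw _ h1
        have a2 := hE2 v hv _ h2.symm
        simp at a1 a2
        omega
  have h3 := Finset.card_le_card_sdiff_add_card (t := S) (s := Finset.univ.image x)
  omega

lemma dichotomy {N k : ℕ} (n : Fin k → ℕ) (x : (Σ i, Fin (n i + 1)) → Fin N)
    (hx : k + (∑ i, n i) / 2 ≤ (Finset.univ.image x).card) (heven : Even (∑ i, n i)) :
    (∃ p, (Finset.univ.filter fun e : (Σ i, Fin (n i)) =>
      s(x ⟨e.1, e.2.castSucc⟩, x ⟨e.1, e.2.succ⟩) = p).card = 1) ∨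
    ∀ p, (Finset.univ.filter fun e : (Σ i, Fin (n i)) =>
      s(x ⟨e.1, e.2.castSucc⟩, x ⟨e.1, e.2.succ⟩) = p).card = 0 ∨
      ((Finset.univ.filter fun e : (Σ i, Fin (n i)) =>
      s(x ⟨e.1, e.2.castSucc⟩, x ⟨e.1, e.2.succ⟩) = p).card = 2 ∧ ¬ p.IsDiag) := by
  classical
  have hV := vertex_count n x
  set w : (Σ i, Fin (n i)) → Sym2 (Fin N) := fun e =>
    s(x ⟨e.1, e.2.castSucc⟩, x ⟨e.1, e.2.succ⟩) with hw
  change (∃ p, (Finset.univ.filter fun e => w e = p).card = 1) ∨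
    ∀ p, (Finset.univ.filter fun e => w e = p).card = 0 ∨
      ((Finset.univ.filter fun e => w e = p).card = 2 ∧ ¬ p.IsDiag)
  by_cases h1 : ∃ p, (Finset.univ.filter fun e => w e = p).card = 1
  · exact Or.inl h1
  right
  push Not at h1
  have hcard : ∑ p ∈ Finset.univ.image w, (Finset.univ.filter fun e => w e = p).card
      = ∑ i, n i := by
    rw [← Finset.card_eq_sum_card_image]
    simp
  have hge : ∀ p ∈ Finset.univ.image w, 2 ≤ (Finset.univ.filter fun e => w e = p).card := by
    intro p hp
    obtain ⟨e, -, he⟩ := Finset.mem_image.1 hp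
    have : 0 < (Finset.univ.filter fun e => w e = p).card :=
      Finset.card_pos.2 ⟨e, by simpa using he⟩
    have := h1 p
    omega
  have hfl : ((Finset.univ.image w).filter fun p => ¬ p.IsDiag).card ≤
    (Finset.univ.image w).card := Finset.card_filter_le _ _
  have hs : (Finset.univ.image w).card * 2 ≤ ∑ i, n i := by
    rw [← hcard, ← smul_eq_mul]
    exact Finset.card_nsmul_le_sum _ _ _ hge
  obtain ⟨m, hm⟩ := heven
  have hm2 : (∑ i, n i) / 2 = m := by omega
  have heq1 : ((Finset.univ.image w).filter fun p => ¬ p.IsDiag).card =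
    (Finset.univ.image w).card := by omega
  have heq2 : (Finset.univ.image w).card * 2 = ∑ i, n i := by omega
  have hnd := Finset.filter_card_eq heq1
  have hall : ∀ p ∈ Finset.univ.image w, 2 = (Finset.univ.filter fun e => w e = p).card := by
    refine (Finset.sum_eq_sum_iff_of_le hge).1 ?_
    rw [hcard, ← heq2]
    simp
  intro p
  by_cases hp : p ∈ Finset.univ.image w
  · exact Or.inr ⟨(hall p hp).symm, hnd p hp⟩
  · left
    rw [Finset.card_eq_zero, Finset.filter_eq_empty_iff]
    intro e _ he
    exact hp (Finset.mem_image.2 ⟨e, Finset.mem_univ _, he⟩)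

lemma count_small {P : Type*} [Fintype P] [DecidableEq P] [Nonempty P] (t N : ℕ) :
    (Finset.univ.filter fun x : P → Fin N => (Finset.univ.image x).card ≤ t).card ≤
      Fintype.card (P → Fin t) * N ^ t := by
  classical
  have : (Finset.univ.filter fun x : P → Fin N => (Finset.univ.image x).card ≤ t) ⊆
      (Finset.univ : Finset ((P → Fin t) × (Fin t → Fin N))).image fun fg => fg.2 ∘ fg.1 := by
    intro x hx
    simp only [Finset.mem_filter, Finset.mem_univ, true_and] at hx
    obtain ⟨emb⟩ : Nonempty (↥(Finset.univ.image x) ↪ Fin t) := by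
      apply Function.Embedding.nonempty_of_card_le
      rw [Fintype.card_coe, Fintype.card_fin]
      exact hx
    have : Nonempty ↥(Finset.univ.image x) :=
      ⟨⟨x (Classical.arbitrary P), Finset.mem_image_of_mem _ (Finset.mem_univ _)⟩⟩
    refine Finset.mem_image.2 ⟨(fun p => emb ⟨x p, Finset.mem_image_of_mem _ (Finset.mem_univ _)⟩,
      fun i => (Function.invFun emb i).1), Finset.mem_univ _, ?_⟩
    funext p
    simp [Function.leftInverse_invFun emb.injective _]
  refine (Finset.card_le_card this).trans (Finset.card_image_le.trans ?_)
  simp [Fintype.card_prod]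

lemma PM_int (ν : Measure ℝ) [IsProbabilityMeasure ν] (N : ℕ) (u v : Fin N) {E : Type*}
    [NormedAddCommGroup E] [NormedSpace ℝ E] (f : ℝ → E)
    (hf : AEStronglyMeasurable f ν) : ∫ ω, f (ω u v) ∂(PM ν N) = ∫ y, f y ∂ν := by
  have h := (PM_eval ν N u v).map_eq
  conv_rhs => rw [← h]
  rw [integral_map (PM_eval ν N u v).measurable.aemeasurable (by rwa [h])]

instance uniformPhase_prob : IsProbabilityMeasure uniformPhase := by
  constructor
  simp only [uniformPhase, Measure.smul_apply, Measure.restrict_apply MeasurableSet.univ,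
    Set.univ_inter, Real.volume_Ico, sub_zero, smul_eq_mul]
  refine ENNReal.inv_mul_cancel ?_ ENNReal.ofReal_ne_top
  have := Real.pi_pos
  simp [this]

lemma uniformPhase_exp (c : ℤ) (hc : c ≠ 0) :
    ∫ y : ℝ, Complex.exp (Complex.I * c * y) ∂uniformPhase = 0 := by
  have hc' : Complex.I * (c : ℂ) ≠ 0 := by simp [hc]
  rw [uniformPhase, integral_smul_measure, integral_Ico_eq_integral_Ioc,
    ← intervalIntegral.integral_of_le (by have := Real.pi_pos; positivity),
    integral_exp_mul_complex hc']
  have : Complex.I * c * ((2 * Real.pi : ℝ) : ℂ) = c * (2 * Real.pi * Complex.I) := by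
    push_cast; ring
  rw [this, Complex.exp_int_mul_two_pi_mul_I]
  simp

/-- The UME as a function of raw samples. -/
def XU (N : ℕ) (ω : Fin N → Fin N → ℝ) : Matrix (Fin N) (Fin N) ℂ := umeMatrix N (phases N ω)

lemma XU_diag {N : ℕ} (ω : Fin N → Fin N → ℝ) (u : Fin N) : XU N ω u u = 0 := by
  simp [XU, umeMatrix]

lemma XU_lt {N : ℕ} (ω : Fin N → Fin N → ℝ) {u v : Fin N} (h : u < v) :
    XU N ω u v = Complex.exp (Complex.I * (1 : ℤ) * (ω u v : ℝ)) := by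
  simp [XU, umeMatrix, phases, h, h.ne]

lemma XU_gt {N : ℕ} (ω : Fin N → Fin N → ℝ) {u v : Fin N} (h : v < u) :
    XU N ω u v = Complex.exp (Complex.I * (-1 : ℤ) * (ω v u : ℝ)) := by
  simp [XU, umeMatrix, phases, h, h.ne', h.not_gt]

lemma XU_norm {N : ℕ} (ω : Fin N → Fin N → ℝ) (u v : Fin N) : ‖XU N ω u v‖ ≤ 1 := by
  simp only [XU, umeMatrix]
  split_ifs
  · simp
  · rw [mul_comm, Complex.norm_exp_ofReal_mul_I]

lemma XU_meas (N : ℕ) (u v : Fin N) : Measurable fun ω => XU N ω u v := by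
  rcases lt_trichotomy u v with h | rfl | h
  · simp only [XU_lt _ h]; fun_prop
  · simp only [XU_diag]; fun_prop
  · simp only [XU_gt _ h]; fun_prop

lemma XU_int (N : ℕ) (m : ℕ) (u v : Fin N) :
    Integrable (fun ω => ‖XU N ω u v‖ ^ m) (PM uniformPhase N) := by
  refine Integrable.mono' (integrable_const (1 : ℝ)) ?_ ?_
  · have := XU_meas N u v
    exact (this.norm.pow_const m).aestronglyMeasurable
  · refine Filter.Eventually.of_forall fun ω => ?_
    rw [Real.norm_of_nonneg (by positivity)]
    exact pow_le_one₀ (norm_nonneg _) (XU_norm _ _ _)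

lemma good_UME : Good uniformPhase XU where
  meas := XU_meas
  dep := by
    intro N u v ω ω' h1 h2
    rcases lt_trichotomy u v with h | rfl | h
    · rw [XU_lt _ h, XU_lt _ h, h1]
    · rw [XU_diag, XU_diag]
    · rw [XU_gt _ h, XU_gt _ h, h2]
  int := XU_int
  bnd := by
    refine fun m => ⟨1, fun N u v => ?_⟩
    calc ∫ ω, ‖XU N ω u v‖ ^ m ∂(PM uniformPhase N) ≤ ∫ ω, (1 : ℝ) ∂(PM uniformPhase N) :=
          integral_mono (XU_int N m u v) (integrable_const _)
            fun ω => pow_le_one₀ (norm_nonneg _) (XU_norm _ _ _)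
      _ = 1 := by simp
  mean := by
    intro N u v
    rcases lt_trichotomy u v with h | rfl | h
    · simp only [XU_lt _ h]
      rw [PM_int uniformPhase N u v (fun y : ℝ => Complex.exp (Complex.I * (1 : ℤ) * y))
        (by fun_prop)]
      exact uniformPhase_exp _ (by decide)
    · simp [XU_diag]
    · simp only [XU_gt _ h]
      rw [PM_int uniformPhase N v u (fun y : ℝ => Complex.exp (Complex.I * (-1 : ℤ) * y))
        (by fun_prop)]
      exact uniformPhase_exp _ (by decide)
  sq := by
    intro N u v hne
    rcases lt_or_gt_of_ne hne with h | h
    · have : ∀ ω, XU N ω u v * XU N ω u v = Complex.exp (Complex.I * (2 : ℤ) * (ω u v : ℝ)) := by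
        intro ω
        rw [XU_lt _ h, ← Complex.exp_add]; congr 1; push_cast; ring
      simp only [this]
      rw [PM_int uniformPhase N u v (fun y : ℝ => Complex.exp (Complex.I * (2 : ℤ) * y))
        (by fun_prop)]
      exact uniformPhase_exp _ (by decide)
    · have : ∀ ω, XU N ω u v * XU N ω u v = Complex.exp (Complex.I * (-2 : ℤ) * (ω v u : ℝ)) := by
        intro ω
        rw [XU_gt _ h, ← Complex.exp_add]; congr 1; push_cast; ring
      simp only [this]
      rw [PM_int uniformPhase N v u (fun y : ℝ => Complex.exp (Complex.I * (-2 : ℤ) * y))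
        (by fun_prop)]
      exact uniformPhase_exp _ (by decide)
  abs := by
    intro N u v hne
    have : ∀ ω, XU N ω u v * XU N ω v u = 1 := by
      intro ω
      rcases lt_or_gt_of_ne hne with h | h
      · rw [XU_lt _ h, XU_gt _ h, ← Complex.exp_add, ← Complex.exp_zero]
        congr 1; push_cast; ring
      · rw [XU_lt _ h, XU_gt _ h, ← Complex.exp_add, ← Complex.exp_zero]
        congr 1; push_cast; ring
    simp [this]

/-- standard Gaussian -/
abbrev gam : Measure ℝ := ProbabilityTheory.gaussianReal 0 1

lemma gam_pow (m : ℕ) : Integrable (fun y : ℝ => |y| ^ m) gam := by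
  have := (ProbabilityTheory.memLp_id_gaussianReal' (μ := 0) (v := 1) (m : ENNReal)
    (by simp)).integrable_norm_pow'
  simpa using this

lemma gam_mean : ∫ y : ℝ, y ∂gam = 0 := by
  simp [gam]

lemma gam_sq : ∫ y : ℝ, y ^ 2 ∂gam = 1 := by
  have h := ProbabilityTheory.variance_id_gaussianReal (μ := 0) (v := 1)
  rw [ProbabilityTheory.variance_of_integral_eq_zero (by fun_prop) (by simp)] at h
  simpa using h

lemma PM_comp_int (N m : ℕ) (u v : Fin N) :
    Integrable (fun ω : Fin N → Fin N → ℝ => |ω u v| ^ m) (PM gam N) :=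
  (PM_eval gam N u v).integrable_comp_of_integrable (gam_pow m)

lemma coord_int (N : ℕ) (u v : Fin N) :
    Integrable (fun ω : Fin N → Fin N → ℝ => (ω u v : ℂ)) (PM gam N) := by
  refine Integrable.ofReal ?_
  refine (PM_comp_int N 1 u v).mono' (PM_eval gam N u v).measurable.aestronglyMeasurable ?_
  exact Filter.Eventually.of_forall fun ω => by simp

lemma coord_sq_int (N : ℕ) (u v : Fin N) :
    Integrable (fun ω : Fin N → Fin N → ℝ => (ω u v : ℂ) ^ 2) (PM gam N) := by
  have := (PM_comp_int N 2 u v).ofReal (𝕜 := ℂ)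
  refine this.congr (Filter.Eventually.of_forall fun ω => ?_)
  simp [← Complex.ofReal_pow]

lemma coord_mul_int (N : ℕ) (u v u' v' : Fin N) :
    Integrable (fun ω : Fin N → Fin N → ℝ => (ω u v : ℂ) * (ω u' v' : ℂ)) (PM gam N) := by
  have h1 := (PM_eval gam N u v).measurable
  have h2 := (PM_eval gam N u' v').measurable
  refine ((PM_comp_int N 2 u v).add (PM_comp_int N 2 u' v')).mono' (by fun_prop) ?_
  refine Filter.Eventually.of_forall fun ω => ?_
  simp only [norm_mul, Complex.norm_real, Real.norm_eq_abs, Pi.add_apply]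
  nlinarith [sq_nonneg (|ω u v| - |ω u' v'|), sq_nonneg (|ω u v| + |ω u' v'|)]

lemma coord_mean (N : ℕ) (u v : Fin N) : ∫ ω, (ω u v : ℂ) ∂(PM gam N) = 0 := by
  rw [PM_int gam N u v (fun y : ℝ => (y : ℂ)) (by fun_prop), integral_complex_ofReal, gam_mean]
  simp

lemma coord_sq (N : ℕ) (u v : Fin N) : ∫ ω, (ω u v : ℂ) ^ 2 ∂(PM gam N) = 1 := by
  rw [PM_int gam N u v (fun y : ℝ => (y : ℂ) ^ 2) (by fun_prop)]
  simp_rw [← Complex.ofReal_pow]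
  rw [integral_complex_ofReal, gam_sq]
  simp

lemma coord_mul (N : ℕ) (u v : Fin N) (h : u ≠ v) :
    ∫ ω, (ω u v : ℂ) * (ω v u : ℂ) ∂(PM gam N) = 0 := by
  have h1 := (PM_eval gam N u v).measurable
  have h2 := (PM_eval gam N v u).measurable
  rw [PM_fac2 gam N (fun ω => (ω u v : ℂ)) (fun ω => (ω v u : ℂ)) (by fun_prop) (by fun_prop)
    {(u, v)} {(v, u)} (by simp [h, h.symm]) (by intro ω ω' h; simpa using h)
    (by intro ω ω' h; simpa using h), coord_mean]
  simp

lemma G_diag {N : ℕ} (ω : Fin N → Fin N → ℝ) (u : Fin N) : gueMatrix N ω u u = (ω u u : ℂ) := by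
  simp [gueMatrix]

lemma G_lt {N : ℕ} (ω : Fin N → Fin N → ℝ) {u v : Fin N} (h : u < v) :
    gueMatrix N ω u v = ((ω u v : ℂ) + Complex.I * (ω v u : ℂ)) / (Real.sqrt 2 : ℂ) := by
  simp [gueMatrix, h, h.ne]

lemma G_gt {N : ℕ} (ω : Fin N → Fin N → ℝ) {u v : Fin N} (h : v < u) :
    gueMatrix N ω u v = ((ω v u : ℂ) - Complex.I * (ω u v : ℂ)) / (Real.sqrt 2 : ℂ) := by
  simp [gueMatrix, h.ne', h.not_gt]

lemma G_meas (N : ℕ) (u v : Fin N) : Measurable fun ω => gueMatrix N ω u v := by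
  rcases lt_trichotomy u v with h | rfl | h
  · simp only [G_lt _ h]; fun_prop
  · simp only [G_diag]; fun_prop
  · simp only [G_gt _ h]; fun_prop

lemma G_norm {N : ℕ} (ω : Fin N → Fin N → ℝ) (u v : Fin N) :
    ‖gueMatrix N ω u v‖ ≤ |ω u v| + |ω v u| := by
  have h2 : (1 : ℝ) ≤ Real.sqrt 2 := by rw [Real.one_le_sqrt]; norm_num
  have key : ∀ z : ℂ, ‖z / (Real.sqrt 2 : ℂ)‖ ≤ ‖z‖ := by
    intro z
    rw [norm_div, Complex.norm_real, Real.norm_of_nonneg (by positivity)]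
    exact div_le_self (norm_nonneg _) h2
  rcases lt_trichotomy u v with h | rfl | h
  · rw [G_lt _ h]
    refine (key _).trans ((norm_add_le _ _).trans ?_)
    simp
  · rw [G_diag]
    simp
  · rw [G_gt _ h]
    refine (key _).trans ((norm_sub_le _ _).trans ?_)
    simp [add_comm]

lemma G_norm_pow {N : ℕ} (m : ℕ) (ω : Fin N → Fin N → ℝ) (u v : Fin N) :
    ‖gueMatrix N ω u v‖ ^ m ≤ 2 ^ (m - 1) * (|ω u v| ^ m + |ω v u| ^ m) :=
  (pow_le_pow_left₀ (norm_nonneg _) (G_norm ω u v) m).trans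
    (add_pow_le (abs_nonneg _) (abs_nonneg _) m)

lemma G_int (N m : ℕ) (u v : Fin N) :
    Integrable (fun ω => ‖gueMatrix N ω u v‖ ^ m) (PM gam N) := by
  refine Integrable.mono' (((PM_comp_int N m u v).add (PM_comp_int N m v u)).const_mul
    (2 ^ (m - 1))) ?_ ?_
  · exact ((G_meas N u v).norm.pow_const m).aestronglyMeasurable
  · refine Filter.Eventually.of_forall fun ω => ?_
    rw [Real.norm_of_nonneg (by positivity)]
    exact G_norm_pow m ω u v

lemma sqrt2_sq : ((Real.sqrt 2 : ℝ) : ℂ) * ((Real.sqrt 2 : ℝ) : ℂ) = 2 := by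
  rw [← Complex.ofReal_mul, Real.mul_self_sqrt (by norm_num)]
  simp

lemma quad_int {N : ℕ} {u v : Fin N} (h : u ≠ v) (α β γ : ℂ) :
    ∫ ω : Fin N → Fin N → ℝ, (α * (ω u v : ℂ) ^ 2 + β * (ω v u : ℂ) ^ 2
      + γ * ((ω u v : ℂ) * (ω v u : ℂ))) ∂(PM gam N) = α + β := by
  rw [integral_add, integral_add, integral_const_mul, integral_const_mul, integral_const_mul,
    coord_sq, coord_sq, coord_mul N u v h]
  · simp
  · exact (coord_sq_int _ _ _).const_mul _
  · exact (coord_sq_int _ _ _).const_mul _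
  · exact ((coord_sq_int _ _ _).const_mul _).add ((coord_sq_int _ _ _).const_mul _)
  · exact (coord_mul_int _ _ _ _ _).const_mul _

lemma lin_int {N : ℕ} (u v : Fin N) (α β : ℂ) :
    ∫ ω : Fin N → Fin N → ℝ, (α * (ω u v : ℂ) + β * (ω v u : ℂ)) ∂(PM gam N) = 0 := by
  rw [integral_add, integral_const_mul, integral_const_mul, coord_mean, coord_mean]
  · simp
  · exact (coord_int _ _ _).const_mul _
  · exact (coord_int _ _ _).const_mul _

lemma good_GUE : Good gam gueMatrix where
  meas := G_meas
  dep := by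
    intro N u v ω ω' h1 h2
    rcases lt_trichotomy u v with h | rfl | h
    · rw [G_lt _ h, G_lt _ h, h1, h2]
    · rw [G_diag, G_diag, h1]
    · rw [G_gt _ h, G_gt _ h, h1, h2]
  int := G_int
  bnd := by
    refine fun m => ⟨2 ^ (m - 1) * ((∫ y, |y| ^ m ∂gam) + ∫ y, |y| ^ m ∂gam), fun N u v => ?_⟩
    calc ∫ ω, ‖gueMatrix N ω u v‖ ^ m ∂(PM gam N)
        ≤ ∫ ω, 2 ^ (m - 1) * (|ω u v| ^ m + |ω v u| ^ m) ∂(PM gam N) :=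
          integral_mono (G_int N m u v) (((PM_comp_int N m u v).add (PM_comp_int N m v u)).const_mul
            (2 ^ (m - 1))) fun ω => G_norm_pow m ω u v
      _ = _ := by
          rw [integral_const_mul, integral_add (PM_comp_int N m u v) (PM_comp_int N m v u),
            PM_int gam N u v (fun y => |y| ^ m) (by fun_prop),
            PM_int gam N v u (fun y => |y| ^ m) (by fun_prop)]
  mean := by
    intro N u v
    rcases lt_trichotomy u v with h | rfl | h
    · rw [← lin_int u v (1 / (Real.sqrt 2 : ℂ)) (Complex.I / (Real.sqrt 2 : ℂ))]
      refine integral_congr_ae (Filter.Eventually.of_forall fun ω => ?_)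
      simp only [G_lt _ h]; ring
    · simp only [G_diag]; exact coord_mean _ _ _
    · rw [← lin_int u v (-Complex.I / (Real.sqrt 2 : ℂ)) (1 / (Real.sqrt 2 : ℂ))]
      refine integral_congr_ae (Filter.Eventually.of_forall fun ω => ?_)
      simp only [G_gt _ h]; ring
  sq := by
    intro N u v hne
    rcases lt_or_gt_of_ne hne with h | h
    · trans (1 / 2 : ℂ) + (-1 / 2)
      · rw [← quad_int hne _ _ Complex.I]
        refine integral_congr_ae (Filter.Eventually.of_forall fun ω => ?_)
        simp only [G_lt _ h]
        rw [div_mul_div_comm, sqrt2_sq]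
        linear_combination (1 / 2 * (ω v u : ℂ) ^ 2) * Complex.I_sq
      · norm_num
    · trans (-1 / 2 : ℂ) + (1 / 2)
      · rw [← quad_int hne _ _ (-Complex.I)]
        refine integral_congr_ae (Filter.Eventually.of_forall fun ω => ?_)
        simp only [G_gt _ h]
        rw [div_mul_div_comm, sqrt2_sq]
        linear_combination (1 / 2 * (ω u v : ℂ) ^ 2) * Complex.I_sq
      · norm_num
  abs := by
    intro N u v hne
    trans (1 / 2 : ℂ) + (1 / 2)
    · rw [← quad_int hne _ _ 0]
      refine integral_congr_ae (Filter.Eventually.of_forall fun ω => ?_)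
      rcases lt_or_gt_of_ne hne with h | h
      · simp only [G_gt _ h, G_lt _ h]
        rw [div_mul_div_comm, sqrt2_sq]
        linear_combination (-1 / 2 * (ω v u : ℂ) ^ 2) * Complex.I_sq
      · simp only [G_gt _ h, G_lt _ h]
        rw [div_mul_div_comm, sqrt2_sq]
        linear_combination (-1 / 2 * (ω u v : ℂ) ^ 2) * Complex.I_sq
    · norm_num

lemma Good.expand {ν : Measure ℝ} [IsProbabilityMeasure ν]
    {X : ∀ N, (Fin N → Fin N → ℝ) → Matrix (Fin N) (Fin N) ℂ} (h : Good ν X)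
    {k : ℕ} (n : Fin k → ℕ) [Nonempty (Σ i, Fin (n i))] (N : ℕ) :
    ∫ ω, ∏ i, Matrix.trace (X N ω ^ n i) ∂(PM ν N) = ∑ x : (Σ i, Fin (n i + 1)) → Fin N,
      (∏ i, (if x ⟨i, 0⟩ = x ⟨i, Fin.last _⟩ then (1 : ℂ) else 0)) *
        ∫ ω, ∏ e : (Σ i, Fin (n i)), X N ω (x ⟨e.1, e.2.castSucc⟩) (x ⟨e.1, e.2.succ⟩)
          ∂(PM ν N) := by
  simp only [prod_trace_expand]
  rw [integral_finsetSum]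
  · simp only [integral_const_mul]
  · intro x _
    exact (h.integrable _ _).const_mul _

/-- For fixed `k ≥ 1` and fixed positive integers `n₁, …, n_k` of even sum,
with `s = k + (n₁ + ⋯ + n_k)/2`, the averages of the products of traces over the UME and
over the GUE agree to leading order: their difference is `O(N^{s−1})` as `N → ∞`. -/
theorem ume_gue_product_traces (k : ℕ) (hk : 1 ≤ k) (n : Fin k → ℕ)
    (hn : ∀ i, 1 ≤ n i) (heven : Even (∑ i, n i)) :
    ∃ (c : ℝ) (N₀ : ℕ), ∀ N ≥ N₀,
      ‖(∫ ω, ∏ i, Matrix.trace ((umeMatrix N (phases N ω)) ^ (n i)) ∂(phaseMeasure N))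
          - (∫ ω, ∏ i, Matrix.trace ((gueMatrix N ω) ^ (n i)) ∂(gueMeasure N))‖
        ≤ c * (N : ℝ) ^ (k + (∑ i, n i) / 2 - 1) := by
  have i₀ : Fin k := ⟨0, hk⟩
  have : Nonempty (Σ i, Fin (n i)) := ⟨⟨i₀, ⟨0, hn i₀⟩⟩⟩
  have : Nonempty (Σ i, Fin (n i + 1)) := ⟨⟨i₀, 0⟩⟩
  obtain ⟨C₁, hC₁⟩ := good_UME.bound (Σ i, Fin (n i))
  obtain ⟨C₂, hC₂⟩ := good_GUE.bound (Σ i, Fin (n i))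
  set t := k + (∑ i, n i) / 2 - 1 with ht
  refine ⟨Fintype.card ((Σ i, Fin (n i + 1)) → Fin t) * (C₁ + C₂), 1, fun N hN => ?_⟩
  have hC : 0 ≤ C₁ + C₂ := by
    have a1 := (norm_nonneg _).trans (hC₁ N (fun _ => ⟨0, hN⟩) (fun _ => ⟨0, hN⟩))
    have a2 := (norm_nonneg _).trans (hC₂ N (fun _ => ⟨0, hN⟩) (fun _ => ⟨0, hN⟩))
    linarith
  have e1 := good_UME.expand n N
  have e2 := good_GUE.expand n N
  change ‖(∫ ω, ∏ i, Matrix.trace (XU N ω ^ n i) ∂(PM uniformPhase N)) -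
    ∫ ω, ∏ i, Matrix.trace (gueMatrix N ω ^ n i) ∂(PM gam N)‖ ≤ _
  rw [e1, e2, ← Finset.sum_sub_distrib]
  refine (norm_sum_le _ _).trans ?_
  have hterm : ∀ x : (Σ i, Fin (n i + 1)) → Fin N,
      ‖(∏ i, (if x ⟨i, 0⟩ = x ⟨i, Fin.last _⟩ then (1 : ℂ) else 0)) *
        ∫ ω, ∏ e : (Σ i, Fin (n i)), XU N ω (x ⟨e.1, e.2.castSucc⟩) (x ⟨e.1, e.2.succ⟩)
          ∂(PM uniformPhase N) -
        (∏ i, (if x ⟨i, 0⟩ = x ⟨i, Fin.last _⟩ then (1 : ℂ) else 0)) *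
        ∫ ω, ∏ e : (Σ i, Fin (n i)), gueMatrix N ω (x ⟨e.1, e.2.castSucc⟩) (x ⟨e.1, e.2.succ⟩)
          ∂(PM gam N)‖ ≤ if (Finset.univ.image x).card ≤ t then C₁ + C₂ else 0 := by
    intro x
    rw [← mul_sub, norm_mul]
    have hone : ‖∏ i, (if x ⟨i, 0⟩ = x ⟨i, Fin.last _⟩ then (1 : ℂ) else 0)‖ ≤ 1 := by
      rw [norm_prod]
      refine Finset.prod_le_one (fun _ _ => norm_nonneg _) fun i _ => ?_
      split_ifs <;> simp
    split_ifs with hx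
    · refine (mul_le_of_le_one_left (norm_nonneg _) hone).trans ?_
      exact (norm_sub_le _ _).trans (add_le_add (hC₁ N _ _) (hC₂ N _ _))
    · rw [good_UME.eq good_GUE _ _ (dichotomy n x (by omega) heven)]
      simp
  refine (Finset.sum_le_sum fun x _ => hterm x).trans ?_
  rw [← Finset.sum_filter, Finset.sum_const, nsmul_eq_mul]
  have hcount := count_small (P := (Σ i, Fin (n i + 1))) t N
  have hcount' : ((Finset.univ.filter fun x : (Σ i, Fin (n i + 1)) → Fin N =>
      (Finset.univ.image x).card ≤ t).card : ℝ) ≤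
      (Fintype.card ((Σ i, Fin (n i + 1)) → Fin t) : ℝ) * (N : ℝ) ^ t := by
    exact_mod_cast hcount
  calc _ ≤ (Fintype.card ((Σ i, Fin (n i + 1)) → Fin t) : ℝ) * (N : ℝ) ^ t * (C₁ + C₂) :=
        mul_le_mul_of_nonneg_right hcount' hC
    _ = _ := by ring
end
end

section
/- Fix an integer n ≥ 5. As N → ∞, the expected trace of the (2n)-th power of the magnetic Hashimoto matrix satisfies ⟨Tr[Y(Φ)^{2n}]⟩ = (n/6) [(n+1)(n−4) + 3(n−5)] N^{n−1} + O(N^{n−2}). -/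
open MeasureTheory Matrix

noncomputable section

/-- A directed edge of the complete graph on `N` vertices: a pair `e = (j, i)` with `i ≠ j`;
its origin is `e.2` and its terminus is `e.1`. -/
abbrev DirEdge (N : ℕ) : Type := {e : Fin N × Fin N // e.1 ≠ e.2}

/-- The magnetic Hashimoto matrix of the complete graph on `N` vertices with phases `φ`:
`Y(Φ)_{e',e} = (δ_{o(e'),τ(e)} − δ_{e',ê}) · exp((i/2)(φ_e + φ_{e'}))`. -/
def hashimoto (N : ℕ) (φ : Fin N → Fin N → ℝ) :
    Matrix (DirEdge N) (DirEdge N) ℂ :=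
  fun e' e =>
    (((if e'.1.2 = e.1.1 then 1 else 0) : ℂ) - ((if e'.1 = (e.1.2, e.1.1) then 1 else 0) : ℂ)) *
      Complex.exp (Complex.I / 2 * ((φ e.1.1 e.1.2 : ℂ) + (φ e'.1.1 e'.1.2 : ℂ)))




lemma matrix_pow_succ_apply_sum {α R : Type*} [Fintype α] [DecidableEq α] [CommRing R]
    (M : Matrix α α R) (k : ℕ) : ∀ a b : α,
    (M ^ (k + 1)) a b
      = ∑ p : Fin k → α, ∏ i : Fin (k + 1),
          M ((Fin.cons a p : Fin (k + 1) → α) i) ((Fin.snoc p b : Fin (k + 1) → α) i) := by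
  induction k with
  | zero =>
    intro a b
    simp [Fin.snoc]
  | succ k ih =>
    intro a b
    rw [pow_succ', Matrix.mul_apply]
    simp_rw [ih]
    rw [← (Fin.consEquiv (fun _ : Fin (k + 1) => α)).sum_comp, Fintype.sum_prod_type]
    refine Finset.sum_congr rfl fun c _ => ?_
    rw [Finset.mul_sum]
    refine Finset.sum_congr rfl fun p _ => ?_
    change _ = ∏ i : Fin (k + 1 + 1), M ((Fin.cons a (Fin.cons c p : Fin (k + 1) → α) :
      Fin (k + 1 + 1) → α) i) ((Fin.snoc (Fin.cons c p : Fin (k + 1) → α) b :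
      Fin (k + 1 + 1) → α) i)
    symm
    rw [Fin.prod_univ_succ, ← Fin.cons_snoc_eq_snoc_cons]
    simp only [Fin.cons_zero, Fin.cons_succ]

lemma trace_pow_eq_sum {α R : Type*} [Fintype α] [DecidableEq α] [CommRing R]
    (M : Matrix α α R) (m : ℕ) [NeZero m] :
    Matrix.trace (M ^ m) = ∑ p : ZMod m → α, ∏ i : ZMod m, M (p i) (p (i + 1)) := by
  obtain ⟨k, rfl⟩ : ∃ k, m = k + 1 := ⟨m - 1, by have := NeZero.pos m; omega⟩
  change Matrix.trace (M ^ (k + 1)) =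
    ∑ p : Fin (k + 1) → α, ∏ i : Fin (k + 1), M (p i) (p (i + 1))
  rw [← (Fin.consEquiv (fun _ : Fin (k + 1) => α)).sum_comp, Fintype.sum_prod_type]
  simp only [Matrix.trace, Matrix.diag_apply]
  refine Finset.sum_congr rfl fun a _ => ?_
  rw [matrix_pow_succ_apply_sum]
  refine Finset.sum_congr rfl fun p _ => ?_
  refine Finset.prod_congr rfl fun i _ => ?_
  simp only [Fin.consEquiv_apply]
  congr 1
  refine Fin.lastCases ?_ (fun j => ?_) i
  · simp
  · simp

instance : IsProbabilityMeasure uniformPhase := by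
  constructor
  have h : ENNReal.ofReal (2 * Real.pi) ≠ 0 := by
    simp [Real.pi_pos]
  simp only [uniformPhase, Measure.smul_apply, MeasurableSet.univ, Measure.restrict_apply,
    Set.univ_inter, Real.volume_Ico, sub_zero, smul_eq_mul]
  exact ENNReal.inv_mul_cancel h ENNReal.ofReal_ne_top

instance (N : ℕ) : IsProbabilityMeasure (phaseMeasure N) := by
  unfold phaseMeasure; infer_instance

lemma integral_uniformPhase_exp (k : ℤ) :
    ∫ x, Complex.exp (Complex.I * (k * x)) ∂uniformPhase = if k = 0 then 1 else 0 := by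
  split_ifs with h
  · simp [h]
  · unfold uniformPhase
    rw [integral_smul_measure, MeasureTheory.integral_Ico_eq_integral_Ioc,
      ← intervalIntegral.integral_of_le (by positivity)]
    have hk : (Complex.I * k : ℂ) ≠ 0 := by
      simp [h]
    have : ∀ x : ℝ, Complex.exp (Complex.I * (k * x)) = Complex.exp ((Complex.I * k) * x) := by
      intro x; ring_nf
    simp_rw [this]
    rw [integral_exp_mul_complex hk]
    have : Complex.exp (Complex.I * k * ((2 * Real.pi : ℝ) : ℂ)) = 1 := by
      rw [Complex.exp_eq_one_iff]
      exact ⟨k, by push_cast; ring⟩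
    rw [this]
    simp

/-- number of steps from `a` to `b` -/
def stepCount {m N : ℕ} [NeZero m] (w : ZMod m → Fin N) (a b : Fin N) : ℕ :=
  (Finset.univ.filter fun i => w i = a ∧ w (i + 1) = b).card

/-- Closed cyclically non-backtracking walks, traversing each edge equally often
in both directions. -/
structure GoodWalk {m N : ℕ} [NeZero m] (w : ZMod m → Fin N) : Prop where
  nb1 : ∀ i, w i ≠ w (i + 1)
  nb2 : ∀ i, w i ≠ w (i + 2)
  bal : ∀ a b, stepCount w a b = stepCount w b a

lemma sum_phases_eq {m N : ℕ} [NeZero m] (w : ZMod m → Fin N) (ω : Fin N → Fin N → ℝ) :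
    ∑ i, phases N ω (w i) (w (i + 1)) =
      ∑ a, ∑ b, ((if a < b then (stepCount w a b : ℤ) - stepCount w b a else 0 : ℤ) : ℝ)
        * ω a b := by
  have h1 : ∑ i, phases N ω (w i) (w (i + 1)) =
      ∑ a, ∑ b, (stepCount w a b : ℝ) * phases N ω a b := by
    simp only [stepCount, Finset.card_filter]
    push_cast
    simp_rw [Finset.sum_mul]
    have : ∀ a, ∑ b, ∑ i, (if w i = a ∧ w (i + 1) = b then (1 : ℝ) else 0) * phases N ω a b
      = ∑ i, ∑ b, (if w i = a ∧ w (i + 1) = b then (1 : ℝ) else 0) * phases N ω a b :=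
      fun a => Finset.sum_comm
    simp_rw [this]
    rw [Finset.sum_comm]
    refine Finset.sum_congr rfl fun i _ => ?_
    rw [Finset.sum_eq_single (w i), Finset.sum_eq_single (w (i + 1))]
    · simp
    · intro b _ hb; simp [hb.symm]
    · simp
    · intro a _ ha; simp [ha.symm]
    · simp
  rw [h1]
  have h2 : ∀ a b, (stepCount w a b : ℝ) * phases N ω a b =
      (if a < b then (stepCount w a b : ℝ) * ω a b else 0) -
      (if b < a then (stepCount w a b : ℝ) * ω b a else 0) := by
    intro a b
    unfold phases
    rcases lt_trichotomy a b with h | h | h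
    · simp [h, h.not_gt]
    · simp [h]
    · simp [h, h.not_gt]
  simp_rw [h2, Finset.sum_sub_distrib]
  conv_lhs => rw [Finset.sum_comm (f := fun a b => if b < a then (stepCount w a b : ℝ) * ω b a else 0)]
  rw [← Finset.sum_sub_distrib]
  refine Finset.sum_congr rfl fun a _ => ?_
  rw [← Finset.sum_sub_distrib]
  refine Finset.sum_congr rfl fun b _ => ?_
  split_ifs
  · push_cast; ring
  · simp

lemma integral_walk {m N : ℕ} [NeZero m] (w : ZMod m → Fin N) :
    ∫ ω, Complex.exp (Complex.I * ((∑ i, phases N ω (w i) (w (i + 1)) : ℝ) : ℂ)) ∂phaseMeasure N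
      = if (∀ a b, stepCount w a b = stepCount w b a) then 1 else 0 := by
  simp_rw [sum_phases_eq]
  set κ : Fin N → Fin N → ℤ :=
    fun a b => if a < b then (stepCount w a b : ℤ) - stepCount w b a else 0 with hκ
  have h : ∀ ω : Fin N → Fin N → ℝ,
      Complex.exp (Complex.I * ((∑ a, ∑ b, ((κ a b : ℤ) : ℝ) * ω a b : ℝ) : ℂ))
      = ∏ a, ∏ b, Complex.exp (Complex.I * (κ a b * ω a b)) := by
    intro ω
    push_cast
    simp_rw [Finset.mul_sum, Complex.exp_sum]
  change ∫ ω : Fin N → Fin N → ℝ,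
    Complex.exp (Complex.I * ((∑ a, ∑ b, ((κ a b : ℤ) : ℝ) * ω a b : ℝ) : ℂ)) ∂phaseMeasure N = _
  simp_rw [h]
  unfold phaseMeasure
  rw [MeasureTheory.integral_fintype_prod_eq_prod
    (f := fun a (x : Fin N → ℝ) => ∏ b, Complex.exp (Complex.I * (κ a b * x b)))]
  have : ∀ a, ∫ x : Fin N → ℝ, ∏ b, Complex.exp (Complex.I * (κ a b * x b))
      ∂(Measure.pi fun _ => uniformPhase) = ∏ b, if κ a b = 0 then 1 else 0 := by
    intro a
    rw [MeasureTheory.integral_fintype_prod_eq_prod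
      (f := fun b (x : ℝ) => Complex.exp (Complex.I * (κ a b * x)))]
    simp_rw [integral_uniformPhase_exp]
  simp_rw [this]
  split_ifs with hb
  · apply Finset.prod_eq_one
    intro a _
    apply Finset.prod_eq_one
    intro b _
    simp [hκ, hb a b]
  · push Not at hb
    obtain ⟨a, b, hab⟩ := hb
    have : ∃ a b, κ a b ≠ 0 := by
      rcases lt_trichotomy a b with h | h | h
      · exact ⟨a, b, by simp only [hκ, h, if_true]; omega⟩
      · exact absurd (by rw [h]) hab
      · exact ⟨b, a, by simp only [hκ, h, if_true]; omega⟩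
    obtain ⟨a, b, h⟩ := this
    apply Finset.prod_eq_zero (Finset.mem_univ a)
    apply Finset.prod_eq_zero (Finset.mem_univ b)
    simp [h]

lemma hashimoto_apply (N : ℕ) (φ : Fin N → Fin N → ℝ) (e' e : DirEdge N) :
    hashimoto N φ e' e = (if e'.1.2 = e.1.1 ∧ e'.1.1 ≠ e.1.2 then 1 else 0) *
      Complex.exp (Complex.I / 2 * ((φ e.1.1 e.1.2 : ℂ) + (φ e'.1.1 e'.1.2 : ℂ))) := by
  unfold hashimoto
  congr 1
  by_cases h1 : e'.1.2 = e.1.1 <;> by_cases h2 : e'.1.1 = e.1.2 <;> simp [h1, h2, Prod.ext_iff]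

lemma trace_hashimoto (m N : ℕ) [NeZero m] (φ : Fin N → Fin N → ℝ) :
    Matrix.trace (hashimoto N φ ^ m) =
      ∑ w : ZMod m → Fin N, if (∀ i, w i ≠ w (i + 1)) ∧ (∀ i, w i ≠ w (i + 2)) then
        Complex.exp (Complex.I * ((∑ i, φ (w i) (w (i + 1)) : ℝ) : ℂ)) else 0 := by
  rw [trace_pow_eq_sum]
  have h1 : ∀ p : ZMod m → DirEdge N, ∏ i, hashimoto N φ (p i) (p (i + 1)) =
      if (∀ i, (p i).1.2 = (p (i + 1)).1.1 ∧ (p i).1.1 ≠ (p (i + 1)).1.2) then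
        Complex.exp (Complex.I * ((∑ i, φ (p i).1.1 (p i).1.2 : ℝ) : ℂ)) else 0 := by
    intro p
    simp_rw [hashimoto_apply]
    rw [Finset.prod_mul_distrib, Fintype.prod_ite_zero, ← Complex.exp_sum, ← Finset.mul_sum,
      Finset.sum_add_distrib]
    have : ∑ i, (φ (p (i + 1)).1.1 (p (i + 1)).1.2 : ℂ) = ∑ i, (φ (p i).1.1 (p i).1.2 : ℂ) :=
      Equiv.sum_comp (Equiv.addRight (1 : ZMod m)) (fun i => (φ (p i).1.1 (p i).1.2 : ℂ))
    rw [this]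
    split_ifs
    · simp only [Finset.prod_const_one, one_mul]
      congr 1
      push_cast
      ring
    · simp
  simp_rw [h1]
  rw [← Finset.sum_filter, ← Finset.sum_filter]
  refine Finset.sum_bij' (fun p _ i => (p i).1.1)
    (fun w hw i => ⟨(w i, w (i + 1)), (by simp at hw; exact hw.1 i)⟩) ?_ ?_ ?_ ?_ ?_
  · intro p hp
    simp only [Finset.mem_filter, Finset.mem_univ, true_and] at hp ⊢
    refine ⟨fun i => ?_, fun i => ?_⟩
    · rw [← (hp i).1]; exact (p i).2
    · have := (hp (i + 1)).1
      rw [add_assoc, one_add_one_eq_two] at this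
      rw [← this]; exact (hp i).2
  · intro w hw
    simp only [Finset.mem_filter, Finset.mem_univ, true_and] at hw ⊢
    intro i
    rw [add_assoc, one_add_one_eq_two]
    exact hw.2 i
  · intro p hp
    simp only [Finset.mem_filter, Finset.mem_univ, true_and] at hp
    funext i
    apply Subtype.ext
    exact Prod.ext rfl (hp i).1.symm
  · intro w hw
    rfl
  · intro p hp
    simp only [Finset.mem_filter, Finset.mem_univ, true_and] at hp
    congr 3
    refine Finset.sum_congr rfl fun i _ => ?_
    rw [(hp i).1]

open Classical in
lemma expected_trace (m N : ℕ) [NeZero m] :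
    ∫ ω, Matrix.trace ((hashimoto N (phases N ω)) ^ m) ∂(phaseMeasure N)
      = ((Finset.univ.filter fun w : ZMod m → Fin N => GoodWalk w).card : ℂ) := by
  simp_rw [trace_hashimoto]
  rw [integral_finsetSum]
  · rw [Finset.card_filter]
    push_cast
    refine Finset.sum_congr rfl fun w _ => ?_
    by_cases h : (∀ i, w i ≠ w (i + 1)) ∧ (∀ i, w i ≠ w (i + 2))
    · simp only [if_pos h]
      have hw := integral_walk w
      push_cast at hw ⊢
      rw [hw]
      by_cases hb : ∀ a b, stepCount w a b = stepCount w b a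
      · rw [if_pos hb, if_pos ⟨h.1, h.2, hb⟩]
      · rw [if_neg hb, if_neg (fun hg => hb hg.bal)]
    · simp only [if_neg h]
      rw [if_neg (fun hg => h ⟨hg.nb1, hg.nb2⟩)]
      simp
  · intro w _
    split_ifs
    · refine Integrable.of_bound (C := 1) ?_ ?_
      · apply Measurable.aestronglyMeasurable
        simp_rw [sum_phases_eq]
        fun_prop
      · filter_upwards with ω
        rw [mul_comm, Complex.norm_exp_ofReal_mul_I]
    · simp


/-- number of visits of the vertex `a` -/
def vdeg {m N : ℕ} [NeZero m] (w : ZMod m → Fin N) (a : Fin N) : ℕ :=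
  (Finset.univ.filter fun i => w i = a).card

section Structure

variable {m N : ℕ} [NeZero m] {w : ZMod m → Fin N}

lemma exists_rev (hw : GoodWalk w) (i : ZMod m) :
    ∃ c, w c = w i ∧ w (c - 1) = w (i + 1) ∧ c ≠ i := by
  have h1 : 0 < stepCount w (w i) (w (i + 1)) :=
    Finset.card_pos.2 ⟨i, by simp⟩
  rw [hw.bal] at h1
  obtain ⟨j, hj⟩ := Finset.card_pos.1 h1
  simp only [Finset.mem_filter, Finset.mem_univ, true_and] at hj
  refine ⟨j + 1, hj.2, by simpa using hj.1, ?_⟩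
  rintro rfl
  have := hw.nb2 j
  apply this
  rw [hj.1, add_assoc, one_add_one_eq_two]

lemma partner_eq (hw : GoodWalk w) {i c : ZMod m} (hd : vdeg w (w i) = 2) (hc : w c = w i)
    (hci : c ≠ i) : w (c - 1) = w (i + 1) := by
  obtain ⟨c', h1, h2, h3⟩ := exists_rev hw i
  by_cases h : c' = c
  · rw [← h]; exact h2
  · exfalso
    have hsub : ({i, c, c'} : Finset (ZMod m)) ⊆ Finset.univ.filter fun j => w j = w i := by
      intro j hj
      simp only [Finset.mem_insert, Finset.mem_singleton] at hj
      simp only [Finset.mem_filter, Finset.mem_univ, true_and]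
      rcases hj with rfl | rfl | rfl
      · rfl
      · exact hc
      · exact h1
    have h4 := Finset.card_le_card hsub
    rw [Finset.card_eq_three.2 ⟨i, c, c', hci.symm, h3.symm, Ne.symm h, rfl⟩] at h4
    unfold vdeg at hd
    omega

lemma two_le_vdeg (hw : GoodWalk w) (i : ZMod m) : 2 ≤ vdeg w (w i) := by
  obtain ⟨c, h1, h2, h3⟩ := exists_rev hw i
  have hsub : ({i, c} : Finset (ZMod m)) ⊆ Finset.univ.filter fun j => w j = w i := by
    intro j hj
    simp only [Finset.mem_insert, Finset.mem_singleton] at hj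
    simp only [Finset.mem_filter, Finset.mem_univ, true_and]
    rcases hj with rfl | rfl
    · rfl
    · exact h1
  have h4 := Finset.card_le_card hsub
  rw [Finset.card_pair h3.symm] at h4
  exact h4

/-- periodic extension of a closed walk to the integers -/
def lift (w : ZMod m → Fin N) (t : ℤ) : Fin N := w (t : ZMod m)

lemma lift_add_period (t : ℤ) : lift w (t + m) = lift w t := by
  simp [lift]

lemma lift_nb1 (hw : GoodWalk w) (t : ℤ) : lift w t ≠ lift w (t + 1) := by
  have := hw.nb1 (t : ZMod m)
  simpa [lift] using this

lemma lift_nb2 (hw : GoodWalk w) (t : ℤ) : lift w t ≠ lift w (t + 2) := by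
  have := hw.nb2 (t : ZMod m)
  simpa [lift] using this

lemma exists_int_rep (z : ZMod m) (a : ℤ) : ∃ k : ℤ, a ≤ k ∧ k < a + m ∧ (k : ZMod m) = z := by
  have hm : (0 : ℤ) < m := by exact_mod_cast NeZero.pos m
  refine ⟨a + ((z.val : ℤ) - a) % m, ?_, ?_, ?_⟩
  · have := Int.emod_nonneg ((z.val : ℤ) - a) hm.ne'
    omega
  · have := Int.emod_lt_of_pos ((z.val : ℤ) - a) hm
    omega
  · have : ((((z.val : ℤ) - a) % m : ℤ) : ZMod m) = (((z.val : ℤ) - a : ℤ) : ZMod m) := by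
      simp
    push_cast at this ⊢
    rw [this]
    simp

lemma mirror_aux (hw : GoodWalk w) (a c : ℤ) (x : ℕ) (h0 : lift w a = lift w c)
    (h1 : lift w (a + 1) = lift w (c - 1))
    (hd : ∀ t : ℕ, 0 < t → t < x → vdeg w (lift w (a + t)) = 2) :
    ∀ t : ℕ, t < x → lift w (a + t) = lift w (c - t) ∧
      lift w (a + t + 1) = lift w (c - t - 1) := by
  intro t
  induction t with
  | zero => intro _; simpa using ⟨h0, h1⟩
  | succ t ih =>
    intro ht
    obtain ⟨e1, e2⟩ := ih (by omega)
    have hd' := hd (t + 1) (by omega) ht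
    have e3 : lift w (a + (t + 1 : ℕ)) = lift w (c - (t + 1 : ℕ)) := by
      push_cast
      rw [← add_assoc, ← sub_sub]; exact e2
    refine ⟨e3, ?_⟩
    have := partner_eq hw (i := ((a + (t + 1 : ℕ) : ℤ) : ZMod m))
      (c := ((c - (t + 1 : ℕ) : ℤ) : ZMod m)) hd' e3.symm ?_
    · simp only [lift]
      push_cast at this ⊢
      exact this.symm
    · intro hcon
      apply lift_nb2 hw (a + t)
      rw [e1]
      simp only [lift]
      congr 1
      push_cast at hcon ⊢
      linear_combination hcon

lemma mirror (hw : GoodWalk w) (a c : ℤ) (x : ℤ) (hx : 0 < x) (hac : a < c)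
    (h0 : lift w a = lift w c)
    (h1 : lift w (a + 1) = lift w (c - 1))
    (hd : ∀ t : ℤ, 0 < t → t < x → vdeg w (lift w (a + t)) = 2) :
    (∀ t : ℤ, 0 ≤ t → t ≤ x → lift w (a + t) = lift w (c - t)) ∧ 2 * x + 3 ≤ c - a := by
  have key : ∀ t : ℤ, 0 ≤ t → t ≤ x → lift w (a + t) = lift w (c - t) := by
    intro t ht0 htx
    have aux := mirror_aux hw a c x.toNat h0 h1
      (fun t h1 h2 => hd t (by omega) (by omega))
    rcases lt_or_eq_of_le htx with h | h
    · have := (aux t.toNat (by omega)).1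
      rwa [Int.toNat_of_nonneg ht0] at this
    · have := (aux (t - 1).toNat (by omega)).2
      rw [Int.toNat_of_nonneg (by omega)] at this
      rw [show a + t = a + (t - 1) + 1 by ring, show c - t = c - (t - 1) - 1 by ring]
      exact this
  refine ⟨key, ?_⟩
  by_contra hcon
  have e := key ((c - a - 1) / 2) (by omega) (by omega)
  rcases Int.emod_two_eq_zero_or_one (c - a - 1) with h | h
  · apply lift_nb1 hw (a + (c - a - 1) / 2)
    rw [e]
    congr 1
    omega
  · apply lift_nb2 hw (a + (c - a - 1) / 2)
    rw [e]
    congr 1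
    omega

lemma first_exit (a b : ℤ) (hab : a < b) (hb : vdeg w (lift w b) ≠ 2) :
    ∃ x : ℤ, 0 < x ∧ x ≤ b - a ∧ vdeg w (lift w (a + x)) ≠ 2 ∧
      ∀ t : ℤ, 0 < t → t < x → vdeg w (lift w (a + t)) = 2 := by
  classical
  have hex : ∃ k : ℕ, vdeg w (lift w (a + 1 + k)) ≠ 2 :=
    ⟨(b - a - 1).toNat, by
      rw [Int.toNat_of_nonneg (by omega), show a + 1 + (b - a - 1) = b by ring]; exact hb⟩
  refine ⟨Nat.find hex + 1, by omega, ?_, ?_, ?_⟩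
  · have : Nat.find hex ≤ (b - a - 1).toNat := by
      apply Nat.find_min'
      rw [Int.toNat_of_nonneg (by omega), show a + 1 + (b - a - 1) = b by ring]; exact hb
    omega
  · have := Nat.find_spec hex
    rwa [show a + ((Nat.find hex : ℤ) + 1) = a + 1 + Nat.find hex by ring]
  · intro t h1 h2
    have := Nat.find_min hex (m := (t - 1).toNat) (by omega)
    rw [Int.toNat_of_nonneg (by omega), show a + 1 + (t - 1) = a + t by ring] at this
    simpa using this

lemma bad_loop (hw : GoodWalk w) {u v : Fin N}
    (huv : ∀ i, vdeg w (w i) ≠ 2 → w i = u ∨ w i = v) (hu : vdeg w u ≠ 2)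
    (a b : ℤ) (hab : a < b) (ha : lift w a = u) (hb : lift w b = u)
    (hc : ∀ t, a < t → t < b → lift w t ≠ u) (h1 : lift w (a + 1) = lift w (b - 1)) :
    ∃ p q, a < p ∧ p < q ∧ q < b ∧ lift w p = v ∧ lift w q = v := by
  obtain ⟨x, hx0, hxb, hx, hd⟩ := first_exit (w := w) a b hab (by rw [hb]; exact hu)
  obtain ⟨hm, hf⟩ := mirror hw a b x hx0 hab (by rw [ha, hb]) h1 hd
  have hv : lift w (a + x) = v := by
    rcases huv _ hx with h | h
    · exact absurd h (hc _ (by omega) (by omega))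
    · exact h
  exact ⟨a + x, b - x, by omega, by omega, by omega, hv, by rw [← hm x hx0.le le_rfl]; exact hv⟩

lemma good_loop (hw : GoodWalk w) {u v : Fin N}
    (huv : ∀ i, vdeg w (w i) ≠ 2 → w i = u ∨ w i = v) (hu : vdeg w u ≠ 2)
    (a b c : ℤ) (hab : a < b) (hbc : b < c) (ha : lift w a = u) (hb : lift w b = u)
    (hc : lift w c = u)
    (hi1 : ∀ t, a < t → t < b → lift w t ≠ u) (hi2 : ∀ t, b < t → t < c → lift w t ≠ u)
    (h1 : lift w (a + 1) = lift w (c - 1)) :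
    ∃ x, 0 < x ∧ x < b - a ∧ x < c - b ∧ lift w (a + x) = v ∧
      ∀ t, 0 ≤ t → t ≤ x → lift w (a + t) = lift w (c - t) := by
  obtain ⟨x, hx0, hxb, hx, hd⟩ := first_exit (w := w) a b hab (by rw [hb]; exact hu)
  obtain ⟨hm, hf⟩ := mirror hw a c x hx0 (by omega) (by rw [ha, hc]) h1 hd
  have hxb' : x < b - a := by
    rcases lt_or_eq_of_le hxb with h | h
    · exact h
    · exfalso
      apply hi2 (c - x) (by omega) (by omega)
      rw [← hm x hx0.le le_rfl, h, show a + (b - a) = b by ring]; exact hb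
  have hv : lift w (a + x) = v := by
    rcases huv _ hx with h | h
    · exact absurd h (hi1 _ (by omega) (by omega))
    · exact h
  refine ⟨x, hx0, hxb', ?_, hv, hm⟩
  by_contra hcon
  have e := hm (c - b) (by omega) (by omega)
  rw [show c - (c - b) = b by ring, hb] at e
  exact hi1 _ (by omega) (by omega) e

lemma eight_loop (hw : GoodWalk w) {u : Fin N}
    (huv : ∀ i, vdeg w (w i) ≠ 2 → w i = u) (hu : vdeg w u ≠ 2)
    (a b c d : ℤ) (hab : a < b) (hbc : b < c) (hcd : c < d) (_hda : d < a + m)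
    (ha : lift w a = u) (hb : lift w b = u)
    (hset : ∀ k, a ≤ k → k < a + m → lift w k = u → k = a ∨ k = b ∨ k = c ∨ k = d) :
    d - c = b - a ∧ ∀ t, 0 ≤ t → t ≤ b - a → lift w (a + t) = lift w (d - t) := by
  obtain ⟨z, hz1, hz2, hz3⟩ := exists_rev hw (a : ZMod m)
  obtain ⟨k, hk1, hk2, rfl⟩ := exists_int_rep z a
  have hka : k ≠ a := by rintro rfl; exact hz3 rfl
  have hku : lift w k = u := by rw [← ha]; exact hz1
  obtain ⟨x, hx0, hxb, hx, hd⟩ := first_exit (w := w) a b hab (by rw [hb]; exact hu)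
  have hxu : lift w (a + x) = u := huv _ hx
  have hxb' : x = b - a := by
    rcases hset _ (by omega) (by omega) hxu with h | h | h | h <;> omega
  obtain ⟨hm, hf⟩ := mirror hw a k x hx0 (by omega) (by rw [ha, hku])
    (by simp only [lift]; push_cast; exact hz2.symm) hd
  have hkx : lift w (k - x) = u := by rw [← hm x hx0.le le_rfl]; exact hxu
  have h1 := hset k hk1 hk2 hku
  have h2 := hset (k - x) (by omega) (by omega) hkx
  have hkd : k = d := by omega
  subst hkd
  exact ⟨by omega, fun t h h' => hm t h (by omega)⟩

lemma card_positions (u : Fin N) :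
    ((Finset.Ico (0 : ℤ) m).filter fun k => lift w k = u).card = vdeg w u := by
  unfold vdeg
  refine Finset.card_bij (fun k _ => (k : ZMod m)) ?_ ?_ ?_
  · intro k hk
    simp only [Finset.mem_filter, Finset.mem_univ, true_and] at hk ⊢
    exact hk.2
  · intro k hk l hl h
    simp only [Finset.mem_filter, Finset.mem_Ico] at hk hl
    rw [ZMod.intCast_eq_intCast_iff_dvd_sub] at h
    have := Int.eq_zero_of_abs_lt_dvd h (by rw [abs_lt]; constructor <;> omega)
    omega
  · intro z hz
    obtain ⟨k, h1, h2, rfl⟩ := exists_int_rep z 0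
    simp only [Finset.mem_filter, Finset.mem_univ, true_and] at hz
    exact ⟨k, by simp only [Finset.mem_filter, Finset.mem_Ico]; exact ⟨⟨h1, by omega⟩, hz⟩, rfl⟩

lemma positions_three (h : vdeg w (lift w 0) = 3) :
    ∃ i j : ℤ, 0 < i ∧ i < j ∧ j < m ∧ lift w i = lift w 0 ∧ lift w j = lift w 0 ∧
      ∀ k : ℤ, 0 ≤ k → k < m → lift w k = lift w 0 → k = 0 ∨ k = i ∨ k = j := by
  have hm : (0 : ℤ) < m := by exact_mod_cast NeZero.pos m
  rw [← card_positions] at h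
  set S := (Finset.Ico (0 : ℤ) m).filter fun k => lift w k = lift w 0 with hS
  have h0 : (0 : ℤ) ∈ S := by simp [hS, NeZero.pos m]
  have h2 : (S.erase 0).card = 2 := by rw [Finset.card_erase_of_mem h0]; omega
  obtain ⟨i, j, hij, he⟩ := Finset.card_eq_two.1 h2
  have hmem : ∀ k, k ≠ 0 → (k ∈ S ↔ k = i ∨ k = j) := by
    intro k hk
    have : k ∈ S.erase 0 ↔ k ∈ ({i, j} : Finset ℤ) := by rw [he]
    simpa [hk] using this
  have hi0 : i ≠ 0 := by
    have : i ∈ S.erase 0 := by rw [he]; simp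
    exact (Finset.mem_erase.1 this).1
  have hj0 : j ≠ 0 := by
    have : j ∈ S.erase 0 := by rw [he]; simp
    exact (Finset.mem_erase.1 this).1
  have hi := (hmem i hi0).2 (Or.inl rfl)
  have hj := (hmem j hj0).2 (Or.inr rfl)
  have hall : ∀ k : ℤ, 0 ≤ k → k < m → lift w k = lift w 0 → k = 0 ∨ k = i ∨ k = j := by
    intro k h1 h2 h3
    by_cases hk : k = 0
    · exact Or.inl hk
    · exact Or.inr ((hmem k hk).1 (by simp [hS, h1, h2, h3]))
  simp only [hS, Finset.mem_filter, Finset.mem_Ico] at hi hj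
  rcases lt_or_gt_of_ne hij with h | h
  · exact ⟨i, j, by omega, h, by omega, hi.2, hj.2, hall⟩
  · exact ⟨j, i, by omega, h, by omega, hj.2, hi.2, fun k h1 h2 h3 => by
      rcases hall k h1 h2 h3 with h | h | h <;> simp [h]⟩

lemma sort_three (a b c : ℤ) (h1 : a ≠ b) (h2 : a ≠ c) (h3 : b ≠ c) :
    ∃ p q r : ℤ, p < q ∧ q < r ∧ ∀ k, (k = a ∨ k = b ∨ k = c) ↔ (k = p ∨ k = q ∨ k = r) := by
  rcases lt_or_gt_of_ne h1 with h | h <;> rcases lt_or_gt_of_ne h2 with h' | h' <;>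
    rcases lt_or_gt_of_ne h3 with h'' | h''
  · exact ⟨a, b, c, by omega, by omega, fun k => by omega⟩
  · exact ⟨a, c, b, by omega, by omega, fun k => by omega⟩
  · omega
  · exact ⟨c, a, b, by omega, by omega, fun k => by omega⟩
  · exact ⟨b, a, c, by omega, by omega, fun k => by omega⟩
  · omega
  · exact ⟨b, c, a, by omega, by omega, fun k => by omega⟩
  · exact ⟨c, b, a, by omega, by omega, fun k => by omega⟩

lemma positions_four (h : vdeg w (lift w 0) = 4) :
    ∃ i j l : ℤ, 0 < i ∧ i < j ∧ j < l ∧ l < m ∧ lift w i = lift w 0 ∧ lift w j = lift w 0 ∧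
      lift w l = lift w 0 ∧
      ∀ k : ℤ, 0 ≤ k → k < m → lift w k = lift w 0 → k = 0 ∨ k = i ∨ k = j ∨ k = l := by
  have hm : (0 : ℤ) < m := by exact_mod_cast NeZero.pos m
  rw [← card_positions] at h
  set S := (Finset.Ico (0 : ℤ) m).filter fun k => lift w k = lift w 0 with hS
  have h0 : (0 : ℤ) ∈ S := by simp [hS, NeZero.pos m]
  have h2 : (S.erase 0).card = 3 := by rw [Finset.card_erase_of_mem h0]; omega
  obtain ⟨i', j', l', hij, hil, hjl, he⟩ := Finset.card_eq_three.1 h2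
  obtain ⟨i, j, l, hlt1, hlt2, hiff⟩ := sort_three i' j' l' hij hil hjl
  have hmem : ∀ k, k ∈ S.erase 0 ↔ (k = i ∨ k = j ∨ k = l) := by
    intro k
    rw [he, ← hiff]
    simp
  have hi := (hmem i).2 (by simp)
  have hj := (hmem j).2 (by simp)
  have hl := (hmem l).2 (by simp)
  simp only [hS, Finset.mem_erase, Finset.mem_filter, Finset.mem_Ico] at hi hj hl
  refine ⟨i, j, l, by omega, hlt1, hlt2, by omega, hi.2.2, hj.2.2, hl.2.2, ?_⟩
  intro k h1 h2 h3
  by_cases hk : k = 0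
  · exact Or.inl hk
  · exact Or.inr ((hmem k).1 (by simp [hS, h1, h2, h3, hk]))

lemma no_four {v : Fin N} (hv : vdeg w v = 3) (a b c d : ℤ) (ha : lift w a = v)
    (hb : lift w b = v) (hc : lift w c = v) (hd : lift w d = v) (h0 : 0 ≤ a) (hab : a < b)
    (hbc : b < c) (hcd : c < d) (hdm : d < m) : False := by
  rw [← card_positions] at hv
  have hsub : ({a, b, c, d} : Finset ℤ) ⊆ (Finset.Ico (0 : ℤ) m).filter fun k => lift w k = v := by
    intro k hk
    simp only [Finset.mem_insert, Finset.mem_singleton] at hk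
    simp only [Finset.mem_filter, Finset.mem_Ico]
    rcases hk with rfl | rfl | rfl | rfl
    · exact ⟨by omega, ha⟩
    · exact ⟨by omega, hb⟩
    · exact ⟨by omega, hc⟩
    · exact ⟨by omega, hd⟩
  have h1 := Finset.card_le_card hsub
  have h2 : ({a, b, c, d} : Finset ℤ).card = 4 := by
    rw [Finset.card_insert_of_notMem, Finset.card_insert_of_notMem, Finset.card_insert_of_notMem,
      Finset.card_singleton] <;> simp <;> omega
  omega

lemma in_out_card (hw : GoodWalk w) (u b : Fin N) :
    (Finset.univ.filter fun s => w s = u ∧ w (s + 1) = b).card =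
    (Finset.univ.filter fun s => w s = u ∧ w (s - 1) = b).card := by
  have h := hw.bal u b
  unfold stepCount at h
  rw [h]
  refine Finset.card_bij (fun s _ => s + 1) ?_ ?_ ?_
  · intro s hs
    simpa [and_comm] using hs
  · intro s _ t _ h
    simpa using h
  · intro s hs
    refine ⟨s - 1, ?_, by simp⟩
    simpa [and_comm] using hs

lemma cyc_three {α : Type*} [DecidableEq α] (A B C P Q R : α) (h1 : A ≠ P) (h2 : B ≠ Q)
    (h3 : C ≠ R)
    (h : ∀ b, (if A = b then 1 else 0) + (if B = b then 1 else 0) + (if C = b then 1 else 0) =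
      (if P = b then 1 else 0) + (if Q = b then 1 else 0) + (if R = b then (1 : ℕ) else 0)) :
    (A = Q ∧ B = R ∧ C = P) ∨ (A = R ∧ B = P ∧ C = Q) := by
  have hA := h A
  have hB := h B
  have hC := h C
  have hP := h P
  have hQ := h Q
  have hR := h R
  grind

lemma in_out_three (hw : GoodWalk w) {p q r : ZMod m} (hpq : p ≠ q) (hpr : p ≠ r) (hqr : q ≠ r)
    (hset : ∀ s, w s = w p ↔ s = p ∨ s = q ∨ s = r) :
    (w (p + 1) = w (q - 1) ∧ w (q + 1) = w (r - 1) ∧ w (r + 1) = w (p - 1)) ∨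
    (w (p + 1) = w (r - 1) ∧ w (q + 1) = w (p - 1) ∧ w (r + 1) = w (q - 1)) := by
  have hnb : ∀ s, w (s + 1) ≠ w (s - 1) := by
    intro s h
    apply hw.nb2 (s - 1)
    rw [← h]; congr 1; ring
  apply cyc_three _ _ _ _ _ _ (hnb p) (hnb q) (hnb r)
  intro b
  have hS : (Finset.univ.filter fun s => w s = w p) = {p, q, r} := by
    ext s; simp [hset]
  have h := in_out_card hw (w p) b
  rw [← Finset.filter_filter, ← Finset.filter_filter, hS, Finset.card_filter, Finset.card_filter] at h
  rw [Finset.sum_insert (by simp [hpq, hpr]), Finset.sum_pair hqr,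
    Finset.sum_insert (by simp [hpq, hpr]), Finset.sum_pair hqr, ← add_assoc, ← add_assoc] at h
  exact h

lemma intCast_ne {a b : ℤ} (h1 : a < b) (h2 : b < a + m) : (a : ZMod m) ≠ (b : ZMod m) := by
  intro h
  rw [ZMod.intCast_eq_intCast_iff_dvd_sub] at h
  have := Int.eq_zero_of_abs_lt_dvd h (by rw [abs_lt]; constructor <;> omega)
  omega

lemma theta_struct (hw : GoodWalk w) {n : ℤ} (hm : (m : ℤ) = 2 * n) {v : Fin N}
    (h0 : vdeg w (lift w 0) = 3) (hv : vdeg w v = 3) (hne : lift w 0 ≠ v)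
    (huv : ∀ i, vdeg w (w i) ≠ 2 → w i = lift w 0 ∨ w i = v) :
    ∃ x y z : ℤ, 0 < x ∧ 0 < y ∧ 0 < z ∧ x + y + z = n ∧
      (∀ t, 0 ≤ t → t ≤ x → lift w t = lift w (n + x - t)) ∧
      (∀ t, 0 ≤ t → t ≤ z → lift w (x + y + t) = lift w (2 * n - t)) ∧
      (∀ t, 0 ≤ t → t ≤ y → lift w (n + x + t) = lift w (x + y - t)) := by
  obtain ⟨i, j, hi, hij, hj, hwi, hwj, hset⟩ := positions_three h0
  have h02 : vdeg w (lift w 0) ≠ 2 := by omega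
  have hL : ∀ t, lift w (t + m) = lift w t := lift_add_period
  have hwm : lift w m = lift w 0 := by simpa using hL 0
  have hi1 : ∀ t, 0 < t → t < i → lift w t ≠ lift w 0 := by
    intro t h1 h2 h3
    have := hset t (by omega) (by omega) h3
    omega
  have hi2 : ∀ t, i < t → t < j → lift w t ≠ lift w 0 := by
    intro t h1 h2 h3
    have := hset t (by omega) (by omega) h3
    omega
  have hi3 : ∀ t, j < t → t < m → lift w t ≠ lift w 0 := by
    intro t h1 h2 h3
    have := hset t (by omega) (by omega) h3
    omega
  have hi4 : ∀ t, (m : ℤ) < t → t < i + m → lift w t ≠ lift w 0 := by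
    intro t h1 h2 h3
    have e := hL (t - m)
    rw [sub_add_cancel] at e
    exact hi1 (t - m) (by omega) (by omega) (by rw [← e]; exact h3)
  have hset' : ∀ s : ZMod m, w s = w ((0 : ℤ) : ZMod m) ↔
      s = ((0 : ℤ) : ZMod m) ∨ s = (i : ZMod m) ∨ s = (j : ZMod m) := by
    intro s
    constructor
    · intro h
      obtain ⟨k, hk1, hk2, rfl⟩ := exists_int_rep s 0
      rcases hset k hk1 (by omega) h with h | h | h <;> simp [h]
    · rintro (rfl | rfl | rfl)
      · rfl
      · exact hwi
      · exact hwj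
  rcases in_out_three hw (intCast_ne hi (by omega)) (intCast_ne (by omega) (by omega))
    (intCast_ne hij (by omega)) hset' with ⟨e1, e2, e3⟩ | ⟨e1, e2, e3⟩
  · exfalso
    obtain ⟨p, q, h1, h2, h3, h4, h5⟩ := bad_loop hw huv h02 0 i hi rfl hwi hi1
      (by simp only [lift]; push_cast at e1 ⊢; simpa using e1)
    obtain ⟨p', q', h1', h2', h3', h4', h5'⟩ := bad_loop hw huv h02 i j hij hwi hwj hi2
      (by simp only [lift]; push_cast at e2 ⊢; exact e2)
    exact no_four hv p q p' q' h4 h5 h4' h5' (by omega) h2 (by omega) h2' (by omega)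
  · obtain ⟨x, hx0, hx1, hx2, hxv, hxm⟩ := good_loop hw huv h02 0 i j hi hij rfl hwi hwj hi1 hi2
      (by simp only [lift]; push_cast at e1 ⊢; simpa using e1)
    obtain ⟨z, hz0, hz1, hz2, hzv, hzm⟩ := good_loop hw huv h02 i j m hij hj hwi hwj hwm hi2 hi3
      (by simp only [lift]; push_cast at e2 ⊢; simpa using e2)
    obtain ⟨y, hy0, hy1, hy2, hyv, hym⟩ := good_loop hw huv h02 j m (i + m) hj (by omega) hwj hwm
      (by rw [hL]; exact hwi) hi3 hi4
      (by simp only [lift]; push_cast at e3 ⊢; simpa using e3)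
    have a1 : lift w (j - x) = v := by rw [← hxm x hx0.le le_rfl]; exact hxv
    have a2 : lift w (m - z) = v := by rw [← hzm z hz0.le le_rfl]; exact hzv
    have a3 : lift w (i - y) = v := by
      rw [← hL, show i - y + m = i + m - y by ring, ← hym y hy0.le le_rfl]; exact hyv
    rw [zero_add] at hxv
    have b1 : x = i - y := by
      by_contra hcon
      rcases lt_or_gt_of_ne hcon with h | h
      · exact no_four hv x (i - y) (j - x) (j + y) hxv a3 a1 hyv (by omega) h (by omega) (by omega)
          (by omega)
      · exact no_four hv (i - y) x (j - x) (j + y) a3 hxv a1 hyv (by omega) h (by omega) (by omega)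
          (by omega)
    have b2 : j - x = i + z := by
      by_contra hcon
      rcases lt_or_gt_of_ne hcon with h | h
      · exact no_four hv x (j - x) (i + z) (j + y) hxv a1 hzv hyv (by omega) (by omega) h (by omega)
          (by omega)
      · exact no_four hv x (i + z) (j - x) (j + y) hxv hzv a1 hyv (by omega) (by omega) h (by omega)
          (by omega)
    have b3 : j + y = m - z := by
      by_contra hcon
      rcases lt_or_gt_of_ne hcon with h | h
      · exact no_four hv x (j - x) (j + y) (m - z) hxv a1 hyv a2 (by omega) (by omega) (by omega) h
          (by omega)
      · exact no_four hv x (j - x) (m - z) (j + y) hxv a1 a2 hyv (by omega) (by omega) (by omega) h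
          (by omega)
    refine ⟨x, y, z, hx0, hy0, hz0, by omega, ?_, ?_, ?_⟩
    · intro t h1 h2
      have := hxm t h1 h2
      rwa [zero_add, show j - t = n + x - t by omega] at this
    · intro t h1 h2
      have := hzm t h1 h2
      rwa [show i + t = x + y + t by omega, hm] at this
    · intro t h1 h2
      have := hym t h1 h2
      rwa [show j + t = n + x + t by omega, show i + m - t = (x + y - t) + m by omega, hL] at this

lemma eight_struct (hw : GoodWalk w) {n : ℤ} (hm : (m : ℤ) = 2 * n)
    (h0 : vdeg w (lift w 0) = 4)
    (huv : ∀ i, vdeg w (w i) ≠ 2 → w i = lift w 0) :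
    ∃ x y : ℤ, 0 < x ∧ 0 < y ∧ x + y = n ∧ lift w x = lift w 0 ∧
      (∀ t, 0 ≤ t → t ≤ x → lift w t = lift w (n + x - t)) ∧
      (∀ t, 0 ≤ t → t ≤ y → lift w (x + t) = lift w (2 * n - t)) := by
  obtain ⟨i, j, l, hi, hij, hjl, hl, hwi, hwj, hwl, hset⟩ := positions_four h0
  have h02 : vdeg w (lift w 0) ≠ 2 := by omega
  have hL : ∀ t, lift w (t + m) = lift w t := lift_add_period
  obtain ⟨e1, e2⟩ := eight_loop hw huv h02 0 i j l hi hij hjl (by omega) rfl hwi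
    (fun k h1 h2 h3 => hset k h1 (by omega) h3)
  obtain ⟨e3, e4⟩ := eight_loop hw huv h02 i j l m hij hjl hl (by omega) hwi hwj
    (fun k h1 h2 h3 => by
      by_cases hk : k < m
      · have := hset k (by omega) hk h3
        omega
      · have e := hL (k - m)
        rw [sub_add_cancel] at e
        have := hset (k - m) (by omega) (by omega) (by rw [← e]; exact h3)
        omega)
  refine ⟨i, j - i, hi, by omega, by omega, hwi, ?_, ?_⟩
  · intro t h1 h2
    have := e2 t h1 (by omega)
    rwa [zero_add, show l - t = n + i - t by omega] at this
  · intro t h1 h2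
    have := e4 t h1 (by omega)
    rwa [hm] at this

end Structure


lemma sum_excess {ι : Type*} [DecidableEq ι] (s : Finset ι) (d : ι → ℕ) (h2 : ∀ i ∈ s, 2 ≤ d i)
    (hs : ∑ i ∈ s, d i = 2 * s.card + 2) :
    (∃ u ∈ s, d u = 4 ∧ ∀ i ∈ s, i ≠ u → d i = 2) ∨
    (∃ u ∈ s, ∃ v ∈ s, u ≠ v ∧ d u = 3 ∧ d v = 3 ∧ ∀ i ∈ s, i ≠ u → i ≠ v → d i = 2) := by
  have he : ∑ i ∈ s, (d i - 2) = 2 := by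
    have : ∑ i ∈ s, (d i - 2) + ∑ i ∈ s, 2 = ∑ i ∈ s, d i := by
      rw [← Finset.sum_add_distrib]
      exact Finset.sum_congr rfl fun i hi => by have := h2 i hi; omega
    simp at this
    omega
  obtain ⟨u, hu, hu'⟩ : ∃ u ∈ s, d u - 2 ≠ 0 := by
    by_contra hcon
    push Not at hcon
    rw [Finset.sum_eq_zero hcon] at he
    omega
  have h1 := Finset.add_sum_erase s (fun i => d i - 2) hu
  by_cases hu4 : d u = 4
  · left
    refine ⟨u, hu, hu4, fun i hi hiu => ?_⟩
    have h3 : ∑ i ∈ s.erase u, (d i - 2) = 0 := by omega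
    rw [Finset.sum_eq_zero_iff] at h3
    have := h3 i (Finset.mem_erase.2 ⟨hiu, hi⟩)
    have := h2 i hi
    omega
  · right
    have h3 : ∑ i ∈ s.erase u, (d i - 2) = 1 := by
      by_contra hcon
      have : d u - 2 = 1 ∨ d u - 2 = 2 := by omega
      omega
    obtain ⟨v, hv, hv'⟩ : ∃ v ∈ s.erase u, d v - 2 ≠ 0 := by
      by_contra hcon
      push Not at hcon
      rw [Finset.sum_eq_zero hcon] at h3
      omega
    have h4 := Finset.add_sum_erase (s.erase u) (fun i => d i - 2) hv
    have hvs := Finset.mem_erase.1 hv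
    refine ⟨u, hu, v, hvs.2, hvs.1.symm, by omega, by omega, fun i hi hiu hiv => ?_⟩
    have h5 : ∑ i ∈ (s.erase u).erase v, (d i - 2) = 0 := by omega
    rw [Finset.sum_eq_zero_iff] at h5
    have := h5 i (Finset.mem_erase.2 ⟨hiv, Finset.mem_erase.2 ⟨hiu, hi⟩⟩)
    have := h2 i hi
    omega

section Degrees

variable {m N : ℕ} [NeZero m] {w : ZMod m → Fin N}

lemma sum_vdeg : ∑ a ∈ Finset.univ.image w, vdeg w a = m := by
  have := Finset.card_eq_sum_card_image w (Finset.univ : Finset (ZMod m))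
  rw [Finset.card_univ, ZMod.card] at this
  exact this.symm

lemma image_two_le (hw : GoodWalk w) : ∀ a ∈ Finset.univ.image w, 2 ≤ vdeg w a := by
  intro a ha
  obtain ⟨i, _, rfl⟩ := Finset.mem_image.1 ha
  exact two_le_vdeg hw i

lemma image_card_lt (hw : GoodWalk w) {n : ℕ} (hm : m = 2 * n) :
    (Finset.univ.image w).card < n := by
  have h1 : ∑ a ∈ Finset.univ.image w, 2 ≤ ∑ a ∈ Finset.univ.image w, vdeg w a :=
    Finset.sum_le_sum (image_two_le hw)
  have h1' := h1
  rw [sum_vdeg] at h1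
  simp only [Finset.sum_const, smul_eq_mul] at h1
  rcases lt_or_ge (Finset.univ.image w).card n with h | h
  · exact h
  exfalso
  have hn : (Finset.univ.image w).card = n := by omega
  have h2 : ∑ a ∈ Finset.univ.image w, 2 = ∑ a ∈ Finset.univ.image w, vdeg w a := by
    rw [sum_vdeg]; simp [hn]; omega
  rw [Finset.sum_eq_sum_iff_of_le (image_two_le hw)] at h2
  have hd : ∀ i, vdeg w (w i) = 2 := fun i => (h2 _ (Finset.mem_image_of_mem _ (Finset.mem_univ i))).symm
  obtain ⟨z, hz1, hz2, hz3⟩ := exists_rev hw ((0 : ℤ) : ZMod m)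
  obtain ⟨k, hk1, hk2, rfl⟩ := exists_int_rep z 0
  have hka : k ≠ 0 := by rintro rfl; exact hz3 rfl
  have := (mirror hw 0 k k (by omega) (by omega) hz1.symm
    (by simp only [lift]; push_cast at hz2 ⊢; simpa using hz2.symm) (fun t _ _ => hd _)).2
  omega

lemma degree_cases (hw : GoodWalk w) {n : ℕ} (hn : 1 ≤ n) (hm : m = 2 * n)
    (hV : (Finset.univ.image w).card = n - 1) :
    (∃ u, vdeg w u = 4 ∧ ∀ i, w i ≠ u → vdeg w (w i) = 2) ∨
    (∃ u v, u ≠ v ∧ vdeg w u = 3 ∧ vdeg w v = 3 ∧ ∀ i, w i ≠ u → w i ≠ v → vdeg w (w i) = 2) := by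
  have hmem : ∀ i, w i ∈ Finset.univ.image w := fun i => Finset.mem_image_of_mem _ (Finset.mem_univ i)
  rcases sum_excess (Finset.univ.image w) (vdeg w) (image_two_le hw)
    (by rw [sum_vdeg, hV]; omega) with ⟨u, _, h4, h⟩ | ⟨u, _, v, _, huv, h1, h2, h⟩
  · exact Or.inl ⟨u, h4, fun i hi => h _ (hmem i) hi⟩
  · exact Or.inr ⟨u, v, huv, h1, h2, fun i hi hi' => h _ (hmem i) hi hi'⟩

lemma card_deg_three (hw : GoodWalk w) {n : ℕ} (hn : 1 ≤ n) (hm : m = 2 * n)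
    (hV : (Finset.univ.image w).card = n - 1) (h3 : ∃ i, vdeg w (w i) = 3) :
    (Finset.univ.filter fun i => vdeg w (w i) = 3).card = 6 := by
  obtain ⟨i, hi⟩ := h3
  rcases degree_cases hw hn hm hV with ⟨u, hu, h⟩ | ⟨u, v, huv, hu, hv, h⟩
  · by_cases hiu : w i = u
    · rw [hiu] at hi; omega
    · have := h i hiu; omega
  · have : (Finset.univ.filter fun i => vdeg w (w i) = 3) =
      (Finset.univ.filter fun i => w i = u) ∪ (Finset.univ.filter fun i => w i = v) := by
      ext j
      simp only [Finset.mem_filter, Finset.mem_univ, true_and, Finset.mem_union]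
      constructor
      · intro hj
        by_contra hcon
        push Not at hcon
        have := h j hcon.1 hcon.2
        omega
      · rintro (hj | hj) <;> rw [hj] <;> assumption
    rw [this, Finset.card_union_of_disjoint]
    · unfold vdeg at hu hv
      rw [hu, hv]
    · rw [Finset.disjoint_filter]
      intro j _ h1 h2
      exact huv (h1.symm.trans h2)

lemma card_deg_four (hw : GoodWalk w) {n : ℕ} (hn : 1 ≤ n) (hm : m = 2 * n)
    (hV : (Finset.univ.image w).card = n - 1) (h4 : ∃ i, vdeg w (w i) = 4) :
    (Finset.univ.filter fun i => vdeg w (w i) = 4).card = 4 := by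
  obtain ⟨i, hi⟩ := h4
  rcases degree_cases hw hn hm hV with ⟨u, hu, h⟩ | ⟨u, v, huv, hu, hv, h⟩
  · have : (Finset.univ.filter fun i => vdeg w (w i) = 4) =
      (Finset.univ.filter fun i => w i = u) := by
      ext j
      simp only [Finset.mem_filter, Finset.mem_univ, true_and]
      constructor
      · intro hj
        by_contra hcon
        have := h j hcon
        omega
      · intro hj; rw [hj]; assumption
    rw [this]
    exact hu
  · exfalso
    by_cases hiu : w i = u
    · rw [hiu] at hi; omega
    · by_cases hiv : w i = v
      · rw [hiv] at hi; omega
      · have := h i hiu hiv; omega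

lemma stepCount_shift (w : ZMod m → Fin N) (k : ZMod m) (a b : Fin N) :
    stepCount (fun i => w (i + k)) a b = stepCount w a b := by
  unfold stepCount
  refine Finset.card_bij (fun i _ => i + k) ?_ ?_ ?_
  · intro i hi
    simp only [Finset.mem_filter, Finset.mem_univ, true_and] at hi ⊢
    rwa [show i + k + 1 = i + 1 + k by ring]
  · intro i _ j _ h; simpa using h
  · intro i hi
    refine ⟨i - k, ?_, by simp⟩
    simp only [Finset.mem_filter, Finset.mem_univ, true_and] at hi ⊢
    rwa [sub_add_cancel, show i - k + 1 + k = i + 1 by ring]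

lemma vdeg_shift (w : ZMod m → Fin N) (k : ZMod m) (a : Fin N) :
    vdeg (fun i => w (i + k)) a = vdeg w a := by
  unfold vdeg
  refine Finset.card_bij (fun i _ => i + k) ?_ ?_ ?_
  · intro i hi
    simpa using hi
  · intro i _ j _ h; simpa using h
  · intro i hi
    exact ⟨i - k, by simpa using hi, by simp⟩

lemma image_shift (w : ZMod m → Fin N) (k : ZMod m) :
    Finset.univ.image (fun i => w (i + k)) = Finset.univ.image w := by
  ext a
  simp only [Finset.mem_image, Finset.mem_univ, true_and]
  constructor
  · rintro ⟨i, rfl⟩; exact ⟨_, rfl⟩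
  · rintro ⟨i, rfl⟩; exact ⟨i - k, by simp⟩

lemma goodWalk_shift (hw : GoodWalk w) (k : ZMod m) : GoodWalk (fun i => w (i + k)) := by
  refine ⟨fun i => ?_, fun i => ?_, fun a b => ?_⟩
  · have := hw.nb1 (i + k)
    rwa [show i + k + 1 = i + 1 + k by ring] at this
  · have := hw.nb2 (i + k)
    rwa [show i + k + 2 = i + 2 + k by ring] at this
  · rw [stepCount_shift, stepCount_shift, hw.bal]

open Classical in
lemma double_count (m N V d r : ℕ) [NeZero m]
    (h : ∀ w : ZMod m → Fin N, GoodWalk w → (Finset.univ.image w).card = V →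
      (∃ i, vdeg w (w i) = d) → (Finset.univ.filter fun i => vdeg w (w i) = d).card = r) :
    r * (Finset.univ.filter fun w : ZMod m → Fin N =>
      GoodWalk w ∧ (Finset.univ.image w).card = V ∧ ∃ i, vdeg w (w i) = d).card =
    m * (Finset.univ.filter fun w : ZMod m → Fin N =>
      GoodWalk w ∧ (Finset.univ.image w).card = V ∧ vdeg w (w 0) = d).card := by
  set A := Finset.univ.filter fun w : ZMod m → Fin N =>
      GoodWalk w ∧ (Finset.univ.image w).card = V ∧ ∃ i, vdeg w (w i) = d with hA
  have h1 := Finset.sum_card_bipartiteAbove_eq_sum_card_bipartiteBelow (s := A)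
    (t := (Finset.univ : Finset (ZMod m))) (fun w i => vdeg w (w i) = d)
  simp only [Finset.bipartiteAbove, Finset.bipartiteBelow] at h1
  have h2 : ∑ w ∈ A, (Finset.univ.filter fun i => vdeg w (w i) = d).card = A.card * r := by
    rw [Finset.sum_const_nat]
    intro w hw
    simp only [hA, Finset.mem_filter, Finset.mem_univ, true_and] at hw
    exact h w hw.1 hw.2.1 hw.2.2
  have h3 : ∀ k : ZMod m, (A.filter fun w => vdeg w (w k) = d).card =
      (Finset.univ.filter fun w : ZMod m → Fin N =>
      GoodWalk w ∧ (Finset.univ.image w).card = V ∧ vdeg w (w 0) = d).card := by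
    intro k
    refine Finset.card_bij' (fun w _ i => w (i + k)) (fun w _ i => w (i + (-k))) ?_ ?_ ?_ ?_
    · intro w hw
      simp only [hA, Finset.mem_filter, Finset.mem_univ, true_and] at hw ⊢
      refine ⟨goodWalk_shift hw.1.1 k, ?_, ?_⟩
      · rw [image_shift]; exact hw.1.2.1
      · rw [vdeg_shift, zero_add]; exact hw.2
    · intro w hw
      simp only [hA, Finset.mem_filter, Finset.mem_univ, true_and] at hw ⊢
      have e : vdeg (fun i => w (i + -k)) (w (k + -k)) = d := by
        rw [vdeg_shift, add_neg_cancel]; exact hw.2.2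
      refine ⟨⟨goodWalk_shift hw.1 (-k), ?_, k, e⟩, e⟩
      · rw [image_shift]; exact hw.2.1
    · intro w _; funext i; simp
    · intro w _; funext i; simp
  rw [h2, Finset.sum_congr rfl (fun k _ => h3 k)] at h1
  simp only [Finset.sum_const, Finset.card_univ, ZMod.card, smul_eq_mul] at h1
  rw [mul_comm r, h1]

end Degrees

section Patterns

variable {m N : ℕ} [NeZero m]

lemma card_pattern (F : ZMod m → ℕ) :
    (Finset.univ.filter fun w : ZMod m → Fin N => ∀ i j, w i = w j ↔ F i = F j).card =
      N.descFactorial (Finset.univ.image F).card := by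
  have h1 : (Finset.univ.filter fun w : ZMod m → Fin N => ∀ i j, w i = w j ↔ F i = F j).card
      = Fintype.card ((Finset.univ.image F) ↪ Fin N) := by
    rw [← Finset.card_univ]
    have hmem : ∀ i, F i ∈ Finset.univ.image F :=
      fun i => Finset.mem_image_of_mem _ (Finset.mem_univ i)
    symm
    refine Finset.card_bij (fun g _ i => g ⟨F i, hmem i⟩) ?_ ?_ ?_
    · intro g _
      simp
    · intro g _ g' _ h
      ext ⟨a, ha⟩
      obtain ⟨i, _, rfl⟩ := Finset.mem_image.1 ha
      have := congrFun h i
      rw [this]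
    · intro w hw
      simp only [Finset.mem_filter, Finset.mem_univ, true_and] at hw
      have hch : ∀ a : Finset.univ.image F, ∃ i, F i = a := by
        rintro ⟨a, ha⟩
        obtain ⟨i, _, rfl⟩ := Finset.mem_image.1 ha
        exact ⟨i, rfl⟩
      choose r hr using hch
      refine ⟨⟨fun a => w (r a), ?_⟩, Finset.mem_univ _, ?_⟩
      · intro a b hab
        have := (hw _ _).1 hab
        rw [hr, hr] at this
        exact Subtype.ext this
      · funext i
        exact (hw _ _).2 (hr _)
  rw [h1, Fintype.card_embedding_eq]
  simp

lemma pattern_of_rep {w : ZMod m → Fin N} (F : ZMod m → ℕ)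
    (h : ∀ s, w s = w ((F s : ℕ) : ZMod m))
    (hc : (Finset.univ.image F).card = (Finset.univ.image w).card) :
    ∀ i j, w i = w j ↔ F i = F j := by
  set g : ℕ → Fin N := fun k => w ((k : ℕ) : ZMod m) with hg
  have hi : Finset.univ.image w = (Finset.univ.image F).image g := by
    rw [Finset.image_image]
    congr 1
    funext s
    exact h s
  rw [hi] at hc
  have hinj := Finset.card_image_iff.1 hc.symm
  intro i j
  constructor
  · intro hij
    apply hinj (by simp) (by simp)
    simp only [hg]
    rw [← h, ← h, hij]
  · intro hij
    rw [h i, h j, hij]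

lemma goodWalk_of_pattern {w : ZMod m → Fin N} (F : ZMod m → ℕ)
    (hF : ∀ i j, w i = w j ↔ F i = F j) (h1 : ∀ i, F i ≠ F (i + 1)) (h2 : ∀ i, F i ≠ F (i + 2))
    (ρ : ZMod m → ZMod m) (hρ : ∀ i, ρ (ρ i) = i) (hρ1 : ∀ i, F (ρ i) = F (i + 1))
    (hρ2 : ∀ i, F (ρ i + 1) = F i) : GoodWalk w := by
  refine ⟨fun i h => h1 i ((hF _ _).1 h), fun i h => h2 i ((hF _ _).1 h), fun a b => ?_⟩
  have e1 : ∀ i, w (ρ i) = w (i + 1) := fun i => (hF _ _).2 (hρ1 i)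
  have e2 : ∀ i, w (ρ i + 1) = w i := fun i => (hF _ _).2 (hρ2 i)
  unfold stepCount
  refine Finset.card_bij' (fun i _ => ρ i) (fun i _ => ρ i) ?_ ?_ ?_ ?_
  · intro i hi
    simpa [e1, e2, and_comm] using hi
  · intro i hi
    simpa [e1, e2, and_comm] using hi
  · intro i _; exact hρ i
  · intro i _; exact hρ i

lemma card_image_of_pattern {w : ZMod m → Fin N} (F : ZMod m → ℕ)
    (hF : ∀ i j, w i = w j ↔ F i = F j) :
    (Finset.univ.image w).card = (Finset.univ.image F).card := by
  refine Finset.card_bij' (fun a ha => F (Finset.mem_image.1 ha).choose)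
    (fun b hb => w (Finset.mem_image.1 hb).choose) ?_ ?_ ?_ ?_
  · intro a ha; simp
  · intro a ha; simp
  · intro a ha
    have h1 := (Finset.mem_image.1 ha).choose_spec.2
    have hb : F (Finset.mem_image.1 ha).choose ∈ Finset.univ.image F := by simp
    have h2 := (Finset.mem_image.1 hb).choose_spec.2
    rw [← hF] at h2
    exact h2.trans h1
  · intro a ha
    have h1 := (Finset.mem_image.1 ha).choose_spec.2
    have hb : w (Finset.mem_image.1 ha).choose ∈ Finset.univ.image w := by simp
    have h2 := (Finset.mem_image.1 hb).choose_spec.2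
    rw [hF] at h2
    exact h2.trans h1

lemma vdeg_of_pattern {w : ZMod m → Fin N} (F : ZMod m → ℕ)
    (hF : ∀ i j, w i = w j ↔ F i = F j) (i : ZMod m) :
    vdeg w (w i) = (Finset.univ.filter fun j => F j = F i).card := by
  unfold vdeg
  simp_rw [hF]

end Patterns

lemma card_low_image (m N k : ℕ) [NeZero m] :
    (Finset.univ.filter fun w : ZMod m → Fin N => (Finset.univ.image w).card ≤ k).card
      ≤ k ^ m * N ^ k := by
  have : (Finset.univ.filter fun w : ZMod m → Fin N => (Finset.univ.image w).card ≤ k) ⊆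
      (Finset.univ : Finset ((ZMod m → Fin k) × (Fin k → Fin N))).image (fun p i => p.2 (p.1 i)) := by
    intro w hw
    simp only [Finset.mem_filter, Finset.mem_univ, true_and] at hw
    simp only [Finset.mem_image, Finset.mem_univ, true_and, Prod.exists]
    have hmem : ∀ i, w i ∈ Finset.univ.image w :=
      fun i => Finset.mem_image_of_mem _ (Finset.mem_univ i)
    let e := (Finset.univ.image w).equivFin
    refine ⟨fun i => Fin.castLE hw (e ⟨w i, hmem i⟩),
      fun a => if h : (a : ℕ) < (Finset.univ.image w).card then (e.symm ⟨a, h⟩ : Fin N) else w 0, ?_⟩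
    funext i
    simp
  refine (Finset.card_le_card this).trans (Finset.card_image_le.trans ?_)
  simp [ZMod.card]


/-- successor modulo `2n` -/
def nxt (n s : ℕ) : ℕ := if s + 1 = 2 * n then 0 else s + 1

/-- canonical labelling of the theta pattern -/
def thetaF (n x y s : ℕ) : ℕ :=
  if s < n then (if s = x + y then 0 else s)
  else if s ≤ n + x then n + x - s
  else if s ≤ n + x + y then n + 2 * x + y - s
  else 2 * n + x + y - s

/-- canonical labelling of the figure-eight pattern -/
def eightF (n x s : ℕ) : ℕ :=
  if s = x ∨ s = n then 0
  else if s < n then s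
  else if s ≤ n + x then n + x - s
  else 2 * n + x - s

/-- step reversal -/
def revS (n x y s : ℕ) : ℕ :=
  if s < x ∨ (n ≤ s ∧ s < n + x) then n + x - 1 - s
  else if s < x + y ∨ (n ≤ s ∧ s < n + x + y) then n + 2 * x + y - 1 - s
  else 2 * n + x + y - 1 - s

/-- admissible parameters of theta patterns -/
def ThetaOK (n x y : ℕ) : Prop :=
  1 ≤ x ∧ 1 ≤ y ∧ x + y < n ∧ ¬ (x = 1 ∧ y = 1) ∧ ¬ (x = 1 ∧ x + y + 1 = n) ∧
    ¬ (y = 1 ∧ x + y + 1 = n)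

lemma theta_nb1 {n x y s : ℕ} (h : ThetaOK n x y) (hs : s < 2 * n) :
    thetaF n x y s ≠ thetaF n x y (nxt n s) := by
  obtain ⟨h1, h2, h3, h4, h5, h6⟩ := h
  unfold thetaF nxt
  split_ifs <;> omega

lemma theta_nb2 {n x y s : ℕ} (h : ThetaOK n x y) (hs : s < 2 * n) :
    thetaF n x y s ≠ thetaF n x y (nxt n (nxt n s)) := by
  obtain ⟨h1, h2, h3, h4, h5, h6⟩ := h
  have hn : nxt n (nxt n s) = if s + 2 < 2 * n then s + 2 else s + 2 - 2 * n := by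
    unfold nxt
    split_ifs <;> omega
  rw [hn]
  unfold thetaF
  split_ifs <;> omega

lemma rev_lt {n x y s : ℕ} (h1 : 1 ≤ x) (h2 : 1 ≤ y) (h3 : x + y ≤ n) (hs : s < 2 * n) :
    revS n x y s < 2 * n := by
  unfold revS
  split_ifs <;> omega

lemma rev_rev {n x y s : ℕ} (h1 : 1 ≤ x) (h2 : 1 ≤ y) (h3 : x + y ≤ n) (hs : s < 2 * n) :
    revS n x y (revS n x y s) = s := by
  unfold revS
  split_ifs <;> omega

lemma theta_rev1 {n x y s : ℕ} (h : ThetaOK n x y) (hs : s < 2 * n) :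
    thetaF n x y (revS n x y s) = thetaF n x y (nxt n s) := by
  obtain ⟨h1, h2, h3, h4, h5, h6⟩ := h
  unfold thetaF nxt revS
  split_ifs <;> omega

lemma theta_zero_iff {n x y s : ℕ} (h : ThetaOK n x y) (hs : s < 2 * n) :
    thetaF n x y s = thetaF n x y 0 ↔ s = 0 ∨ s = x + y ∨ s = n + x := by
  obtain ⟨h1, h2, h3, h4, h5, h6⟩ := h
  unfold thetaF
  split_ifs <;> omega

lemma theta_range {n x y s : ℕ} (h : ThetaOK n x y) (hs : s < 2 * n) :
    thetaF n x y s < n ∧ thetaF n x y s ≠ x + y := by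
  obtain ⟨h1, h2, h3, h4, h5, h6⟩ := h
  unfold thetaF
  split_ifs <;> omega

lemma eight_nb1 {n x s : ℕ} (h : 3 ≤ x) (h' : x + 3 ≤ n) (hs : s < 2 * n) :
    eightF n x s ≠ eightF n x (nxt n s) := by
  unfold eightF nxt
  split_ifs <;> omega

lemma eight_nb2 {n x s : ℕ} (h : 3 ≤ x) (h' : x + 3 ≤ n) (hs : s < 2 * n) :
    eightF n x s ≠ eightF n x (nxt n (nxt n s)) := by
  have hn : nxt n (nxt n s) = if s + 2 < 2 * n then s + 2 else s + 2 - 2 * n := by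
    unfold nxt
    split_ifs <;> omega
  rw [hn]
  unfold eightF
  split_ifs <;> omega

lemma eight_rev1 {n x s : ℕ} (h : 3 ≤ x) (h' : x + 3 ≤ n) (hs : s < 2 * n) :
    eightF n x (revS n x (n - x) s) = eightF n x (nxt n s) := by
  unfold eightF nxt revS
  split_ifs <;> omega

lemma eight_zero_iff {n x s : ℕ} (h : 3 ≤ x) (h' : x + 3 ≤ n) (hs : s < 2 * n) :
    eightF n x s = eightF n x 0 ↔ s = 0 ∨ s = x ∨ s = n ∨ s = n + x := by
  unfold eightF
  split_ifs <;> omega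

lemma eight_range {n x s : ℕ} (h : 3 ≤ x) (h' : x + 3 ≤ n) (hs : s < 2 * n) :
    eightF n x s < n ∧ eightF n x s ≠ x := by
  unfold eightF
  split_ifs <;> omega


section Final

variable {n N : ℕ} [NeZero (2 * n)]

lemma val_add_one_nxt (i : ZMod (2 * n)) : (i + 1).val = nxt n i.val := by
  have hi := ZMod.val_lt i
  have h1 : (1 : ZMod (2 * n)).val = 1 := ZMod.val_one'' (by omega)
  rw [ZMod.val_add, h1]
  unfold nxt
  split_ifs with h
  · rw [h]; simp
  · exact Nat.mod_eq_of_lt (by omega)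

lemma val_add_two_nxt (i : ZMod (2 * n)) : (i + 2).val = nxt n (nxt n i.val) := by
  rw [show i + 2 = i + 1 + 1 by ring, val_add_one_nxt, val_add_one_nxt]

lemma goodWalk_of_fun {w : ZMod (2 * n) → Fin N} (f r : ℕ → ℕ)
    (hF : ∀ i j, w i = w j ↔ f i.val = f j.val)
    (h1 : ∀ s < 2 * n, f s ≠ f (nxt n s)) (h2 : ∀ s < 2 * n, f s ≠ f (nxt n (nxt n s)))
    (hr : ∀ s < 2 * n, r s < 2 * n) (hrr : ∀ s < 2 * n, r (r s) = s)
    (hr1 : ∀ s < 2 * n, f (r s) = f (nxt n s)) : GoodWalk w := by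
  have hv : ∀ i : ZMod (2 * n), ((r i.val : ℕ) : ZMod (2 * n)).val = r i.val := fun i =>
    ZMod.val_natCast_of_lt (hr _ (ZMod.val_lt i))
  refine goodWalk_of_pattern (fun i => f i.val) hF (fun i => ?_) (fun i => ?_)
    (fun i => ((r i.val : ℕ) : ZMod (2 * n))) (fun i => ?_) (fun i => ?_) (fun i => ?_)
  · rw [val_add_one_nxt]; exact h1 _ (ZMod.val_lt i)
  · rw [val_add_two_nxt]; exact h2 _ (ZMod.val_lt i)
  · rw [hv, hrr _ (ZMod.val_lt i)]; simp
  · rw [hv, val_add_one_nxt]; exact hr1 _ (ZMod.val_lt i)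
  · rw [val_add_one_nxt, hv, ← hr1 _ (hr _ (ZMod.val_lt i)), hrr _ (ZMod.val_lt i)]

lemma card_filter_val (P : ℕ → Prop) [DecidablePred P] :
    (Finset.univ.filter fun j : ZMod (2 * n) => P j.val).card =
      ((Finset.range (2 * n)).filter P).card := by
  refine Finset.card_bij (fun j _ => j.val) ?_ ?_ ?_
  · intro j hj
    simp only [Finset.mem_filter, Finset.mem_univ, true_and, Finset.mem_range] at hj ⊢
    exact ⟨ZMod.val_lt j, hj⟩
  · intro i _ j _ h
    exact ZMod.val_injective _ h
  · intro k hk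
    simp only [Finset.mem_filter, Finset.mem_range] at hk
    have hv := ZMod.val_natCast_of_lt hk.1
    exact ⟨(k : ZMod (2 * n)), by simp [hv, hk.2], hv⟩

lemma card_image_val (f : ℕ → ℕ) (q : ℕ) (hq : q < n)
    (h1 : ∀ s < 2 * n, f s < n ∧ f s ≠ q) (h2 : ∀ s < n, s ≠ q → f s = s) :
    (Finset.univ.image fun j : ZMod (2 * n) => f j.val).card = n - 1 := by
  have : (Finset.univ.image fun j : ZMod (2 * n) => f j.val) = (Finset.range n).erase q := by
    ext k
    simp only [Finset.mem_image, Finset.mem_univ, true_and, Finset.mem_erase, Finset.mem_range]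
    constructor
    · rintro ⟨j, rfl⟩
      have := h1 _ (ZMod.val_lt j)
      exact ⟨this.2, this.1⟩
    · rintro ⟨hk, hk'⟩
      refine ⟨(k : ZMod (2 * n)), ?_⟩
      rw [ZMod.val_natCast_of_lt (by omega)]
      exact h2 k hk' hk
  rw [this, Finset.card_erase_of_mem (by simpa using hq), Finset.card_range]

lemma theta_image_card {x y : ℕ} (h : ThetaOK n x y) :
    (Finset.univ.image fun j : ZMod (2 * n) => thetaF n x y j.val).card = n - 1 := by
  refine card_image_val _ (x + y) h.2.2.1 (fun s hs => theta_range h hs) ?_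
  intro s hs hsq
  simp [thetaF, hs, hsq]

lemma eight_image_card {x : ℕ} (h : 3 ≤ x) (h' : x + 3 ≤ n) :
    (Finset.univ.image fun j : ZMod (2 * n) => eightF n x j.val).card = n - 1 := by
  refine card_image_val _ x (by omega) (fun s hs => eight_range h h' hs) ?_
  intro s hs hsq
  simp [eightF, hs, hsq, hs.ne]

lemma theta_pattern_mem {w : ZMod (2 * n) → Fin N} {x y : ℕ} (h : ThetaOK n x y)
    (hF : ∀ i j, w i = w j ↔ thetaF n x y i.val = thetaF n x y j.val) :
    GoodWalk w ∧ (Finset.univ.image w).card = n - 1 ∧ vdeg w (w 0) = 3 := by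
  have h' := h
  obtain ⟨h1, h2, h3, -⟩ := h'
  refine ⟨goodWalk_of_fun (thetaF n x y) (revS n x y) hF (fun s hs => theta_nb1 h hs)
    (fun s hs => theta_nb2 h hs) (fun s hs => rev_lt h1 h2 h3.le hs)
    (fun s hs => rev_rev h1 h2 h3.le hs) (fun s hs => theta_rev1 h hs), ?_, ?_⟩
  · rw [card_image_of_pattern _ hF, theta_image_card h]
  · rw [vdeg_of_pattern _ hF, ZMod.val_zero,
      card_filter_val (fun s => thetaF n x y s = thetaF n x y 0), Finset.card_eq_three]
    refine ⟨0, x + y, n + x, by omega, by omega, by omega, ?_⟩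
    ext s
    simp only [Finset.mem_filter, Finset.mem_range, Finset.mem_insert, Finset.mem_singleton]
    constructor
    · rintro ⟨hs, hs'⟩
      exact (theta_zero_iff h hs).1 hs'
    · intro hs
      have hs' : s < 2 * n := by omega
      exact ⟨hs', (theta_zero_iff h hs').2 hs⟩

lemma eight_pattern_mem {w : ZMod (2 * n) → Fin N} {x : ℕ} (h : 3 ≤ x) (h' : x + 3 ≤ n)
    (hF : ∀ i j, w i = w j ↔ eightF n x i.val = eightF n x j.val) :
    GoodWalk w ∧ (Finset.univ.image w).card = n - 1 ∧ vdeg w (w 0) = 4 := by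
  refine ⟨goodWalk_of_fun (eightF n x) (revS n x (n - x)) hF (fun s hs => eight_nb1 h h' hs)
    (fun s hs => eight_nb2 h h' hs) (fun s hs => rev_lt (by omega) (by omega) (by omega) hs)
    (fun s hs => rev_rev (by omega) (by omega) (by omega) hs)
    (fun s hs => eight_rev1 h h' hs), ?_, ?_⟩
  · rw [card_image_of_pattern _ hF, eight_image_card h h']
  · rw [vdeg_of_pattern _ hF, ZMod.val_zero,
      card_filter_val (fun s => eightF n x s = eightF n x 0)]
    have : (Finset.range (2 * n)).filter (fun s => eightF n x s = eightF n x 0) =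
        {0, x, n, n + x} := by
      ext s
      simp only [Finset.mem_filter, Finset.mem_range, Finset.mem_insert, Finset.mem_singleton]
      constructor
      · rintro ⟨hs, hs'⟩
        exact (eight_zero_iff h h' hs).1 hs'
      · intro hs
        have hs' : s < 2 * n := by omega
        exact ⟨hs', (eight_zero_iff h h' hs').2 hs⟩
    rw [this, Finset.card_insert_of_notMem, Finset.card_insert_of_notMem,
      Finset.card_insert_of_notMem, Finset.card_singleton] <;> simp <;> omega

lemma exists_theta {w : ZMod (2 * n) → Fin N} (hn : 1 ≤ n) (hw : GoodWalk w)
    (hV : (Finset.univ.image w).card = n - 1) (h3 : vdeg w (w 0) = 3) :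
    ∃ x y, ThetaOK n x y ∧ ∀ i j, w i = w j ↔ thetaF n x y i.val = thetaF n x y j.val := by
  have h0 : lift w 0 = w 0 := by simp [lift]
  obtain ⟨v, hv, hne, huv⟩ : ∃ v, vdeg w v = 3 ∧ lift w 0 ≠ v ∧
      ∀ i, vdeg w (w i) ≠ 2 → w i = lift w 0 ∨ w i = v := by
    rw [h0]
    rcases degree_cases hw hn rfl hV with ⟨u, hu, h⟩ | ⟨u, v, huv, hu, hv, h⟩
    · exfalso
      by_cases hiu : w 0 = u
      · rw [hiu] at h3; omega
      · have := h 0 hiu; omega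
    · by_cases h0u : w 0 = u
      · refine ⟨v, hv, by rw [h0u]; exact huv, fun i hi => ?_⟩
        by_contra hcon
        push Not at hcon
        exact hi (h i (by rw [← h0u]; exact hcon.1) hcon.2)
      · by_cases h0v : w 0 = v
        · refine ⟨u, hu, h0u, fun i hi => ?_⟩
          by_contra hcon
          push Not at hcon
          exact hi (h i hcon.2 (by rw [← h0v]; exact hcon.1))
        · have := h 0 h0u h0v; omega
  obtain ⟨x, y, z, hx, hy, hz, hxyz, e1, e2, e3⟩ := theta_struct hw (n := (n : ℤ)) (by push_cast; ring)
    (by rw [h0]; exact h3) hv hne huv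
  lift x to ℕ using hx.le
  lift y to ℕ using hy.le
  lift z to ℕ using hz.le
  have hxy0 : lift w (x + y) = lift w 0 := by
    have a1 := e1 0 le_rfl (by omega)
    have a2 := e3 0 le_rfl (by omega)
    simp only [sub_zero, add_zero] at a1 a2
    rw [a1, a2]
  have hOK : ThetaOK n x y := by
    refine ⟨by omega, by omega, by omega, ?_, ?_, ?_⟩
    · rintro ⟨rfl, rfl⟩
      apply lift_nb2 hw 0
      rw [← hxy0]; congr 1
    · rintro ⟨rfl, hy1⟩
      apply lift_nb2 hw ((1 : ℕ) + y)
      have a2 := e3 0 le_rfl (by omega)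
      simp only [sub_zero, add_zero] at a2
      rw [← a2]
      congr 1
      push_cast; omega
    · rintro ⟨rfl, hy1⟩
      apply lift_nb2 hw x
      have a1 := e1 x (by omega) le_rfl
      rw [a1]
      congr 1
      push_cast; omega
  refine ⟨x, y, hOK, ?_⟩
  apply pattern_of_rep (fun i : ZMod (2 * n) => thetaF n x y i.val)
  · have key : ∀ s : ℕ, s < 2 * n → lift w s = lift w (thetaF n x y s : ℕ) := by
      intro s hs
      unfold thetaF
      split_ifs with c1 c2 c3 c4
      · rw [c2]; push_cast; exact hxy0
      · rfl
      · have := e1 (n + x - s) (by omega) (by omega)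
        rw [show (n : ℤ) + x - (n + x - s) = s by ring] at this
        rw [← this]; congr 1; omega
      · have := e3 (s - (n + x)) (by omega) (by omega)
        rw [show (n : ℤ) + x + (s - (n + x)) = s by ring] at this
        rw [this]; congr 1; omega
      · have := e2 (2 * n - s) (by omega) (by omega)
        rw [show (2 : ℤ) * n - (2 * n - s) = s by ring] at this
        rw [← this]; congr 1; omega
    intro s
    have := key s.val (ZMod.val_lt s)
    simpa [lift] using this
  · rw [theta_image_card hOK, hV]

lemma exists_eight {w : ZMod (2 * n) → Fin N} (hn : 1 ≤ n) (hw : GoodWalk w)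
    (hV : (Finset.univ.image w).card = n - 1) (h4 : vdeg w (w 0) = 4) :
    ∃ x, 3 ≤ x ∧ x + 3 ≤ n ∧ ∀ i j, w i = w j ↔ eightF n x i.val = eightF n x j.val := by
  have h0 : lift w 0 = w 0 := by simp [lift]
  have huv : ∀ i, vdeg w (w i) ≠ 2 → w i = lift w 0 := by
    rw [h0]
    rcases degree_cases hw hn rfl hV with ⟨u, hu, h⟩ | ⟨u, v, huv, hu, hv, h⟩
    · by_cases hiu : w 0 = u
      · intro i hi
        by_contra hcon
        exact hi (h i (by rw [← hiu]; exact hcon))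
      · have := h 0 hiu; omega
    · exfalso
      by_cases h0u : w 0 = u
      · rw [h0u] at h4; omega
      · by_cases h0v : w 0 = v
        · rw [h0v] at h4; omega
        · have := h 0 h0u h0v; omega
  obtain ⟨x, y, hx, hy, hxy, hx0, e1, e2⟩ := eight_struct hw (n := (n : ℤ)) (by push_cast; ring)
    (by rw [h0]; exact h4) huv
  lift x to ℕ using hx.le
  lift y to ℕ using hy.le
  have hn0 : lift w n = lift w 0 := by
    have := e1 x (by omega) le_rfl
    rw [show (n : ℤ) + x - x = n by ring] at this
    rw [← this, hx0]
  have hx3 : 3 ≤ x := by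
    by_contra hcon
    have : x = 1 ∨ x = 2 := by omega
    rcases this with rfl | rfl
    · exact lift_nb1 hw 0 (by rw [← hx0]; congr 1)
    · exact lift_nb2 hw 0 (by rw [← hx0]; congr 1)
  have hy3 : x + 3 ≤ n := by
    by_contra hcon
    have : y = 1 ∨ y = 2 := by omega
    rcases this with rfl | rfl
    · exact lift_nb1 hw x (by rw [hx0, ← hn0]; congr 1; push_cast at hxy; omega)
    · exact lift_nb2 hw x (by rw [hx0, ← hn0]; congr 1; push_cast at hxy; omega)
  refine ⟨x, hx3, hy3, ?_⟩
  apply pattern_of_rep (fun i : ZMod (2 * n) => eightF n x i.val)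
  · have key : ∀ s : ℕ, s < 2 * n → lift w s = lift w (eightF n x s : ℕ) := by
      intro s hs
      unfold eightF
      split_ifs with c1 c2 c3
      · rcases c1 with rfl | rfl
        · exact_mod_cast hx0
        · exact_mod_cast hn0
      · rfl
      · have := e1 (n + x - s) (by omega) (by omega)
        rw [show (n : ℤ) + x - (n + x - s) = s by ring] at this
        rw [← this]; congr 1; omega
      · have := e2 (2 * n - s) (by omega) (by omega)
        rw [show (2 : ℤ) * n - (2 * n - s) = s by ring] at this
        rw [← this]; congr 1; omega
    intro s
    have := key s.val (ZMod.val_lt s)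
    simpa [lift] using this
  · rw [eight_image_card hx3 hy3, hV]

open Classical in
/-- finite set of theta parameters -/
def thetaParams (n : ℕ) : Finset (ℕ × ℕ) :=
  (Finset.range n ×ˢ Finset.range n).filter fun p => ThetaOK n p.1 p.2

lemma mem_thetaParams {n : ℕ} (p : ℕ × ℕ) : p ∈ thetaParams n ↔ ThetaOK n p.1 p.2 := by
  simp only [thetaParams, Finset.mem_filter, Finset.mem_product, Finset.mem_range,
    and_iff_right_iff_imp]
  rintro ⟨h1, h2, h3, -⟩
  omega

lemma card_triangle (n : ℕ) :
    2 * ((Finset.range n ×ˢ Finset.range n).filter fun p : ℕ × ℕ =>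
      1 ≤ p.1 ∧ 1 ≤ p.2 ∧ p.1 + p.2 < n).card = (n - 1) * (n - 2) := by
  induction n with
  | zero => simp
  | succ n ih =>
    have hsplit : ((Finset.range (n + 1) ×ˢ Finset.range (n + 1)).filter fun p : ℕ × ℕ =>
        1 ≤ p.1 ∧ 1 ≤ p.2 ∧ p.1 + p.2 < n + 1) =
        ((Finset.range n ×ˢ Finset.range n).filter fun p : ℕ × ℕ =>
          1 ≤ p.1 ∧ 1 ≤ p.2 ∧ p.1 + p.2 < n) ∪
        (Finset.Ico 1 n).image (fun x => (x, n - x)) := by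
      ext ⟨a, b⟩
      simp only [Finset.mem_filter, Finset.mem_product, Finset.mem_range, Finset.mem_union,
        Finset.mem_image, Finset.mem_Ico, Prod.mk.injEq]
      constructor
      · rintro ⟨h1, h2, h3, h4⟩
        by_cases h : a + b < n
        · left; omega
        · right; exact ⟨a, by omega, rfl, by omega⟩
      · rintro (h | ⟨x, h1, rfl, rfl⟩) <;> omega
    rw [hsplit, Finset.card_union_of_disjoint, Finset.card_image_of_injective, Nat.card_Ico,
      mul_add, ih]
    · rcases n with _ | _ | n
      · simp
      · simp
      · simp only [Nat.add_sub_cancel, Nat.reduceSubDiff]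
        ring_nf
    · intro a b hab
      simpa using (Prod.ext_iff.1 hab).1
    · rw [Finset.disjoint_left]
      rintro ⟨a, b⟩ h1 h2
      simp only [Finset.mem_filter, Finset.mem_product, Finset.mem_range,
        Finset.mem_image, Finset.mem_Ico, Prod.mk.injEq] at h1 h2
      obtain ⟨x, h3, rfl, rfl⟩ := h2
      omega

lemma card_thetaParams {n : ℕ} (hn : 5 ≤ n) :
    2 * (thetaParams n).card = (n + 1) * (n - 4) := by
  have h := card_triangle n
  have hu : ((Finset.range n ×ˢ Finset.range n).filter fun p : ℕ × ℕ =>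
      1 ≤ p.1 ∧ 1 ≤ p.2 ∧ p.1 + p.2 < n) = thetaParams n ∪ {(1, 1), (1, n - 2), (n - 2, 1)} := by
    ext ⟨a, b⟩
    rw [Finset.mem_union, mem_thetaParams]
    simp only [Finset.mem_filter, Finset.mem_product, Finset.mem_range,
      Finset.mem_insert, Finset.mem_singleton, Prod.mk.injEq, ThetaOK]
    omega
  have hc : ({(1, 1), (1, n - 2), (n - 2, 1)} : Finset (ℕ × ℕ)).card = 3 := by
    rw [Finset.card_eq_three]
    refine ⟨_, _, _, ?_, ?_, ?_, rfl⟩ <;> simp only [ne_eq, Prod.mk.injEq] <;> omega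
  rw [hu, Finset.card_union_of_disjoint, hc] at h
  · obtain ⟨k, rfl⟩ : ∃ k, n = k + 5 := ⟨n - 5, by omega⟩
    simp only [show k + 5 - 1 = k + 4 by omega, show k + 5 - 2 = k + 3 by omega,
      show k + 5 - 4 = k + 1 by omega] at h ⊢
    nlinarith
  · rw [Finset.disjoint_left]
    rintro ⟨a, b⟩ h1 h2
    rw [mem_thetaParams] at h1
    simp only [Finset.mem_insert, Finset.mem_singleton, Prod.mk.injEq, ThetaOK] at h1 h2
    omega

open Classical in
lemma theta_base_count (hn : 1 ≤ n) :
    (Finset.univ.filter fun w : ZMod (2 * n) → Fin N =>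
      GoodWalk w ∧ (Finset.univ.image w).card = n - 1 ∧ vdeg w (w 0) = 3).card =
    (thetaParams n).card * N.descFactorial (n - 1) := by
  have hU : (Finset.univ.filter fun w : ZMod (2 * n) → Fin N =>
      GoodWalk w ∧ (Finset.univ.image w).card = n - 1 ∧ vdeg w (w 0) = 3) =
      (thetaParams n).biUnion fun p => Finset.univ.filter fun w : ZMod (2 * n) → Fin N =>
        ∀ i j, w i = w j ↔ thetaF n p.1 p.2 i.val = thetaF n p.1 p.2 j.val := by
    ext w
    simp only [Finset.mem_biUnion, Finset.mem_filter, Finset.mem_univ, true_and]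
    constructor
    · rintro ⟨h1, h2, h3⟩
      obtain ⟨x, y, hOK, h⟩ := exists_theta hn h1 h2 h3
      exact ⟨(x, y), (mem_thetaParams _).2 hOK, h⟩
    · rintro ⟨p, hp, h⟩
      exact theta_pattern_mem ((mem_thetaParams _).1 hp) h
  rw [hU, Finset.card_biUnion, Finset.sum_const_nat]
  · intro p hp
    have := card_pattern (N := N) (fun i : ZMod (2 * n) => thetaF n p.1 p.2 i.val)
    rw [theta_image_card ((mem_thetaParams _).1 hp)] at this
    convert this
  · rintro ⟨x, y⟩ hp ⟨x', y'⟩ hp' hne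
    rw [Finset.mem_coe, mem_thetaParams] at hp hp'
    change Disjoint _ _
    rw [Finset.disjoint_left]
    intro w h1 h2
    simp only [Finset.mem_filter, Finset.mem_univ, true_and] at h1 h2 hp hp'
    apply hne
    have hk : ∀ s < 2 * n, (s = 0 ∨ s = x + y ∨ s = n + x) → (s = 0 ∨ s = x' + y' ∨ s = n + x') := by
      intro s hs h
      rw [← theta_zero_iff hp hs] at h
      rw [← theta_zero_iff hp' hs]
      have a1 := h1 (s : ZMod (2 * n)) 0
      have a2 := h2 (s : ZMod (2 * n)) 0
      rw [ZMod.val_natCast_of_lt hs, ZMod.val_zero] at a1 a2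
      exact a2.1 (a1.2 h)
    obtain ⟨q1, q2, q3, -⟩ := hp
    obtain ⟨r1, r2, r3, -⟩ := hp'
    have k1 := hk (x + y) (by omega) (by simp)
    have k2 := hk (n + x) (by omega) (by simp)
    rw [Prod.mk.injEq]
    omega

open Classical in
lemma eight_base_count (hn : 5 ≤ n) :
    (Finset.univ.filter fun w : ZMod (2 * n) → Fin N =>
      GoodWalk w ∧ (Finset.univ.image w).card = n - 1 ∧ vdeg w (w 0) = 4).card =
    (n - 5) * N.descFactorial (n - 1) := by
  have hU : (Finset.univ.filter fun w : ZMod (2 * n) → Fin N =>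
      GoodWalk w ∧ (Finset.univ.image w).card = n - 1 ∧ vdeg w (w 0) = 4) =
      (Finset.Ico 3 (n - 2)).biUnion fun x => Finset.univ.filter fun w : ZMod (2 * n) → Fin N =>
        ∀ i j, w i = w j ↔ eightF n x i.val = eightF n x j.val := by
    ext w
    simp only [Finset.mem_biUnion, Finset.mem_filter, Finset.mem_univ, true_and, Finset.mem_Ico]
    constructor
    · rintro ⟨h1, h2, h3⟩
      obtain ⟨x, hx, hx', h⟩ := exists_eight (by omega) h1 h2 h3
      exact ⟨x, by omega, h⟩
    · rintro ⟨x, hx, h⟩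
      exact eight_pattern_mem hx.1 (by omega) h
  rw [hU, Finset.card_biUnion, Finset.sum_const_nat (m := N.descFactorial (n - 1)), Nat.card_Ico,
    show n - 2 - 3 = n - 5 by omega]
  · intro x hx
    rw [Finset.mem_Ico] at hx
    have := card_pattern (N := N) (fun i : ZMod (2 * n) => eightF n x i.val)
    rw [eight_image_card hx.1 (by omega)] at this
    convert this
  · intro x hp x' hp' hne
    rw [Finset.mem_coe, Finset.mem_Ico] at hp hp'
    change Disjoint _ _
    rw [Finset.disjoint_left]
    intro w h1 h2
    simp only [Finset.mem_filter, Finset.mem_univ, true_and] at h1 h2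
    apply hne
    have hk : ∀ s < 2 * n, (s = 0 ∨ s = x ∨ s = n ∨ s = n + x) →
        (s = 0 ∨ s = x' ∨ s = n ∨ s = n + x') := by
      intro s hs h
      rw [← eight_zero_iff hp.1 (by omega) hs] at h
      rw [← eight_zero_iff hp'.1 (by omega) hs]
      have a1 := h1 (s : ZMod (2 * n)) 0
      have a2 := h2 (s : ZMod (2 * n)) 0
      rw [ZMod.val_natCast_of_lt hs, ZMod.val_zero] at a1 a2
      exact a2.1 (a1.2 h)
    have k1 := hk x (by omega) (by simp)
    omega

open Classical in
lemma good_count (hn : 5 ≤ n) :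
    ∃ R : ℕ, R ≤ (n - 2) ^ (2 * n) * N ^ (n - 2) ∧
      6 * (Finset.univ.filter fun w : ZMod (2 * n) → Fin N => GoodWalk w).card =
        (n * ((n + 1) * (n - 4)) + 3 * n * (n - 5)) * N.descFactorial (n - 1) + 6 * R := by
  set G3 := Finset.univ.filter fun w : ZMod (2 * n) → Fin N =>
      GoodWalk w ∧ (Finset.univ.image w).card = n - 1 ∧ ∃ i, vdeg w (w i) = 3 with hG3
  set G4 := Finset.univ.filter fun w : ZMod (2 * n) → Fin N =>
      GoodWalk w ∧ (Finset.univ.image w).card = n - 1 ∧ ∃ i, vdeg w (w i) = 4 with hG4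
  set L := Finset.univ.filter fun w : ZMod (2 * n) → Fin N =>
      GoodWalk w ∧ (Finset.univ.image w).card ≤ n - 2 with hL
  have e3 : 6 * G3.card = 2 * n * ((thetaParams n).card * N.descFactorial (n - 1)) := by
    rw [← theta_base_count (N := N) (by omega)]
    exact double_count (2 * n) N (n - 1) 3 6
      (fun w hw hV h => card_deg_three hw (by omega) rfl hV h)
  have e4 : 4 * G4.card = 2 * n * ((n - 5) * N.descFactorial (n - 1)) := by
    rw [← eight_base_count (N := N) hn]
    exact double_count (2 * n) N (n - 1) 4 4
      (fun w hw hV h => card_deg_four hw (by omega) rfl hV h)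
  have hU : (Finset.univ.filter fun w : ZMod (2 * n) → Fin N => GoodWalk w) = (G3 ∪ G4) ∪ L := by
    ext w
    simp only [hG3, hG4, hL, Finset.mem_union, Finset.mem_filter, Finset.mem_univ, true_and]
    constructor
    · intro hw
      have hlt := image_card_lt hw rfl
      by_cases hV : (Finset.univ.image w).card = n - 1
      · left
        have hex : ∀ u, 0 < vdeg w u → ∃ i, w i = u := by
          intro u hu
          obtain ⟨i, hi⟩ := Finset.card_pos.1 hu
          exact ⟨i, by simpa using hi⟩
        rcases degree_cases hw (by omega) rfl hV with ⟨u, hu, h⟩ | ⟨u, v, huv, hu, hv, h⟩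
        · obtain ⟨i, rfl⟩ := hex u (by omega)
          exact Or.inr ⟨hw, hV, i, hu⟩
        · obtain ⟨i, rfl⟩ := hex u (by omega)
          exact Or.inl ⟨hw, hV, i, hu⟩
      · right
        exact ⟨hw, by omega⟩
    · rintro ((h | h) | h) <;> exact h.1
  have d1 : Disjoint G3 G4 := by
    rw [Finset.disjoint_left]
    intro w h1 h2
    simp only [hG3, hG4, Finset.mem_filter, Finset.mem_univ, true_and] at h1 h2
    obtain ⟨hw, hV, i, hi⟩ := h1
    obtain ⟨-, -, j, hj⟩ := h2
    rcases degree_cases hw (by omega) rfl hV with ⟨u, hu, h⟩ | ⟨u, v, huv, hu, hv, h⟩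
    · by_cases hiu : w i = u
      · rw [hiu] at hi; omega
      · have := h i hiu; omega
    · by_cases hju : w j = u
      · rw [hju] at hj; omega
      · by_cases hjv : w j = v
        · rw [hjv] at hj; omega
        · have := h j hju hjv; omega
  have d2 : Disjoint (G3 ∪ G4) L := by
    rw [Finset.disjoint_left]
    intro w h1 h2
    simp only [hG3, hG4, hL, Finset.mem_union, Finset.mem_filter, Finset.mem_univ, true_and] at h1 h2
    rcases h1 with h1 | h1 <;> omega
  refine ⟨L.card, ?_, ?_⟩
  · refine le_trans (Finset.card_le_card ?_) (card_low_image (2 * n) N (n - 2))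
    intro w hw
    simp only [hL, Finset.mem_filter, Finset.mem_univ, true_and] at hw ⊢
    exact hw.2
  · rw [hU, Finset.card_union_of_disjoint d2, Finset.card_union_of_disjoint d1]
    have hc := card_thetaParams hn
    rw [← hc]
    have : 2 * (6 * G4.card) = 2 * (3 * n * (n - 5) * N.descFactorial (n - 1)) := by
      calc 2 * (6 * G4.card) = 3 * (4 * G4.card) := by ring
        _ = _ := by rw [e4]; ring
    have h6 : 6 * G4.card = 3 * n * (n - 5) * N.descFactorial (n - 1) := by omega
    rw [mul_add, mul_add, e3, h6]
    ring

end Final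

lemma descFactorial_close (N k : ℕ) :
    |(N.descFactorial (k + 1) : ℝ) - (N : ℝ) ^ (k + 1)| ≤ ((k + 1) ^ 2 : ℝ) * (N : ℝ) ^ k := by
  have hle : ∀ j, (N.descFactorial j : ℝ) ≤ (N : ℝ) ^ j := fun j => by
    exact_mod_cast Nat.descFactorial_le_pow N j
  induction k with
  | zero => simp
  | succ k ih =>
    rw [Nat.descFactorial_succ]
    push_cast
    rw [abs_le] at ih ⊢
    have hN : (0 : ℝ) ≤ N := Nat.cast_nonneg N
    have hsub1 : ((N - (k + 1) : ℕ) : ℝ) ≤ N := by exact_mod_cast Nat.sub_le _ _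
    have hsub2 : (N : ℝ) - (k + 1) ≤ ((N - (k + 1) : ℕ) : ℝ) := by
      have : N ≤ (N - (k + 1)) + (k + 1) := by omega
      have : (N : ℝ) ≤ ((N - (k + 1) : ℕ) : ℝ) + (k + 1) := by exact_mod_cast this
      linarith
    have hD := hle (k + 1)
    have hD0 : (0 : ℝ) ≤ (N.descFactorial (k + 1) : ℝ) := Nat.cast_nonneg _
    have hp : (0 : ℝ) ≤ (N : ℝ) ^ (k + 1) := by positivity
    have e1 : (N : ℝ) ^ (k + 1) = N * (N : ℝ) ^ k := by ring
    have e2 : (N : ℝ) ^ (k + 1 + 1) = N * (N : ℝ) ^ (k + 1) := by ring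
    have hk : (0 : ℝ) ≤ k := Nat.cast_nonneg k
    constructor
    · have a1 : ((N : ℝ) - (k + 1)) * (N.descFactorial (k + 1) : ℝ) ≤
          ((N - (k + 1) : ℕ) : ℝ) * (N.descFactorial (k + 1) : ℝ) :=
        mul_le_mul_of_nonneg_right hsub2 hD0
      have a2 : (N : ℝ) * ((N : ℝ) ^ (k + 1) - ((k + 1) ^ 2 : ℝ) * (N : ℝ) ^ k) ≤
          N * (N.descFactorial (k + 1) : ℝ) :=
        mul_le_mul_of_nonneg_left (by linarith [ih.1]) hN
      have a3 : ((k : ℝ) + 1) * (N.descFactorial (k + 1) : ℝ) ≤ (k + 1) * (N : ℝ) ^ (k + 1) :=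
        mul_le_mul_of_nonneg_left hD (by positivity)
      have a4 : 0 ≤ ((k : ℝ) + 2) * (N : ℝ) ^ (k + 1) := by positivity
      rw [e2]
      have a5 : (N : ℝ) * (((k + 1) ^ 2 : ℝ) * (N : ℝ) ^ k) = ((k + 1) ^ 2 : ℝ) * (N : ℝ) ^ (k + 1) := by
        ring
      nlinarith
    · have a1 : ((N - (k + 1) : ℕ) : ℝ) * (N.descFactorial (k + 1) : ℝ) ≤ N * (N : ℝ) ^ (k + 1) :=
        mul_le_mul hsub1 hD hD0 hN
      rw [e2]
      have : 0 ≤ ((k : ℝ) + 1 + 1) ^ 2 * (N : ℝ) ^ (k + 1) := by positivity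
      linarith

/-- for fixed `n ≥ 5`, as `N → ∞`,
`⟨Tr[Y(Φ)^{2n}]⟩ = (n/6)[(n+1)(n−4) + 3(n−5)]·N^{n−1} + O(N^{n−2})`. -/
theorem hashimoto_even_trace_asymptotics (n : ℕ) (hn : 5 ≤ n) :
    ∃ (c : ℝ) (N₀ : ℕ), ∀ N ≥ N₀,
      ‖(∫ ω, Matrix.trace ((hashimoto N (phases N ω)) ^ (2 * n)) ∂(phaseMeasure N))
          - ((n : ℂ) / 6 * (((n : ℂ) + 1) * ((n : ℂ) - 4) + 3 * ((n : ℂ) - 5)))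
            * (N : ℂ) ^ (n - 1)‖
        ≤ c * (N : ℝ) ^ (n - 2) := by
  classical
  haveI : NeZero (2 * n) := ⟨by omega⟩
  set K : ℝ := (n : ℝ) / 6 * (((n : ℝ) + 1) * ((n : ℝ) - 4) + 3 * ((n : ℝ) - 5)) with hK
  have hn5 : (5 : ℝ) ≤ n := by exact_mod_cast hn
  have hK0 : 0 ≤ K := by
    have : 0 ≤ (n : ℝ) - 4 := by linarith
    have : 0 ≤ (n : ℝ) - 5 := by linarith
    positivity
  refine ⟨K * ((n - 2 : ℕ) + 1) ^ 2 + ((n - 2) ^ (2 * n) : ℕ), 0, fun N _ => ?_⟩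
  rw [expected_trace]
  obtain ⟨R, hR, hcount⟩ := good_count (n := n) (N := N) hn
  set G : ℕ := (Finset.univ.filter fun w : ZMod (2 * n) → Fin N => GoodWalk w).card with hG
  have hGr : (G : ℝ) = K * (N.descFactorial (n - 1) : ℝ) + R := by
    have h1 := congrArg (Nat.cast : ℕ → ℝ) hcount
    push_cast [Nat.cast_sub (show 4 ≤ n by omega), Nat.cast_sub hn] at h1
    rw [hK]
    linarith
  have hcast : (G : ℂ) - ((n : ℂ) / 6 * (((n : ℂ) + 1) * ((n : ℂ) - 4) + 3 * ((n : ℂ) - 5)))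
      * (N : ℂ) ^ (n - 1) = (((G : ℝ) - K * (N : ℝ) ^ (n - 1) : ℝ) : ℂ) := by
    rw [hK]; push_cast; ring
  rw [hcast, Complex.norm_real, Real.norm_eq_abs, hGr]
  have hclose := descFactorial_close N (n - 2)
  rw [show n - 2 + 1 = n - 1 by omega] at hclose
  have hRr : (R : ℝ) ≤ ((n - 2) ^ (2 * n) : ℕ) * (N : ℝ) ^ (n - 2) := by exact_mod_cast hR
  calc |K * (N.descFactorial (n - 1) : ℝ) + R - K * (N : ℝ) ^ (n - 1)|
      = |K * ((N.descFactorial (n - 1) : ℝ) - (N : ℝ) ^ (n - 1)) + R| := by congr 1; ring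
    _ ≤ |K * ((N.descFactorial (n - 1) : ℝ) - (N : ℝ) ^ (n - 1))| + |(R : ℝ)| := abs_add_le _ _
    _ = K * |(N.descFactorial (n - 1) : ℝ) - (N : ℝ) ^ (n - 1)| + R := by
        rw [abs_mul, abs_of_nonneg hK0, abs_of_nonneg (show (0:ℝ) ≤ (R:ℝ) from Nat.cast_nonneg R)]
    _ ≤ K * ((((n - 2 : ℕ) : ℝ) + 1) ^ 2 * (N : ℝ) ^ (n - 2)) +
        ((n - 2) ^ (2 * n) : ℕ) * (N : ℝ) ^ (n - 2) := by
        gcongr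
    _ = _ := by ring
end
end

section
/- Let N ≥ 3, let M be a UME matrix and W = M/(2√(N−2)). For every n with 1 ≤ n ≤ 4, the expected trace of the Chebyshev polynomial of even degree 2n satisfies the exact identity ⟨Tr[T_{2n}(W)]⟩ = −(N/2) · (N−3)/(N−2)^n. -/
open MeasureTheory Matrix

noncomputable section

/-- The scaled UME matrix `W = M / (2√(N−2))`. -/
def scaledUme (N : ℕ) (φ : Fin N → Fin N → ℝ) : Matrix (Fin N) (Fin N) ℂ :=
  ((1 / (2 * Real.sqrt ((N : ℝ) - 2)) : ℝ) : ℂ) • umeMatrix N φ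

/-- `Tr[T_n(W)]`, the trace of the `n`-th Chebyshev polynomial of the first kind evaluated
at the scaled UME matrix `W = M/(2√(N−2))`. -/
def chebTrace (N : ℕ) (φ : Fin N → Fin N → ℝ) (n : ℕ) : ℂ :=
  Matrix.trace (Polynomial.aeval (scaledUme N φ) (Polynomial.Chebyshev.T ℂ n))

/-- Integrable functions of the raw sample with vanishing expectation. -/
def ZeroMean (N : ℕ) (f : (Fin N → Fin N → ℝ) → ℂ) : Prop :=
  Integrable f (phaseMeasure N) ∧ ∫ ω, f ω ∂(phaseMeasure N) = 0

/-- Entries of the UME matrix as functions of the raw sample. -/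
def ent (N : ℕ) (ω : Fin N → Fin N → ℝ) (a b : Fin N) : ℂ := umeMatrix N (phases N ω) a b

lemma ent_self (N : ℕ) (ω : Fin N → Fin N → ℝ) (a : Fin N) : ent N ω a a = 0 := by
  simp [ent, umeMatrix]

lemma ent_mul_swap (N : ℕ) (ω : Fin N → Fin N → ℝ) (a b : Fin N) (h : a ≠ b) :
    ent N ω a b * ent N ω b a = 1 := by
  rcases lt_or_gt_of_ne h with h' | h'
  · simp [ent, umeMatrix, phases, h, h.symm, h', h'.not_gt, ← Complex.exp_add]
  · simp [ent, umeMatrix, phases, h, h.symm, h', h'.not_gt, ← Complex.exp_add]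

instance inst_s9 : IsProbabilityMeasure uniformPhase := by
  constructor
  have h : (0:ℝ) < 2 * Real.pi := by positivity
  simp only [uniformPhase, Measure.smul_apply, Measure.restrict_apply MeasurableSet.univ,
    Set.univ_inter, Real.volume_Ico, sub_zero, smul_eq_mul]
  exact ENNReal.inv_mul_cancel (by simpa using h) ENNReal.ofReal_ne_top

lemma integral_exp_int (n : ℤ) (hn : n ≠ 0) :
    ∫ x, Complex.exp (Complex.I * (n * (x : ℂ))) ∂uniformPhase = 0 := by
  have h : (0:ℝ) ≤ 2 * Real.pi := by positivity
  have hc : (Complex.I * n : ℂ) ≠ 0 := mul_ne_zero Complex.I_ne_zero (by exact_mod_cast hn)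
  rw [uniformPhase, integral_smul_measure, integral_Ico_eq_integral_Ioc,
    ← intervalIntegral.integral_of_le h]
  simp_rw [← mul_assoc]
  rw [integral_exp_mul_complex hc]
  have : Complex.exp (Complex.I * n * ((2 * Real.pi : ℝ) : ℂ)) = 1 := by
    rw [Complex.exp_eq_one_iff]
    exact ⟨n, by push_cast; ring⟩
  rw [this]; simp

/-- Exponent of the phase `ω c d` in a product of entries. -/
def expo {N : ℕ} (L : List (Fin N × Fin N)) (c d : Fin N) : ℤ :=
  if c < d then (L.count (c, d) : ℤ) - L.count (d, c) else 0

lemma ent_single {N : ℕ} (ω : Fin N → Fin N → ℝ) (a b : Fin N) (h : a ≠ b) :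
    ent N ω a b = ∏ c, ∏ d, Complex.exp (Complex.I * ((expo [(a, b)] c d : ℤ) * (ω c d : ℂ))) := by
  simp_rw [← Complex.exp_sum, ← Finset.mul_sum]
  simp only [ent, umeMatrix, h, if_false]
  congr 2
  rcases lt_or_gt_of_ne h with h' | h'
  · rw [Finset.sum_eq_single a, Finset.sum_eq_single b]
    · simp [expo, phases, h', h]
    · intro d _ hd
      by_cases had : a < d
      · have : (a, b) ≠ (d, a) := by rintro ⟨⟩; exact h rfl
        simp [expo, hd.symm, h.symm, List.count_cons]
      · simp [expo, had]
    · simp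
    · intro c _ hc
      apply Finset.sum_eq_zero
      intro d _
      by_cases hcd : c < d
      · have : ¬ (a = d ∧ b = c) := by rintro ⟨rfl, rfl⟩; exact absurd hcd h'.not_gt
        simp [expo, hc.symm, List.count_cons, this]
      · simp [expo, hcd]
    · simp
  · rw [Finset.sum_eq_single b, Finset.sum_eq_single a]
    · simp [expo, phases, h', h, h'.not_gt, List.count_cons]
    · intro d _ hd
      simp [expo, hd.symm, h, List.count_cons]
    · simp
    · intro c _ hc
      apply Finset.sum_eq_zero
      intro d _
      by_cases hcd : c < d
      · have : ¬ (a = c ∧ b = d) := by rintro ⟨rfl, rfl⟩; exact absurd hcd h'.not_gt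
        simp [expo, hc.symm, List.count_cons, this]
      · simp [expo, hcd]
    · simp

lemma ent_prod {N : ℕ} (ω : Fin N → Fin N → ℝ) (L : List (Fin N × Fin N))
    (hL : ∀ e ∈ L, e.1 ≠ e.2) :
    (L.map fun e => ent N ω e.1 e.2).prod
      = ∏ c, ∏ d, Complex.exp (Complex.I * ((expo L c d : ℤ) * (ω c d : ℂ))) := by
  induction L with
  | nil => simp [expo]
  | cons e L ih =>
    rw [List.map_cons, List.prod_cons, ih (fun e he => hL e (List.mem_cons_of_mem _ he)),
      ent_single ω _ _ (hL e List.mem_cons_self)]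
    simp_rw [← Finset.prod_mul_distrib, ← Complex.exp_add]
    refine Finset.prod_congr rfl fun c _ => Finset.prod_congr rfl fun d _ => ?_
    congr 1
    rw [← mul_add, ← add_mul]
    congr 2
    by_cases hcd : c < d
    · simp only [expo, hcd, if_true, List.count_cons, List.count_nil]
      push_cast
      ring
    · simp [expo, hcd]

lemma zeroMean_mono {N : ℕ} (L : List (Fin N × Fin N))
    (h : (∀ e ∈ L, e.1 ≠ e.2) → ∃ e ∈ L, (e.2, e.1) ∉ L) :
    ZeroMean N (fun ω => (L.map fun e => ent N ω e.1 e.2).prod) := by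
  by_cases hL : ∀ e ∈ L, e.1 ≠ e.2
  · obtain ⟨⟨a, b⟩, he, hne⟩ := h hL
    have hab : a ≠ b := hL _ he
    simp only at hne
    simp_rw [fun ω => ent_prod (N := N) ω L hL]
    constructor
    · refine Integrable.of_bound (C := 1) (Continuous.aestronglyMeasurable (by fun_prop)) ?_
      refine Filter.Eventually.of_forall fun ω => le_of_eq ?_
      simp_rw [norm_prod]
      refine Finset.prod_eq_one fun c _ => Finset.prod_eq_one fun d _ => ?_
      rw [mul_comm]
      exact_mod_cast Complex.norm_exp_ofReal_mul_I ((expo L c d : ℝ) * ω c d)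
    · rw [phaseMeasure, integral_fintype_prod_eq_prod (𝕜 := ℂ)
        (f := fun c (x : Fin N → ℝ) => ∏ d, Complex.exp (Complex.I * ((expo L c d : ℤ) * (x d : ℂ))))]
      have key : ∀ c d, expo L c d ≠ 0 → ∏ c, ∫ x : Fin N → ℝ,
          ∏ d, Complex.exp (Complex.I * ((expo L c d : ℤ) * (x d : ℂ)))
            ∂(Measure.pi fun _ => uniformPhase) = 0 := by
        intro c d hcd
        apply Finset.prod_eq_zero (Finset.mem_univ c)
        rw [integral_fintype_prod_eq_prod (𝕜 := ℂ)
          (f := fun d (x : ℝ) => Complex.exp (Complex.I * ((expo L c d : ℤ) * (x : ℂ))))]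
        apply Finset.prod_eq_zero (Finset.mem_univ d)
        exact integral_exp_int _ hcd
      have h1 : 0 < L.count (a, b) := List.count_pos_iff.2 he
      have h2 : L.count (b, a) = 0 := List.count_eq_zero.2 hne
      rcases lt_or_gt_of_ne hab with h' | h'
      · apply key a b
        simp only [expo, h', if_true, h2]; omega
      · apply key b a
        simp only [expo, h', if_true, h2]; omega
  · push Not at hL
    obtain ⟨e, he, hee⟩ := hL
    have : (fun ω => (L.map fun e => ent N ω e.1 e.2).prod) = fun _ => (0:ℂ) := by
      funext ω
      apply List.prod_eq_zero
      rw [List.mem_map]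
      exact ⟨e, he, by rw [hee, ent_self]⟩
    rw [this]
    simp [ZeroMean]

lemma zeroMean_zero (N : ℕ) : ZeroMean N (fun _ => 0) := by simp [ZeroMean]

lemma zeroMean_sum {N : ℕ} {ι : Type} (s : Finset ι) (f : ι → (Fin N → Fin N → ℝ) → ℂ)
    (h : ∀ i ∈ s, ZeroMean N (f i)) : ZeroMean N (fun ω => ∑ i ∈ s, f i ω) := by
  constructor
  · exact integrable_finsetSum s fun i hi => (h i hi).1
  · rw [integral_finsetSum s fun i hi => (h i hi).1]
    exact Finset.sum_eq_zero fun i hi => (h i hi).2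

/-- Sum of weights of non-backtracking walks of length `k + 1` from `x` to `y` with first step
to `z`. -/
def nbF (N : ℕ) (ω : Fin N → Fin N → ℝ) : ℕ → Fin N → Fin N → Fin N → ℂ
  | 0, x, z, y => if z = y then ent N ω x z else 0
  | k + 1, x, z, y => ent N ω x z * ∑ w, if w = x then 0 else nbF N ω k z w y

/-- Matrix of non-backtracking walk sums of length `k + 1`. -/
def nbA (N : ℕ) (ω : Fin N → Fin N → ℝ) (k : ℕ) : Matrix (Fin N) (Fin N) ℂ :=
  fun x y => ∑ z, nbF N ω k x z y

lemma nbF_succ (N : ℕ) (ω : Fin N → Fin N → ℝ) (k : ℕ) (x z y : Fin N) :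
    nbF N ω (k + 1) x z y = ent N ω x z * (nbA N ω k z y - nbF N ω k z x y) := by
  have : ∀ w, (if w = x then 0 else nbF N ω k z w y)
      = nbF N ω k z w y - if w = x then nbF N ω k z w y else 0 := by
    intro w; split_ifs <;> simp
  simp [nbF, nbA, this, Finset.sum_sub_distrib]

lemma nbF_self (N : ℕ) (ω : Fin N → Fin N → ℝ) (k : ℕ) (x y : Fin N) :
    nbF N ω k x x y = 0 := by
  cases k <;> simp [nbF, ent_self]

/-- The UME matrix of the sample. -/
def entM (N : ℕ) (ω : Fin N → Fin N → ℝ) : Matrix (Fin N) (Fin N) ℂ :=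
  umeMatrix N (phases N ω)

lemma nbA_zero (N : ℕ) (ω : Fin N → Fin N → ℝ) : nbA N ω 0 = entM N ω := by
  ext x y
  simp [nbA, nbF, entM, ent]

lemma nbA_one (N : ℕ) (ω : Fin N → Fin N → ℝ) :
    nbA N ω 1 = entM N ω * entM N ω - ((N : ℂ) - 1) • (1 : Matrix (Fin N) (Fin N) ℂ) := by
  ext x y
  have h0 : nbA N ω 1 x y = ∑ z, nbF N ω 1 x z y := rfl
  rw [h0]
  simp_rw [nbF_succ N ω 0, mul_sub, Finset.sum_sub_distrib, nbA_zero]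
  rw [Matrix.sub_apply, Matrix.mul_apply]
  congr 1
  have : ∀ z, ent N ω x z * nbF N ω 0 z x y = (if x = y then 1 else 0) -
      (if z = x then (if x = y then 1 else 0) else 0) := by
    intro z
    by_cases hz : z = x
    · subst hz; simp [nbF_self]
    · by_cases hxy : x = y
      · simp only [nbF, hxy, if_true]
        subst hxy
        simp [hz, ent_mul_swap N ω x z (Ne.symm hz)]
      · simp [nbF, hxy]
  simp_rw [this, Finset.sum_sub_distrib]
  by_cases hxy : x = y <;> simp [hxy]

lemma nbA_rec (N : ℕ) (ω : Fin N → Fin N → ℝ) (k : ℕ) :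
    nbA N ω (k + 2) = entM N ω * nbA N ω (k + 1) - ((N : ℂ) - 2) • nbA N ω k := by
  ext x y
  have h0 : nbA N ω (k + 2) x y = ∑ z, nbF N ω (k + 1 + 1) x z y := rfl
  rw [h0]
  simp_rw [nbF_succ N ω (k + 1), mul_sub, Finset.sum_sub_distrib]
  rw [Matrix.sub_apply, Matrix.mul_apply]
  congr 1
  have : ∀ z, ent N ω x z * nbF N ω (k + 1) z x y = (nbA N ω k x y - nbF N ω k x z y) -
      (if z = x then nbA N ω k x y else 0) := by
    intro z
    by_cases hz : z = x
    · subst hz; simp [nbF_self]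
    · rw [nbF_succ, ← mul_assoc, ent_mul_swap N ω x z (Ne.symm hz)]; simp [hz]
  simp_rw [this, Finset.sum_sub_distrib]
  have h1 : ∑ z, nbF N ω k x z y = nbA N ω k x y := rfl
  rw [h1]
  simp
  ring

/-- A prefix of edges followed by a non-backtracking sum. -/
def preF (N : ℕ) (L : List (Fin N × Fin N)) (k : ℕ) (x z y : Fin N) : Prop :=
  ZeroMean N (fun ω => (L.map fun e => ent N ω e.1 e.2).prod * nbF N ω k x z y)

lemma preF_zero {N : ℕ} (L : List (Fin N × Fin N)) (x y z : Fin N)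
    (h : z = y → ZeroMean N (fun ω => ((L ++ [(x, z)]).map fun e => ent N ω e.1 e.2).prod)) :
    preF N L 0 x z y := by
  unfold preF
  by_cases hz : z = y
  · simpa [nbF, hz] using h hz
  · simp [nbF, hz, zeroMean_zero]

lemma preF_succ {N : ℕ} (L : List (Fin N × Fin N)) (k : ℕ) (x y z : Fin N)
    (h : ∀ w, w ≠ x → preF N (L ++ [(x, z)]) k z w y) :
    preF N L (k + 1) x z y := by
  unfold preF
  have : (fun ω => (L.map fun e => ent N ω e.1 e.2).prod * nbF N ω (k + 1) x z y)
      = fun ω => ∑ w, if w = x then 0 else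
        ((L ++ [(x, z)]).map fun e => ent N ω e.1 e.2).prod * nbF N ω k z w y := by
    funext ω
    simp [nbF, Finset.mul_sum, mul_assoc]
  rw [this]
  apply zeroMean_sum
  intro w _
  by_cases hw : w = x
  · simp [hw, zeroMean_zero]
  · simpa [hw, preF] using h w hw

lemma zeroMean_trace {N : ℕ} (k : ℕ) (h : ∀ x z, preF N [] k x z x) :
    ZeroMean N (fun ω => (nbA N ω k).trace) := by
  have : (fun ω => (nbA N ω k).trace) = fun ω => ∑ x, ∑ z, nbF N ω k x z x := by
    funext ω; rfl
  rw [this]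
  refine zeroMean_sum _ _ fun x _ => zeroMean_sum _ _ fun z _ => ?_
  simpa [preF] using h x z

/-- Removing a tail from a monomial. -/
lemma zeroMean_tail {N : ℕ} (a b : Fin N) (L : List (Fin N × Fin N))
    (h : ZeroMean N (fun ω => (L.map fun e => ent N ω e.1 e.2).prod)) :
    ZeroMean N (fun ω => (((a, b) :: (L ++ [(b, a)])).map fun e => ent N ω e.1 e.2).prod) := by
  by_cases hab : a = b
  · subst hab
    simp [ent_self, zeroMean_zero]
  · convert h using 2 with ω
    simp only [List.map_cons, List.map_append, List.map_nil, List.prod_cons, List.prod_append,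
      List.prod_nil, mul_one]
    linear_combination (L.map fun e => ent N ω e.1 e.2).prod * ent_mul_swap N ω a b hab

lemma mono4 {N : ℕ} (a b c d : Fin N) (h1 : c ≠ a) (h2 : d ≠ b) :
    ZeroMean N (fun ω => ([(a, b), (b, c), (c, d), (d, a)].map fun e => ent N ω e.1 e.2).prod) := by
  apply zeroMean_mono
  intro hL
  simp only [List.forall_mem_cons] at hL
  obtain ⟨n1, n2, n3, n4, -⟩ := hL
  refine ⟨(a, b), by simp, ?_⟩
  simp only [List.mem_cons, Prod.mk.injEq, List.not_mem_nil]
  grind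

lemma mono6 {N : ℕ} (a b c d e f : Fin N) (h1 : c ≠ a) (h2 : d ≠ b) (h3 : e ≠ c) (h4 : f ≠ d)
    (h5 : a ≠ e) :
    ZeroMean N (fun ω => ([(a, b), (b, c), (c, d), (d, e), (e, f), (f, a)].map
      fun e => ent N ω e.1 e.2).prod) := by
  by_cases hf : f = b
  · subst hf
    exact zeroMean_tail a f [(f, c), (c, d), (d, e), (e, f)] (mono4 f c d e h2 h3)
  apply zeroMean_mono
  intro hL
  simp only [List.forall_mem_cons] at hL
  obtain ⟨n1, n2, n3, n4, n5, n6, -⟩ := hL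
  refine ⟨(a, b), by simp, ?_⟩
  simp only [List.mem_cons, Prod.mk.injEq, List.not_mem_nil]
  grind

lemma mono8 {N : ℕ} (a b c d e f g h : Fin N) (h1 : c ≠ a) (h2 : d ≠ b) (h3 : e ≠ c)
    (h4 : f ≠ d) (h5 : g ≠ e) (h6 : h ≠ f) (h7 : a ≠ g) :
    ZeroMean N (fun ω => ([(a, b), (b, c), (c, d), (d, e), (e, f), (f, g), (g, h), (h, a)].map
      fun e => ent N ω e.1 e.2).prod) := by
  by_cases hh : h = b
  · subst hh
    exact zeroMean_tail a h [(h, c), (c, d), (d, e), (e, f), (f, g), (g, h)]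
      (mono6 h c d e f g h2 h3 h4 h5 h6)
  apply zeroMean_mono
  intro hL
  simp only [List.forall_mem_cons] at hL
  obtain ⟨n1, n2, n3, n4, n5, n6, n7, n8, -⟩ := hL
  by_contra! hc
  simp only [List.forall_mem_cons] at hc
  simp only [List.mem_cons, Prod.mk.injEq, List.not_mem_nil] at hc
  obtain ⟨c1, c2, c3, c4, c5, c6, c7, c8, -⟩ := hc
  have e1 : e = b ∧ f = a := by grind
  have e2 : f = c ∧ g = b := by grind
  have e3 : g = d ∧ h = c := by grind
  grind

lemma trace2 (N : ℕ) : ZeroMean N (fun ω => (nbA N ω 1).trace) := by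
  apply zeroMean_trace
  intro x z
  apply preF_succ; intro w hw
  apply preF_zero; intro h
  exact absurd h hw

lemma trace4 (N : ℕ) : ZeroMean N (fun ω => (nbA N ω 3).trace) := by
  apply zeroMean_trace
  intro a b
  apply preF_succ; intro c h1
  apply preF_succ; intro d h2
  apply preF_succ; intro a' h3
  apply preF_zero; rintro rfl
  exact mono4 _ b c d h1 h2

lemma trace6 (N : ℕ) : ZeroMean N (fun ω => (nbA N ω 5).trace) := by
  apply zeroMean_trace
  intro a b
  apply preF_succ; intro c h1
  apply preF_succ; intro d h2
  apply preF_succ; intro e h3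
  apply preF_succ; intro f h4
  apply preF_succ; intro a' h5
  apply preF_zero; rintro rfl
  exact mono6 _ b c d e f h1 h2 h3 h4 h5

lemma trace8 (N : ℕ) : ZeroMean N (fun ω => (nbA N ω 7).trace) := by
  apply zeroMean_trace
  intro a b
  apply preF_succ; intro c h1
  apply preF_succ; intro d h2
  apply preF_succ; intro e h3
  apply preF_succ; intro f h4
  apply preF_succ; intro g h5
  apply preF_succ; intro h h6
  apply preF_succ; intro a' h7
  apply preF_zero; rintro rfl
  exact mono8 _ b c d e f g h h1 h2 h3 h4 h5 h6 h7

open Polynomial in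
/-- Polynomials giving the non-backtracking walk matrices. -/
def nbP (q : ℂ) : ℕ → Polynomial ℂ
  | 0 => X
  | 1 => X * X - C (q + 1)
  | k + 2 => X * nbP q (k + 1) - C q * nbP q k

lemma nbA_eq (N : ℕ) (ω : Fin N → Fin N → ℝ) : ∀ k,
    nbA N ω k = Polynomial.aeval (entM N ω) (nbP ((N : ℂ) - 2) k)
  | 0 => by simp [nbA_zero, nbP]
  | 1 => by
    rw [nbA_one, nbP, map_sub, map_mul, Polynomial.aeval_X, Polynomial.aeval_C,
      Algebra.algebraMap_eq_smul_one]
    congr 2; ring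
  | k + 2 => by
    rw [nbA_rec, nbP, map_sub, map_mul, map_mul, Polynomial.aeval_X, Polynomial.aeval_C,
      nbA_eq N ω k, nbA_eq N ω (k + 1), Algebra.algebraMap_eq_smul_one, smul_one_mul]

open Polynomial in
lemma cheb_comp (q c : ℂ) (hc : 4 * q * c ^ 2 = 1) (n : ℕ) (h1 : 1 ≤ n) (h4 : n ≤ 4) :
    C (2 * q ^ n) * (Chebyshev.T ℂ ((2 * n : ℕ) : ℤ)).comp (C c * X)
      = nbP q (2 * n - 1)
        - C (q - 1) * (∑ j ∈ Finset.range (n - 1), nbP q (2 * j + 1)) - C (q - 1) := by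
  have c4 : (C 4 : ℂ[X]) = 4 := map_ofNat C 4
  have c2 : (C 2 : ℂ[X]) = 2 := map_ofNat C 2
  have hC : 4 * C q * C c ^ 2 = 1 := by
    have := congrArg (C : ℂ → ℂ[X]) hc
    rwa [C_mul, C_mul, C_pow, c4, C_1] at this
  have t : ∀ m : ℤ, (Chebyshev.T ℂ (m + 2)).comp (C c * X)
      = 2 * (C c * X) * (Chebyshev.T ℂ (m + 1)).comp (C c * X)
        - (Chebyshev.T ℂ m).comp (C c * X) := by
    intro m
    rw [Chebyshev.T_add_two]; simp
  have t0 : (Chebyshev.T ℂ 0).comp (C c * X) = 1 := by simp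
  have t1 : (Chebyshev.T ℂ 1).comp (C c * X) = C c * X := by simp
  have t2 := t 0
  have t3 := t 1
  have t4 := t 2
  have t5 := t 3
  have t6 := t 4
  have t7 := t 5
  have t8 := t 6
  norm_num only at t2 t3 t4 t5 t6 t7 t8
  rw [t0, t1] at t2
  rw [t1, t2] at t3
  rw [t2, t3] at t4
  rw [t3, t4] at t5
  rw [t4, t5] at t6
  rw [t5, t6] at t7
  rw [t6, t7] at t8
  have p2 : C (2 * q ^ n) = 2 * C q ^ n := by rw [C_mul, C_pow, c2]
  have pe : C (q + 1) = C q + 1 := by simp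
  have pm : C (q - 1) = C q - 1 := by simp
  have hs : 4 * C q * (C c * X) ^ 2 = X ^ 2 := by linear_combination X ^ 2 * hC
  have hs2 : (4 * C q * (C c * X) ^ 2) ^ 2 = (X ^ 2) ^ 2 := by rw [hs]
  have hs3 : (4 * C q * (C c * X) ^ 2) ^ 3 = (X ^ 2) ^ 3 := by rw [hs]
  have hs4 : (4 * C q * (C c * X) ^ 2) ^ 4 = (X ^ 2) ^ 4 := by rw [hs]
  rw [p2, pm]
  have h : n = 1 ∨ n = 2 ∨ n = 3 ∨ n = 4 := by omega
  rcases h with rfl | rfl | rfl | rfl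
  · simp only [Nat.reduceMul, Nat.reduceSub, Nat.cast_ofNat, t2, Finset.sum_range_zero, nbP, pe]
    linear_combination hs
  · simp only [Nat.reduceMul, Nat.reduceSub, Nat.cast_ofNat, t4, Finset.sum_range_succ,
      Finset.sum_range_zero, Nat.reduceAdd, nbP, pe]
    linear_combination hs2 - 4 * C q * hs
  · simp only [Nat.reduceMul, Nat.reduceSub, Nat.cast_ofNat, t6, Finset.sum_range_succ,
      Finset.sum_range_zero, Nat.reduceAdd, nbP, pe]
    linear_combination hs3 - 6 * C q * hs2 + 9 * C q ^ 2 * hs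
  · simp only [Nat.reduceMul, Nat.reduceSub, Nat.cast_ofNat, t8, Finset.sum_range_succ,
      Finset.sum_range_zero, Nat.reduceAdd, nbP, pe]
    linear_combination hs4 - 8 * C q * hs3 + 20 * C q ^ 2 * hs2 - 16 * C q ^ 3 * hs

lemma zeroMean_nbA (N j : ℕ) (hj : j ≤ 3) : ZeroMean N (fun ω => (nbA N ω (2 * j + 1)).trace) := by
  have h : j = 0 ∨ j = 1 ∨ j = 2 ∨ j = 3 := by omega
  rcases h with rfl | rfl | rfl | rfl
  · exact trace2 N
  · exact trace4 N
  · exact trace6 N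
  · exact trace8 N

lemma chebTrace_eq (N : ℕ) (hN : 3 ≤ N) (n : ℕ) (h1 : 1 ≤ n) (h4 : n ≤ 4)
    (ω : Fin N → Fin N → ℝ) :
    chebTrace N (phases N ω) (2 * n) = (2 * ((N : ℂ) - 2) ^ n)⁻¹ *
      ((nbA N ω (2 * (n - 1) + 1)).trace
        - ((N : ℂ) - 3) * (∑ j ∈ Finset.range (n - 1), (nbA N ω (2 * j + 1)).trace)
        - ((N : ℂ) - 3) * N) := by
  have hN' : (3:ℝ) ≤ N := by exact_mod_cast hN
  have hq0 : ((N : ℝ) - 2) ≠ 0 := by linarith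
  have hq : ((N : ℂ) - 2) ≠ 0 := by exact_mod_cast hq0
  set c : ℂ := ((1 / (2 * Real.sqrt ((N : ℝ) - 2)) : ℝ) : ℂ) with hcdef
  have hc : 4 * ((N : ℂ) - 2) * c ^ 2 = 1 := by
    have : 4 * ((N : ℝ) - 2) * (1 / (2 * Real.sqrt ((N : ℝ) - 2))) ^ 2 = 1 := by
      rw [div_pow, mul_pow, Real.sq_sqrt (by linarith)]
      field_simp
      norm_num
    rw [hcdef]
    exact_mod_cast this
  have key := congrArg (fun p => (Polynomial.aeval (entM N ω) p).trace)
    (cheb_comp ((N : ℂ) - 2) c hc n h1 h4)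
  have hidx : 2 * n - 1 = 2 * (n - 1) + 1 := by omega
  have hW : Polynomial.aeval (entM N ω) (Polynomial.C c * Polynomial.X)
      = scaledUme N (phases N ω) := by
    rw [map_mul, Polynomial.aeval_C, Polynomial.aeval_X, Algebra.algebraMap_eq_smul_one,
      smul_one_mul]
    rfl
  have hsub : (N : ℂ) - 2 - 1 = N - 3 := by ring
  have hCm : ∀ (a : ℂ) (p : Polynomial ℂ), (Polynomial.aeval (entM N ω) (Polynomial.C a * p)).trace
      = a * (Polynomial.aeval (entM N ω) p).trace := by
    intro a p
    rw [map_mul, Polynomial.aeval_C, Algebra.algebraMap_eq_smul_one, smul_one_mul,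
      Matrix.trace_smul, smul_eq_mul]
  have hC1 : ∀ a : ℂ, (Polynomial.aeval (entM N ω) (Polynomial.C a)).trace = a * N := by
    intro a
    rw [Polynomial.aeval_C, Algebra.algebraMap_eq_smul_one, Matrix.trace_smul, smul_eq_mul,
      Matrix.trace_one, Fintype.card_fin]
  rw [map_sub (Polynomial.aeval (R := ℂ) (entM N ω)), map_sub (Polynomial.aeval (R := ℂ) (entM N ω)),
    Matrix.trace_sub, Matrix.trace_sub, hCm, hCm, hC1, Polynomial.aeval_comp, hW,
    map_sum (Polynomial.aeval (R := ℂ) (entM N ω)), Matrix.trace_sum, hsub, hidx] at key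
  simp only [← nbA_eq] at key
  rw [← key, chebTrace, inv_mul_cancel_left₀ (mul_ne_zero two_ne_zero (pow_ne_zero n hq))]

/-- for `N ≥ 3` and `1 ≤ n ≤ 4`, the exact identity
`⟨Tr[T_{2n}(W)]⟩ = −(N/2)·(N−3)/(N−2)^n` holds, where `W = M/(2√(N−2))`. -/
theorem cheb_trace_low_expectation (N : ℕ) (hN : 3 ≤ N) (n : ℕ) (h1 : 1 ≤ n) (h4 : n ≤ 4) :
    (∫ ω, chebTrace N (phases N ω) (2 * n) ∂(phaseMeasure N))
      = -((N : ℂ) / 2) * ((N : ℂ) - 3) / ((N : ℂ) - 2) ^ n := by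
  simp_rw [fun ω => chebTrace_eq N hN n h1 h4 ω]
  have hA := zeroMean_nbA N (n - 1) (by omega)
  have hS := zeroMean_sum (Finset.range (n - 1)) (fun j ω => (nbA N ω (2 * j + 1)).trace)
    (fun j hj => zeroMean_nbA N j (by have := Finset.mem_range.1 hj; omega))
  have hD : ∫ ω, ((nbA N ω (2 * (n - 1) + 1)).trace
      - ((N : ℂ) - 3) * (∑ j ∈ Finset.range (n - 1), (nbA N ω (2 * j + 1)).trace))
        ∂(phaseMeasure N) = 0 := by
    rw [integral_sub hA.1 (hS.1.const_mul _), integral_const_mul, hA.2, hS.2]; simp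
  have hI : Integrable (fun ω => (nbA N ω (2 * (n - 1) + 1)).trace
      - ((N : ℂ) - 3) * (∑ j ∈ Finset.range (n - 1), (nbA N ω (2 * j + 1)).trace))
        (phaseMeasure N) := hA.1.sub (hS.1.const_mul _)
  rw [integral_const_mul, integral_sub hI (integrable_const _), hD]
  simp
  ring
end
end
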